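/- Let n ≥ 3 and let 0 ≤ a < (n-2)/2, 0 < b, a ≤ b < a+1, p = 2n/(n-2+2(b-a)), ν > 0, α, β > 1 with α + β = p. Let (u, v) be a positive finite-energy solution of the Hénon–Sobolev system (S). Then there exists τ > 0 such that, setting ũ(x) = τ^{(n-2-2a)/2} u(τx) and ṽ(x) = τ^{(n-2-2a)/2} v(τx), one has the modified inversion symmetry ũ(x/|x|²) = |x|^{n-2-2a} ũ(x) and ṽ(x/|x|²) = |x|^{n-2-2a} ṽ(x) for all x ≠ 0; moreover, for any fixed unit vector e ∈ ℝⁿ, the function t ↦ e^{-((n-2-2a)/2)t} ũ(e^{-t} e) is even on ℝ and strictly decreasing on (0, ∞), and the same holds for ṽ. -/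

import Mathlib

open MeasureTheory Real Filter Topology

noncomputable section

/-- Coordinate Laplacian on Euclidean space. -/
def lapl {n : ℕ} (w : EuclideanSpace ℝ (Fin n) → ℝ) (x : EuclideanSpace ℝ (Fin n)) : ℝ :=
  ∑ i : Fin n, fderiv ℝ (fun y => fderiv ℝ w y (EuclideanSpace.single i 1)) x
    (EuclideanSpace.single i 1)

/-- The weighted divergence `div(|x|^(-2a) ∇w)(x) = |x|^(-2a) (Δw(x) - 2a⟨x,∇w(x)⟩/|x|²)`. -/
def wdiv {n : ℕ} (a : ℝ) (w : EuclideanSpace ℝ (Fin n) → ℝ) (x : EuclideanSpace ℝ (Fin n)) : ℝ :=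
  ‖x‖ ^ (-(2*a)) * (lapl w x - 2*a * (@inner ℝ _ _ x (gradient w x)) / ‖x‖^2)

/-- Finiteness of the weighted Dirichlet energy `∫ |x|^(-2a) |∇w|² < ∞`. -/
def finiteEnergy {n : ℕ} (a : ℝ) (w : EuclideanSpace ℝ (Fin n) → ℝ) : Prop :=
  Integrable (fun x : EuclideanSpace ℝ (Fin n) => ‖x‖ ^ (-(2*a)) * ‖gradient w x‖^2)

open scoped Gradient RealInnerProductSpace

/-- Euclidean space of dimension `n`. -/
abbrev Euc (n : ℕ) := EuclideanSpace ℝ (Fin n)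

/-- `F` vanishes outside a compact annulus centred at the origin. -/
def AnnSupp {n : ℕ} {V : Type*} [Zero V] (F : Euc n → V) : Prop :=
  ∃ r R : ℝ, 0 < r ∧ ∀ x, (‖x‖ < r ∨ R < ‖x‖) → F x = 0

/-- `C¹` functions on the punctured space, supported in a compact annulus. -/
structure TestFn {n : ℕ} (ζ : Euc n → ℝ) : Prop where
  smooth : ContDiffOn ℝ 1 ζ {0}ᶜ
  supp : AnnSupp ζ

section basics

variable {n : ℕ}

lemma AnnSupp.mono {V W : Type*} [Zero V] [Zero W] {f : Euc n → V} {g : Euc n → W}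
    (hf : AnnSupp f) (h : ∀ x, f x = 0 → g x = 0) : AnnSupp g := by
  obtain ⟨r, R, hr, H⟩ := hf
  exact ⟨r, R, hr, fun x hx => h x (H x hx)⟩

lemma AnnSupp.eventuallyEq_zero {V : Type*} [Zero V] {f : Euc n → V} (hf : AnnSupp f) :
    f =ᶠ[𝓝 0] 0 := by
  obtain ⟨r, R, hr, H⟩ := hf
  filter_upwards [Metric.ball_mem_nhds (0 : Euc n) hr] with x hx
  exact H x (Or.inl (by simpa using hx))

lemma AnnSupp.zero {V : Type*} [Zero V] {f : Euc n → V} (hf : AnnSupp f) : f 0 = 0 :=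
  hf.eventuallyEq_zero.self_of_nhds

lemma AnnSupp.fderiv {f : Euc n → ℝ} (hf : AnnSupp f) : AnnSupp (fderiv ℝ f) := by
  obtain ⟨r, R, hr, H⟩ := hf
  refine ⟨r, R, hr, fun x hx => ?_⟩
  have : f =ᶠ[𝓝 x] fun _ => 0 := by
    rcases hx with hx | hx
    · filter_upwards [(isOpen_lt continuous_norm continuous_const).mem_nhds hx] with y hy
      exact H y (Or.inl hy)
    · filter_upwards [(isOpen_lt continuous_const continuous_norm).mem_nhds hx] with y hy
      exact H y (Or.inr hy)
  rw [this.fderiv_eq]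
  simp

lemma gradient_eq_toDual_symm (f : Euc n → ℝ) (x : Euc n) :
    ∇ f x = (InnerProductSpace.toDual ℝ (Euc n)).symm (fderiv ℝ f x) := rfl

lemma AnnSupp.gradient {f : Euc n → ℝ} (hf : AnnSupp f) : AnnSupp (gradient f) :=
  hf.fderiv.mono fun x hx => by simp [gradient_eq_toDual_symm, hx]

lemma AnnSupp.hasCompactSupport {f : Euc n → ℝ} (hf : AnnSupp f) : HasCompactSupport f := by
  obtain ⟨r, R, hr, H⟩ := hf
  refine HasCompactSupport.of_support_subset_isCompact (isCompact_closedBall (0 : Euc n) R) ?_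
  intro x hx
  by_contra h
  exact hx (H x (Or.inr (by simpa using h)))

lemma AnnSupp.integrable {F : Euc n → ℝ} (hs : AnnSupp F) (hF : ContinuousOn F {0}ᶜ) :
    Integrable F := by
  have hc : Continuous F := by
    rw [continuous_iff_continuousAt]
    intro x
    by_cases hx : x = 0
    · subst hx
      exact (continuousAt_const (y := (0 : ℝ))).congr hs.eventuallyEq_zero.symm
    · exact hF.continuousAt (isOpen_compl_singleton.mem_nhds hx)
  exact hc.integrable_of_hasCompactSupport hs.hasCompactSupport

lemma TestFn.contDiff {ζ : Euc n → ℝ} (h : TestFn ζ) : ContDiff ℝ 1 ζ := by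
  rw [contDiff_iff_contDiffAt]
  intro x
  by_cases hx : x = 0
  · subst hx
    exact (contDiffAt_const (c := (0 : ℝ))).congr_of_eventuallyEq h.supp.eventuallyEq_zero
  · exact h.smooth.contDiffAt (isOpen_compl_singleton.mem_nhds hx)

lemma TestFn.differentiable {ζ : Euc n → ℝ} (h : TestFn ζ) : Differentiable ℝ ζ :=
  h.contDiff.differentiable (by norm_num)

lemma TestFn.continuous_fderiv {ζ : Euc n → ℝ} (h : TestFn ζ) : Continuous (fderiv ℝ ζ) :=
  h.contDiff.continuous_fderiv (by norm_num)

lemma TestFn.integral_fderiv {F : Euc n → ℝ} (h : TestFn F) (e : Euc n) :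
    ∫ x, fderiv ℝ F x e = 0 := by
  have := integral_mul_fderiv_eq_neg_fderiv_mul_of_integrable (μ := volume) (𝕜 := ℝ)
    (f := fun _ : Euc n => (1 : ℝ)) (g := F) (v := e) (by simp) ?_ ?_
    (fun x _ => differentiableAt_const _) (fun x _ => h.differentiable x)
  · simpa using this
  · refine (AnnSupp.mono h.supp.fderiv (fun x hx => by simp [hx])).integrable ?_
    exact (continuous_const.mul (h.continuous_fderiv.clm_apply continuous_const)).continuousOn
  · refine (AnnSupp.mono h.supp (fun x hx => by simp [hx])).integrable ?_
    exact (continuous_const.mul h.contDiff.continuous).continuousOn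

lemma continuousOn_gradient {f : Euc n → ℝ} (hf : ContDiffOn ℝ 1 f {0}ᶜ) :
    ContinuousOn (∇ f) {0}ᶜ := by
  have h : ContinuousOn (fderiv ℝ f) {0}ᶜ :=
    hf.continuousOn_fderiv_of_isOpen isOpen_compl_singleton le_rfl
  exact ((InnerProductSpace.toDual ℝ (Euc n)).symm.continuous).comp_continuousOn h

lemma ContDiffOn.hasFDerivAt_punctured {m : WithTop ℕ∞} {f : Euc n → ℝ}
    (hf : ContDiffOn ℝ m f {0}ᶜ) (hm : m ≠ 0) {x : Euc n} (hx : x ≠ 0) :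
    HasFDerivAt f (fderiv ℝ f x) x :=
  ((hf.contDiffAt (isOpen_compl_singleton.mem_nhds hx)).differentiableAt hm).hasFDerivAt

lemma hasFDerivAt_radial {h : ℝ → ℝ} {h' : ℝ} {x : Euc n} (hx : x ≠ 0)
    (hh : HasDerivAt h h' ‖x‖) :
    HasFDerivAt (fun y : Euc n => h ‖y‖) ((h' / ‖x‖) • innerSL ℝ x) x := by
  have h0 : ‖x‖ ≠ 0 := norm_ne_zero_iff.mpr hx
  have h1 : HasFDerivAt (fun y : Euc n => ‖y‖ ^ 2) (2 • innerSL ℝ x) x :=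
    (hasStrictFDerivAt_norm_sq x).hasFDerivAt
  have h2 := h1.sqrt (by positivity)
  have h3 : (fun y : Euc n => √(‖y‖ ^ 2)) = fun y => ‖y‖ := by
    funext y; exact Real.sqrt_sq (norm_nonneg _)
  rw [h3, Real.sqrt_sq (norm_nonneg _)] at h2
  have h4 := hh.comp_hasFDerivAt x h2
  refine h4.congr_fderiv ?_
  ext y
  simp
  field_simp

lemma hasFDerivAt_norm_rpow_punctured (s : ℝ) {x : Euc n} (hx : x ≠ 0) :
    HasFDerivAt (fun y : Euc n => ‖y‖ ^ s) ((s * ‖x‖ ^ (s - 2)) • innerSL ℝ x) x := by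
  have h0 : 0 < ‖x‖ := norm_pos_iff.mpr hx
  have := hasFDerivAt_radial hx (Real.hasDerivAt_rpow_const (p := s) (Or.inl h0.ne'))
  convert this using 2
  rw [mul_div_assoc]
  congr 1
  rw [eq_div_iff h0.ne', ← Real.rpow_add_one h0.ne']
  congr 1; ring

lemma contDiffOn_norm_rpow (s : ℝ) {m : WithTop ℕ∞} :
    ContDiffOn ℝ m (fun y : Euc n => ‖y‖ ^ s) {0}ᶜ := by
  intro x hx
  exact ((contDiffAt_norm ℝ hx).rpow_const_of_ne (norm_ne_zero_iff.mpr hx)).contDiffWithinAt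

lemma continuousOn_norm_rpow (s : ℝ) : ContinuousOn (fun y : Euc n => ‖y‖ ^ s) {0}ᶜ :=
  (contDiffOn_norm_rpow (m := 0) s).continuousOn

lemma inner_gradient_eq_sum (f g : Euc n → ℝ) (x : Euc n) :
    ⟪∇ f x, ∇ g x⟫ = ∑ i : Fin n, fderiv ℝ f x (EuclideanSpace.single i 1) *
      fderiv ℝ g x (EuclideanSpace.single i 1) := by
  have := (EuclideanSpace.basisFun (Fin n) ℝ).sum_inner_mul_inner (∇ f x) (∇ g x)
  rw [← this]
  refine Finset.sum_congr rfl fun i _ => ?_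
  rw [EuclideanSpace.basisFun_apply, inner_gradient_left, real_inner_comm, inner_gradient_left]

lemma fderiv_apply_eq_sum (f : Euc n → ℝ) (x y : Euc n) :
    fderiv ℝ f x y = ∑ i : Fin n, y i * fderiv ℝ f x (EuclideanSpace.single i 1) := by
  conv_lhs => rw [← (EuclideanSpace.basisFun (Fin n) ℝ).sum_repr y]
  simp

lemma inner_gradient_apply (f : Euc n → ℝ) (x y : Euc n) : ⟪y, ∇ f x⟫ = fderiv ℝ f x y := by
  rw [real_inner_comm, inner_gradient_left]

lemma norm_gradient (f : Euc n → ℝ) (x : Euc n) : ‖∇ f x‖ = ‖fderiv ℝ f x‖ := by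
  rw [gradient_eq_toDual_symm, LinearIsometryEquiv.norm_map]

/-- The weak form of the weighted divergence. -/
lemma integral_inner_gradient_eq (a : ℝ) {w ζ : Euc n → ℝ} (hw : ContDiffOn ℝ 2 w {0}ᶜ)
    (hζ : TestFn ζ) :
    ∫ x, ‖x‖ ^ (-(2 * a)) * ⟪∇ w x, ∇ ζ x⟫ = ∫ x, -(wdiv a w x) * ζ x := by
  set e : Fin n → Euc n := fun i => EuclideanSpace.single i 1 with he
  have hD : ContDiffOn ℝ 1 (fderiv ℝ w) {0}ᶜ :=
    hw.fderiv_of_isOpen isOpen_compl_singleton (by norm_num)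
  have hDi : ∀ i, ContDiffOn ℝ 1 (fun y => fderiv ℝ w y (e i)) {0}ᶜ := fun i =>
    hD.clm_apply contDiffOn_const
  let F : Fin n → Euc n → ℝ := fun i x => ‖x‖ ^ (-(2 * a)) * fderiv ℝ w x (e i) * ζ x
  have hF : ∀ i, TestFn (F i) := fun i =>
    ⟨((contDiffOn_norm_rpow _).mul (hDi i)).mul hζ.smooth,
      hζ.supp.mono fun x hx => by simp [F, hx]⟩
  have key : ∀ x, ∑ i, fderiv ℝ (F i) x (e i) =
      ‖x‖ ^ (-(2 * a)) * ⟪∇ w x, ∇ ζ x⟫ + wdiv a w x * ζ x := by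
    intro x
    by_cases hx : x = 0
    · subst hx
      rw [hζ.supp.zero, hζ.supp.gradient.zero]
      simp [fun i => (hF i).supp.fderiv.zero]
    · have h1 : ∀ i, fderiv ℝ (F i) x (e i) =
          ‖x‖ ^ (-(2 * a)) * (fderiv ℝ w x (e i) * fderiv ℝ ζ x (e i)) +
          ‖x‖ ^ (-(2 * a)) * ζ x * fderiv ℝ (fun y => fderiv ℝ w y (e i)) x (e i) +
          (-(2 * a) * ‖x‖ ^ (-(2 * a) - 2) * ζ x) * (x i * fderiv ℝ w x (e i)) := by
        intro i
        have := (((hasFDerivAt_norm_rpow_punctured (-(2 * a)) hx).mul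
          ((hDi i).hasFDerivAt_punctured (by norm_num) hx)).mul
          (hζ.smooth.hasFDerivAt_punctured (by norm_num) hx)).fderiv
        have hFi : F i = ((fun y : Euc n => ‖y‖ ^ (-(2 * a))) *
            (fun y => fderiv ℝ w y (e i))) * ζ := rfl
        rw [hFi, this]
        have hi : ⟪x, e i⟫ = x i := by simp [he, EuclideanSpace.inner_single_right]
        simp [hi]
        ring
      have h0 : 0 < ‖x‖ := norm_pos_iff.mpr hx
      simp_rw [h1, Finset.sum_add_distrib, ← Finset.mul_sum]
      rw [inner_gradient_eq_sum, wdiv, inner_gradient_apply, fderiv_apply_eq_sum w x x, lapl]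
      have : ‖x‖ ^ (-(2 * a) - 2) = ‖x‖ ^ (-(2 * a)) / ‖x‖ ^ 2 := by
        rw [Real.rpow_sub h0]; norm_num
      rw [this]
      simp only [he]
      ring
  have hgi : ∀ i, Integrable (fun x => fderiv ℝ (F i) x (e i)) := fun i =>
    ((hF i).supp.fderiv.mono (fun x hx => by simp [hx])).integrable
      ((hF i).continuous_fderiv.clm_apply continuous_const).continuousOn
  have hsum : ∫ x, ∑ i, fderiv ℝ (F i) x (e i) = 0 := by
    rw [integral_finsetSum _ fun i _ => hgi i]
    exact Finset.sum_eq_zero fun i _ => (hF i).integral_fderiv _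
  have hA : Integrable fun x => ‖x‖ ^ (-(2 * a)) * ⟪∇ w x, ∇ ζ x⟫ := by
    refine (hζ.supp.gradient.mono fun x hx => by simp [hx]).integrable ?_
    exact (continuousOn_norm_rpow _).mul
      ((continuousOn_gradient (hw.of_le (by norm_num))).inner (continuousOn_gradient hζ.smooth))
  have hS : Integrable fun x => ∑ i, fderiv ℝ (F i) x (e i) :=
    integrable_finsetSum _ fun i _ => hgi i
  have : ∀ x, -(wdiv a w x) * ζ x = ‖x‖ ^ (-(2 * a)) * ⟪∇ w x, ∇ ζ x⟫ -
      ∑ i, fderiv ℝ (F i) x (e i) := fun x => by rw [key x]; ring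
  simp_rw [this]
  rw [integral_sub hA hS, hsum, sub_zero]

end basics

/-- Logarithmic cutoff functions at scale `L`. -/
structure LogCutoff {n : ℕ} (K L : ℝ) (η : Euc n → ℝ) : Prop where
  test : TestFn η
  nonneg : ∀ x, 0 ≤ η x
  le_one : ∀ x, η x ≤ 1
  eq_one : ∀ x, x ≠ 0 → |log ‖x‖| ≤ L → η x = 1
  grad : ∀ x, x ≠ 0 → ‖∇ η x‖ * ‖x‖ ≤ K / L

/-- A `C¹` regularisation `S` of the positive part, and the primitive `T` of the squared
derivative of `S`. -/
structure PosReg (δ : ℝ) (S T σ : ℝ → ℝ) : Prop where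
  contσ : Continuous σ
  σ_nonneg : ∀ s, 0 ≤ σ s
  σ_le : ∀ s, σ s ≤ 1
  σ_zero : ∀ s ≤ 0, σ s = 0
  hasDerivS : ∀ s, HasDerivAt S (σ s) s
  hasDerivT : ∀ s, HasDerivAt T (σ s ^ 2) s
  S_zero : ∀ s ≤ 0, S s = 0
  T_zero : ∀ s ≤ 0, T s = 0
  T_pos : ∀ s, 0 < s → 0 < T s
  T_le : ∀ s, T s ≤ S s * σ s
  S_nonneg : ∀ s, 0 ≤ S s
  S_le : ∀ s, 0 ≤ s → S s ≤ s
  le_S : ∀ s, s - δ ≤ S s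

lemma exists_posReg {δ : ℝ} (hδ : 0 < δ) : ∃ S T σ : ℝ → ℝ, PosReg δ S T σ := by
  let σ : ℝ → ℝ := fun s => max 0 (min 1 (s / δ))
  have cσ : Continuous σ := by fun_prop
  have σ0 : ∀ s, 0 ≤ σ s := fun s => le_max_left _ _
  have σ1 : ∀ s, σ s ≤ 1 := fun s => max_le zero_le_one (min_le_left _ _)
  have σz : ∀ s ≤ 0, σ s = 0 := fun s hs =>
    max_eq_left ((min_le_right _ _).trans (div_nonpos_of_nonpos_of_nonneg hs hδ.le))
  have σpos : ∀ s, 0 < s → 0 < σ s := fun s hs =>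
    lt_max_of_lt_right (lt_min one_pos (div_pos hs hδ))
  have σone : ∀ s, δ ≤ s → σ s = 1 := fun s hs => by
    have : 1 ≤ s / δ := by rwa [le_div_iff₀ hδ, one_mul]
    simp [σ, min_eq_left this]
  have σmono : Monotone σ := fun s t hst =>
    max_le_max le_rfl (min_le_min le_rfl (div_le_div_of_nonneg_right hst hδ.le))
  have cσ2 : Continuous fun s => σ s ^ 2 := cσ.pow 2
  have zint : ∀ f : ℝ → ℝ, (∀ s ≤ 0, f s = 0) → ∀ s ≤ 0, ∫ t in (0 : ℝ)..s, f t = 0 := by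
    intro f hf s hs
    rw [intervalIntegral.integral_symm, intervalIntegral.integral_congr (g := fun _ => (0 : ℝ))]
    · simp
    · intro t ht
      rw [Set.uIcc_of_le hs] at ht
      exact hf t ht.2
  let S : ℝ → ℝ := fun s => ∫ t in (0 : ℝ)..s, σ t
  let T : ℝ → ℝ := fun s => ∫ t in (0 : ℝ)..s, σ t ^ 2
  have Sz : ∀ s ≤ 0, S s = 0 := zint σ σz
  have Tz : ∀ s ≤ 0, T s = 0 := zint _ fun s hs => by simp [σz s hs]
  have S0 : ∀ s, 0 ≤ S s := fun s => by
    rcases le_total s 0 with hs | hs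
    · exact (Sz s hs).ge
    · exact intervalIntegral.integral_nonneg hs fun t _ => σ0 t
  refine ⟨S, T, σ, cσ, σ0, σ1, σz, fun s => (cσ.integral_hasStrictDerivAt 0 s).hasDerivAt,
    fun s => (cσ2.integral_hasStrictDerivAt 0 s).hasDerivAt, Sz, Tz, ?_, ?_, S0, ?_, ?_⟩
  · intro s hs
    exact intervalIntegral.intervalIntegral_pos_of_pos_on (cσ2.intervalIntegrable 0 s)
      (fun t ht => pow_pos (σpos t ht.1) 2) hs
  · intro s
    rcases le_total s 0 with hs | hs
    · rw [Tz s hs, σz s hs, mul_zero]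
    · change (∫ t in (0 : ℝ)..s, σ t ^ 2) ≤ (∫ t in (0 : ℝ)..s, σ t) * σ s
      rw [← intervalIntegral.integral_mul_const]
      refine intervalIntegral.integral_mono_on hs (cσ2.intervalIntegrable _ _)
        ((cσ.mul continuous_const).intervalIntegrable _ _) fun t ht => ?_
      rw [sq]
      exact mul_le_mul_of_nonneg_left (σmono ht.2) (σ0 t)
  · intro s hs
    have := intervalIntegral.integral_mono_on (μ := volume) hs (cσ.intervalIntegrable 0 s)
      (continuous_const.intervalIntegrable 0 s) fun t _ => σ1 t
    simpa using this
  · intro s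
    rcases le_total s δ with hs | hs
    · linarith [S0 s]
    · have h1 : S s = (∫ t in (0 : ℝ)..δ, σ t) + ∫ t in δ..s, σ t :=
        (intervalIntegral.integral_add_adjacent_intervals (cσ.intervalIntegrable _ _)
          (cσ.intervalIntegrable _ _)).symm
      have h2 : ∫ t in δ..s, σ t = ∫ t in δ..s, (1 : ℝ) :=
        intervalIntegral.integral_congr fun t ht => by
          rw [Set.uIcc_of_le hs] at ht
          exact σone t ht.1
      have h3 : 0 ≤ ∫ t in (0 : ℝ)..δ, σ t := S0 δ
      rw [h1, h2]
      simp
      exact h3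

lemma PosReg.contDiffS {δ : ℝ} {S T σ : ℝ → ℝ} (h : PosReg δ S T σ) : ContDiff ℝ 1 S := by
  rw [contDiff_one_iff_deriv]
  refine ⟨fun s => (h.hasDerivS s).differentiableAt, ?_⟩
  rw [show deriv S = σ from funext fun s => (h.hasDerivS s).deriv]
  exact h.contσ

lemma PosReg.contDiffT {δ : ℝ} {S T σ : ℝ → ℝ} (h : PosReg δ S T σ) : ContDiff ℝ 1 T := by
  rw [contDiff_one_iff_deriv]
  refine ⟨fun s => (h.hasDerivT s).differentiableAt, ?_⟩
  rw [show deriv T = fun s => σ s ^ 2 from funext fun s => (h.hasDerivT s).deriv]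
  exact h.contσ.pow 2

lemma PosReg.T_nonneg {δ : ℝ} {S T σ : ℝ → ℝ} (h : PosReg δ S T σ) (s : ℝ) : 0 ≤ T s := by
  rcases le_or_gt s 0 with hs | hs
  · exact (h.T_zero s hs).ge
  · exact (h.T_pos s hs).le

lemma PosReg.T_le_S {δ : ℝ} {S T σ : ℝ → ℝ} (h : PosReg δ S T σ) (s : ℝ) : T s ≤ S s :=
  (h.T_le s).trans (mul_le_of_le_one_right (h.S_nonneg s) (h.σ_le s))

section cutoffs

variable {n : ℕ}

lemma TestFn.mul {f g : Euc n → ℝ} (hf : ContDiffOn ℝ 1 f {0}ᶜ) (hg : TestFn g) :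
    TestFn fun x => f x * g x :=
  ⟨hf.mul hg.smooth, hg.supp.mono fun x hx => by simp [hx]⟩

lemma norm_gradient_radial {h : ℝ → ℝ} {h' : ℝ} {x : Euc n} (hx : x ≠ 0)
    (hh : HasDerivAt h h' ‖x‖) : ‖∇ (fun y : Euc n => h ‖y‖) x‖ = |h'| := by
  rw [norm_gradient, (hasFDerivAt_radial hx hh).fderiv, norm_smul, innerSL_apply_norm,
    norm_div, norm_norm, div_mul_cancel₀ _ (norm_ne_zero_iff.mpr hx), Real.norm_eq_abs]

lemma exists_logCutoff (n : ℕ) :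
    ∃ K : ℝ, 0 < K ∧ ∀ L : ℝ, 0 < L → ∃ η : Euc n → ℝ, LogCutoff K L η := by
  let χ : ContDiffBump (0 : ℝ) := ⟨1, 2, by norm_num, by norm_num⟩
  have hχ : ContDiff ℝ 1 χ := χ.contDiff
  obtain ⟨K, hK⟩ : ∃ K, ∀ s, ‖deriv χ s‖ ≤ K :=
    (hχ.continuous_deriv le_rfl).bounded_above_of_compact_support χ.hasCompactSupport.deriv
  have hK0 : 0 ≤ K := (norm_nonneg _).trans (hK 0)
  refine ⟨K + 1, by linarith, fun L hL => ?_⟩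
  let η : Euc n → ℝ := fun x => if x = 0 then 0 else χ (log ‖x‖ / L)
  have hη : ∀ x : Euc n, x ≠ 0 → η =ᶠ[𝓝 x] fun y => χ (log ‖y‖ / L) := fun x hx => by
    filter_upwards [isOpen_compl_singleton.mem_nhds hx] with y hy
    exact if_neg hy
  have hzero : ∀ s : ℝ, 2 ≤ |s| → χ s = 0 := fun s hs => by
    apply χ.zero_of_le_dist
    simpa [Real.dist_eq] using hs
  refine ⟨η, ⟨⟨?_, ⟨exp (-(2 * L)), exp (2 * L), exp_pos _, ?_⟩⟩, ?_, ?_, ?_, ?_⟩⟩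
  · intro x hx
    have : ContDiffAt ℝ 1 (fun y : Euc n => χ (log ‖y‖ / L)) x :=
      hχ.contDiffAt.comp x (((contDiffAt_norm ℝ hx).log (norm_ne_zero_iff.mpr hx)).div_const L)
    exact (this.congr_of_eventuallyEq (hη x hx)).contDiffWithinAt
  · intro x hx
    by_cases h0 : x = 0
    · simp [η, h0]
    have hn : 0 < ‖x‖ := norm_pos_iff.mpr h0
    simp only [η, h0, if_false]
    apply hzero
    rw [abs_div, abs_of_pos hL, le_div_iff₀ hL]
    rcases hx with hx | hx
    · have := (log_lt_iff_lt_exp hn).mpr hx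
      exact (by linarith : 2 * L ≤ -log ‖x‖).trans (neg_le_abs _)
    · exact ((lt_log_iff_exp_lt hn).mpr hx).le.trans (le_abs_self _)
  · intro x
    simp only [η]; split_ifs
    · exact le_rfl
    · exact χ.nonneg
  · intro x
    simp only [η]; split_ifs
    · exact zero_le_one
    · exact χ.le_one
  · intro x hx h
    simp only [η, hx, if_false]
    apply χ.one_of_mem_closedBall
    rw [mem_closedBall_zero_iff, Real.norm_eq_abs, abs_div, abs_of_pos hL, div_le_iff₀ hL]
    simpa [χ] using h
  · intro x hx
    have hn : 0 < ‖x‖ := norm_pos_iff.mpr hx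
    have hd : HasDerivAt (fun r => χ (log r / L)) (deriv χ (log ‖x‖ / L) * (‖x‖⁻¹ / L)) ‖x‖ :=
      ((hχ.differentiable (by norm_num)) _).hasDerivAt.comp _
        ((Real.hasDerivAt_log hn.ne').div_const L)
    rw [(hη x hx).gradient_eq, norm_gradient_radial hx hd, abs_mul,
      abs_of_pos (by positivity : 0 < ‖x‖⁻¹ / L)]
    have := hK (log ‖x‖ / L)
    rw [Real.norm_eq_abs] at this
    rw [show |deriv χ (log ‖x‖ / L)| * (‖x‖⁻¹ / L) * ‖x‖ =
      |deriv χ (log ‖x‖ / L)| / L by field_simp]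
    gcongr
    linarith

/-- A nonnegative function with bounded integrals against cutoffs is integrable. -/
lemma integrable_of_logCutoff {F : Euc n → ℝ} (hF : ContinuousOn F {0}ᶜ)
    (h0 : ∀ x, x ≠ 0 → 0 ≤ F x) (hn : 0 < n) {K C : ℝ}
    (hK : ∀ L : ℝ, 0 < L → ∃ η : Euc n → ℝ, LogCutoff K L η)
    (hC : ∀ L : ℝ, 1 ≤ L → ∀ η : Euc n → ℝ, LogCutoff K L η → ∫ x, F x * η x ^ 2 ≤ C) :
    Integrable F := by
  have : Nonempty (Fin n) := ⟨⟨0, hn⟩⟩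
  let A : ℕ → Set (Euc n) := fun L => {x | exp (-(L : ℝ)) ≤ ‖x‖ ∧ ‖x‖ ≤ exp L}
  have hne : ∀ᵐ x : Euc n, x ≠ 0 := Measure.ae_ne volume 0
  have hAm : ∀ L, IsClosed (A L) := fun L =>
    (isClosed_le continuous_const continuous_norm).inter (isClosed_le continuous_norm continuous_const)
  have hAc : ∀ L, IsCompact (A L) := fun L =>
    (isCompact_closedBall (0 : Euc n) (exp L)).of_isClosed_subset (hAm L)
      fun x hx => by simpa using hx.2
  have hA0 : ∀ L, A L ⊆ {0}ᶜ := fun L x hx h => by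
    simp only [Set.mem_singleton_iff] at h
    rw [h] at hx
    have := hx.1
    rw [norm_zero] at this
    exact absurd this (not_le.mpr (exp_pos _))
  have hcov : AECover (volume : Measure (Euc n)) atTop A := by
    refine ⟨?_, fun L => (hAm L).measurableSet⟩
    filter_upwards [hne] with x hx
    have hn : 0 < ‖x‖ := norm_pos_iff.mpr hx
    filter_upwards [eventually_ge_atTop ⌈|log ‖x‖|⌉₊] with L hL
    have := abs_le.mp (Nat.ceil_le.mp hL)
    exact ⟨(le_log_iff_exp_le hn).mp this.1, (log_le_iff_le_exp hn).mp this.2⟩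
  refine hcov.integrable_of_integral_bounded_of_nonneg_ae C
    (fun L => (hF.mono (hA0 L)).integrableOn_compact (hAc L)) (hne.mono h0) ?_
  filter_upwards [eventually_ge_atTop 1] with L hL
  have hL' : (1 : ℝ) ≤ L := by exact_mod_cast hL
  obtain ⟨η, hη⟩ := hK L (by linarith)
  refine le_trans ?_ (hC L hL' η hη)
  have hInt : Integrable fun x => F x * η x ^ 2 :=
    (hη.test.supp.mono fun x hx => by simp [hx]).integrable
      (hF.mul (hη.test.contDiff.continuous.pow 2).continuousOn)
  calc ∫ x in A L, F x = ∫ x in A L, F x * η x ^ 2 := by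
        refine setIntegral_congr_fun (hAm L).measurableSet fun x hx => ?_
        have h0 : x ≠ 0 := hA0 L hx
        have hn : 0 < ‖x‖ := norm_pos_iff.mpr h0
        have : η x = 1 := hη.eq_one x h0 (abs_le.mpr
          ⟨(le_log_iff_exp_le hn).mpr hx.1, (log_le_iff_le_exp hn).mpr hx.2⟩)
        simp [this]
    _ ≤ ∫ x, F x * η x ^ 2 := by
        refine setIntegral_le_integral hInt ?_
        filter_upwards [hne] with x hx
        exact mul_nonneg (h0 x hx) (sq_nonneg _)

lemma integrableOn_norm_rpow_ball (hn : 0 < n) {s : ℝ} (hs : 0 < s) :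
    IntegrableOn (fun x : Euc n => ‖x‖ ^ (s - n)) {x | ‖x‖ < 1} := by
  have : Nonempty (Fin n) := ⟨⟨0, hn⟩⟩
  have h := (integrable_fun_norm_addHaar (E := Euc n) volume
    (f := Set.indicator (Set.Iio 1) fun r : ℝ => r ^ (s - n)))
  have hm : MeasurableSet {x : Euc n | ‖x‖ < 1} :=
    (isOpen_lt continuous_norm continuous_const).measurableSet
  rw [← integrable_indicator_iff hm]
  have h1 : Set.indicator {x : Euc n | ‖x‖ < 1} (fun x : Euc n => ‖x‖ ^ (s - n)) =
      fun x => Set.indicator (Set.Iio 1) (fun r : ℝ => r ^ (s - n)) ‖x‖ := by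
    funext x; simp [Set.indicator]
  rw [h1, h]
  have h2 : ∀ y ∈ Set.Ioi (0:ℝ), y ^ (Module.finrank ℝ (Euc n) - 1) •
      Set.indicator (Set.Iio 1) (fun r : ℝ => r ^ (s - n)) y =
      Set.indicator (Set.Iio 1) (fun r : ℝ => r ^ (s - 1)) y := by
    intro y hy
    by_cases h : y ∈ Set.Iio (1:ℝ)
    · simp only [Set.indicator_of_mem h, smul_eq_mul, finrank_euclideanSpace_fin]
      rw [← Real.rpow_natCast, ← Real.rpow_add hy]
      congr 1
      rw [Nat.cast_sub hn]; push_cast; ring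
    · simp [Set.indicator_of_notMem h]
  rw [integrableOn_congr_fun h2 measurableSet_Ioi, IntegrableOn,
    integrable_indicator_iff measurableSet_Iio, IntegrableOn, Measure.restrict_restrict measurableSet_Iio,
    Set.inter_comm, Set.Ioi_inter_Iio]
  exact (intervalIntegral.integrableOn_Ioo_rpow_iff one_pos).mpr (by linarith)

lemma integrableOn_norm_rpow_compl_ball (hn : 0 < n) {s : ℝ} (hs : 0 < s) :
    IntegrableOn (fun x : Euc n => ‖x‖ ^ (-s - n)) {x | 1 ≤ ‖x‖} := by
  have hm : MeasurableSet {x : Euc n | 1 ≤ ‖x‖} :=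
    (isClosed_le continuous_const continuous_norm).measurableSet
  have h := (integrable_one_add_norm (E := Euc n) (μ := volume) (r := s + n)
    (by simp; linarith)).const_mul (2 ^ (s + n))
  refine Integrable.mono' h.integrableOn ?_ ?_
  · refine ContinuousOn.aestronglyMeasurable ?_ hm
    exact (continuousOn_norm_rpow _).mono fun x hx h0 => by
      simp only [Set.mem_singleton_iff] at h0
      simp only [Set.mem_ofPred_eq, h0, norm_zero] at hx
      linarith
  · filter_upwards [ae_restrict_mem hm] with x hx
    have hx' : 1 ≤ ‖x‖ := hx
    rw [Real.norm_of_nonneg (by positivity)]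
    rw [show -s - (n:ℝ) = -(s+n) by ring, Real.rpow_neg (by positivity), Real.rpow_neg (by positivity),
      ← div_eq_mul_inv, ← Real.div_rpow (by norm_num) (by positivity), ← Real.inv_rpow (by positivity)]
    refine Real.rpow_le_rpow (by positivity) ?_ (by positivity)
    rw [inv_eq_one_div, div_le_div_iff₀ (by positivity) (by positivity)]
    linarith

end cutoffs

section hardy

variable {n : ℕ}

lemma TestFn.continuous {ζ : Euc n → ℝ} (h : TestFn ζ) : Continuous ζ := h.contDiff.continuous

lemma ae_ne_zero (hn : 0 < n) : ∀ᵐ x : Euc n, x ≠ 0 := by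
  have : Nonempty (Fin n) := ⟨⟨0, hn⟩⟩
  exact Measure.ae_ne volume 0

lemma continuousOn_fderiv_self {f : Euc n → ℝ} (hf : ContDiffOn ℝ 1 f {0}ᶜ) :
    ContinuousOn (fun x => fderiv ℝ f x x) {0}ᶜ :=
  (hf.continuousOn_fderiv_of_isOpen isOpen_compl_singleton le_rfl).clm_apply continuousOn_id

lemma abs_fderiv_self_le (f : Euc n → ℝ) (x : Euc n) : |fderiv ℝ f x x| ≤ ‖∇ f x‖ * ‖x‖ := by
  rw [norm_gradient]; exact (fderiv ℝ f x).le_opNorm x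

lemma TestFn.integral_fderiv_self_add {Ψ : Euc n → ℝ} (hΨ : TestFn Ψ) :
    ∫ x, (fderiv ℝ Ψ x x + n * Ψ x) = 0 := by
  have hcoord : ∀ i : Fin n, ContDiff ℝ 1 fun x : Euc n => x i := fun i =>
    (EuclideanSpace.proj (𝕜 := ℝ) i).contDiff
  have hT : ∀ i : Fin n, TestFn fun x : Euc n => x i * Ψ x := fun i =>
    TestFn.mul (hcoord i).contDiffOn hΨ
  have hd : ∀ (i : Fin n) (x : Euc n), fderiv ℝ (fun x : Euc n => x i * Ψ x) x
      (EuclideanSpace.single i 1) =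
      x i * fderiv ℝ Ψ x (EuclideanSpace.single i 1) + Ψ x := fun i x => by
    have h1 : HasFDerivAt (fun x : Euc n => x i) (EuclideanSpace.proj (𝕜 := ℝ) i) x :=
      (EuclideanSpace.proj (𝕜 := ℝ) i).hasFDerivAt
    rw [(h1.fun_mul (hΨ.differentiable x).hasFDerivAt).fderiv]
    simp
  have hs : ∀ x : Euc n, fderiv ℝ Ψ x x + n * Ψ x = ∑ i : Fin n,
      fderiv ℝ (fun x : Euc n => x i * Ψ x) x (EuclideanSpace.single i 1) := fun x => by
    simp only [hd, Finset.sum_add_distrib, ← fderiv_apply_eq_sum]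
    simp
  simp only [hs]
  rw [integral_finsetSum]
  · exact Finset.sum_eq_zero fun i _ => (hT i).integral_fderiv _
  · intro i _
    refine ((hT i).supp.fderiv.mono fun x hx => by simp [hx]).integrable ?_
    exact ((hT i).continuous_fderiv.clm_apply continuous_const).continuousOn

/-- Integration by parts along rays with a radial weight. -/
lemma integral_radial_identity {h h' : ℝ → ℝ} (hh : ContDiffOn ℝ 1 h (Set.Ioi 0))
    (hh' : ∀ r, 0 < r → HasDerivAt h (h' r) r) {g : Euc n → ℝ} (hg : TestFn g) :
    ∫ x : Euc n, ‖x‖ ^ (-(n : ℝ)) * (h' ‖x‖ * ‖x‖) * g x ^ 2 =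
      ∫ x : Euc n, -(‖x‖ ^ (-(n : ℝ)) * (2 * h ‖x‖ * g x * fderiv ℝ g x x)) := by
  have hhn : ContDiffOn ℝ 1 (fun x : Euc n => h ‖x‖) {0}ᶜ := fun x hx =>
    ((hh.contDiffAt (Ioi_mem_nhds (norm_pos_iff.mpr hx))).comp x
      (contDiffAt_norm ℝ hx)).contDiffWithinAt
  have hw : ContDiffOn ℝ 1 (fun x : Euc n => ‖x‖ ^ (-(n : ℝ)) * h ‖x‖) {0}ᶜ :=
    (contDiffOn_norm_rpow _).mul hhn
  have hg2 : TestFn fun x => g x * g x := TestFn.mul hg.smooth hg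
  have hΨ := TestFn.mul hw hg2
  have hpt : ∀ x : Euc n, fderiv ℝ (fun x : Euc n => (‖x‖ ^ (-(n : ℝ)) * h ‖x‖) * (g x * g x)) x x
      + n * ((‖x‖ ^ (-(n : ℝ)) * h ‖x‖) * (g x * g x)) =
      ‖x‖ ^ (-(n : ℝ)) * (h' ‖x‖ * ‖x‖) * g x ^ 2 -
        -(‖x‖ ^ (-(n : ℝ)) * (2 * h ‖x‖ * g x * fderiv ℝ g x x)) := by
    intro x
    by_cases hx : x = 0
    · subst hx
      simp [hg.supp.zero]
    have h0 : 0 < ‖x‖ := norm_pos_iff.mpr hx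
    have h1 := ((hasFDerivAt_norm_rpow_punctured (-(n : ℝ)) hx).fun_mul
      (hasFDerivAt_radial hx (hh' _ h0))).fun_mul
      ((hg.differentiable x).hasFDerivAt.fun_mul (hg.differentiable x).hasFDerivAt)
    rw [h1.fderiv]
    simp only [add_apply, smul_apply, innerSL_apply_apply,
      real_inner_self_eq_norm_sq, smul_eq_mul]
    have e1 : ‖x‖ ^ (-(n : ℝ) - 2) * ‖x‖ ^ 2 = ‖x‖ ^ (-(n : ℝ)) := by
      rw [← Real.rpow_natCast, ← Real.rpow_add h0]; norm_num
    rw [← e1]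
    field_simp
    ring
  have key := hΨ.integral_fderiv_self_add
  simp only [hpt] at key
  have c1 : ContinuousOn (fun x : Euc n => h' ‖x‖) {0}ᶜ := by
    have hd : ContinuousOn (deriv h) (Set.Ioi 0) :=
      hh.continuousOn_deriv_of_isOpen isOpen_Ioi le_rfl
    have : ContinuousOn h' (Set.Ioi 0) := hd.congr fun r hr => (hh' r hr).deriv.symm
    exact this.comp continuous_norm.continuousOn fun x hx => norm_pos_iff.mpr hx
  rw [integral_sub] at key
  · exact sub_eq_zero.mp key
  · refine (hg.supp.mono fun x hx => by simp [hx]).integrable ?_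
    exact ((continuousOn_norm_rpow _).mul (c1.mul continuous_norm.continuousOn)).mul
      (hg.continuous.pow 2).continuousOn
  · refine (hg.supp.mono fun x hx => by simp [hx]).integrable ?_
    exact ((continuousOn_norm_rpow _).mul (((continuousOn_const.mul hhn.continuousOn).mul
      hg.continuous.continuousOn).mul (continuousOn_fderiv_self hg.smooth))).neg

/-- A localised Hardy inequality with a saturated weight. -/
lemma weighted_hardy {a k c : ℝ} (hk : 2 * k = n - 2 - 2 * a) (hk0 : 0 < k) (hc : 0 ≤ c)
    {G η : Euc n → ℝ} (hG : ContDiffOn ℝ 1 G {0}ᶜ) (hη : TestFn η) :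
    ∫ x : Euc n, ‖x‖ ^ (-(2 * a) - 2) / (1 + c * ‖x‖ ^ (2 * k)) ^ 2 * (G x * η x) ^ 2 ≤
      (1 / k ^ 2) * (∫ x : Euc n, ‖x‖ ^ (-(2 * a)) * ‖∇ G x‖ ^ 2 * η x ^ 2) +
      (2 / k) * ∫ x : Euc n, ‖x‖ ^ (-(2 * a) - 2) / (1 + c * ‖x‖ ^ (2 * k)) * G x ^ 2 * |η x| *
        (‖∇ η x‖ * ‖x‖) := by
  let D : ℝ → ℝ := fun r => 1 + c * r ^ (2 * k)
  have hD : ∀ r, 0 < r → 0 < D r := fun r hr => by positivity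
  let h : ℝ → ℝ := fun r => r ^ (2 * k) / D r
  let h' : ℝ → ℝ := fun r => 2 * k * r ^ (2 * k - 1) / D r ^ 2
  have hp : ContDiffOn ℝ 1 (fun r : ℝ => r ^ (2 * k)) (Set.Ioi 0) := fun r hr =>
    (Real.contDiffAt_rpow_const_of_ne (ne_of_gt hr)).contDiffWithinAt
  have hh : ContDiffOn ℝ 1 h (Set.Ioi 0) :=
    hp.div (contDiffOn_const.add (contDiffOn_const.mul hp)) fun r hr => (hD r hr).ne'
  have hh' : ∀ r, 0 < r → HasDerivAt h (h' r) r := fun r hr => by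
    have h1 := Real.hasDerivAt_rpow_const (p := 2 * k) (Or.inl hr.ne')
    refine (h1.fun_div ((h1.const_mul c).const_add 1) (hD r hr).ne').congr_deriv ?_
    simp only [h', D]; ring
  have hg : TestFn fun x => G x * η x := TestFn.mul hG hη
  have id := integral_radial_identity hh hh' hg
  have cD : ContinuousOn (fun x : Euc n => D ‖x‖) {0}ᶜ :=
    continuousOn_const.add (continuousOn_const.mul (continuousOn_norm_rpow _))
  have nD : ∀ x ∈ ({0}ᶜ : Set (Euc n)), D ‖x‖ ≠ 0 := fun x hx => (hD _ (norm_pos_iff.mpr hx)).ne'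
  have cη : ContinuousOn η {0}ᶜ := hη.continuous.continuousOn
  have cdη : ContinuousOn (fun x => ‖∇ η x‖) {0}ᶜ := (continuousOn_gradient hη.smooth).norm
  have cdG : ContinuousOn (fun x => ‖∇ G x‖) {0}ᶜ := (continuousOn_gradient hG).norm
  have cG : ContinuousOn G {0}ᶜ := hG.continuousOn
  have ew : ∀ x : Euc n, x ≠ 0 → ‖x‖ ^ (-(n : ℝ)) * ‖x‖ ^ (2 * k) = ‖x‖ ^ (-(2 * a) - 2) :=
    fun x hx => by
      rw [← Real.rpow_add (norm_pos_iff.mpr hx), hk]; congr 1; ring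
  have ew2 : ∀ x : Euc n, x ≠ 0 → ‖x‖ ^ (-(2 * a)) = ‖x‖ ^ (-(2 * a) - 2) * ‖x‖ ^ 2 :=
    fun x hx => by
      rw [← Real.rpow_natCast ‖x‖ 2, ← Real.rpow_add (norm_pos_iff.mpr hx)]; norm_num
  -- abbreviations for the three integrands
  set A : Euc n → ℝ := fun x =>
    ‖x‖ ^ (-(2 * a) - 2) / (1 + c * ‖x‖ ^ (2 * k)) ^ 2 * (G x * η x) ^ 2 with hA
  set B : Euc n → ℝ := fun x => ‖x‖ ^ (-(2 * a)) * ‖∇ G x‖ ^ 2 * η x ^ 2 with hB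
  set E : Euc n → ℝ := fun x => ‖x‖ ^ (-(2 * a) - 2) / (1 + c * ‖x‖ ^ (2 * k)) * G x ^ 2 * |η x| *
        (‖∇ η x‖ * ‖x‖) with hE
  have iA : Integrable A := (hη.supp.mono fun x hx => by simp [hA, hx]).integrable
    (((continuousOn_norm_rpow _).div (cD.pow 2) fun x hx => pow_ne_zero 2 (nD x hx)).mul
      ((cG.mul cη).pow 2))
  have iB : Integrable B := (hη.supp.mono fun x hx => by simp [hB, hx]).integrable
    (((continuousOn_norm_rpow _).mul (cdG.pow 2)).mul (cη.pow 2))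
  have iE : Integrable E := (hη.supp.mono fun x hx => by simp [hE, hx]).integrable
    (((((continuousOn_norm_rpow _).div cD nD).mul (cG.pow 2)).mul cη.abs).mul
      (cdη.mul continuous_norm.continuousOn))
  have e1 : ∫ x : Euc n, ‖x‖ ^ (-(n : ℝ)) * (h' ‖x‖ * ‖x‖) * (G x * η x) ^ 2 =
      ∫ x, 2 * k * A x := by
    congr 1; funext x
    by_cases hx : x = 0
    · subst hx; simp [hA, hη.supp.zero]
    have h0 : 0 < ‖x‖ := norm_pos_iff.mpr hx
    simp only [hA, h', ← ew x hx]
    have : ‖x‖ ^ (2 * k) = ‖x‖ ^ (2 * k - 1) * ‖x‖ := by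
      rw [← Real.rpow_add_one h0.ne']; norm_num
    rw [show D ‖x‖ = 1 + c * ‖x‖ ^ (2 * k) from rfl]
    rw [show ‖x‖ ^ (-(n : ℝ)) * ‖x‖ ^ (2 * k) =
      ‖x‖ ^ (-(n : ℝ)) * (‖x‖ ^ (2 * k - 1) * ‖x‖) by rw [← this]]
    ring
  have key : ∫ x, 2 * k * A x ≤ ∫ x, (k * A x + (1 / k * B x + 2 * E x)) := by
    rw [← e1, id]
    refine integral_mono ?_ ((iA.const_mul k).add ((iB.const_mul _).add (iE.const_mul _))) ?_
    · refine (hg.supp.mono fun x hx => by simp [hx]).integrable ?_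
      have hhn : ContinuousOn (fun x : Euc n => h ‖x‖) {0}ᶜ :=
        hh.continuousOn.comp continuous_norm.continuousOn fun x hx => norm_pos_iff.mpr hx
      exact ((continuousOn_norm_rpow _).mul (((continuousOn_const.mul hhn).mul
        hg.continuous.continuousOn).mul (continuousOn_fderiv_self hg.smooth))).neg
    · intro x
      by_cases hx : x = 0
      · subst hx; simp [hA, hB, hE, hη.supp.zero]
      have h0 : 0 < ‖x‖ := norm_pos_iff.mpr hx
      have hd : fderiv ℝ (fun x => G x * η x) x x =
          G x * fderiv ℝ η x x + η x * fderiv ℝ G x x := by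
        rw [((hG.hasFDerivAt_punctured one_ne_zero hx).fun_mul
          (hη.differentiable x).hasFDerivAt).fderiv]
        simp
      have b1 := abs_le.mp (abs_fderiv_self_le G x)
      have b2 := abs_fderiv_self_le η x
      simp only [hd, hA, hB, hE, h, ew2 x hx]
      set W := ‖x‖ ^ (-(2 * a) - 2) with hW
      have hW0 : 0 < W := by positivity
      set d := 1 + c * ‖x‖ ^ (2 * k) with hd'
      have hd0 : 0 < d := by positivity
      rw [show -(‖x‖ ^ (-(n : ℝ)) * (2 * (‖x‖ ^ (2 * k) / D ‖x‖) * (G x * η x) *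
        (G x * fderiv ℝ η x x + η x * fderiv ℝ G x x))) = -((‖x‖ ^ (-(n : ℝ)) * ‖x‖ ^ (2 * k)) *
        (2 / d * (G x * η x) * (G x * fderiv ℝ η x x + η x * fderiv ℝ G x x))) by
          simp only [D, hd']; ring, ew x hx]
      have t1 : -(2 / d * (G x * η x) * (G x * fderiv ℝ η x x)) ≤
          2 * (1 / d * G x ^ 2 * |η x| * (‖∇ η x‖ * ‖x‖)) := by
        have : -(η x * fderiv ℝ η x x) ≤ |η x| * (‖∇ η x‖ * ‖x‖) := by
          refine (neg_le_abs _).trans ?_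
          rw [abs_mul]; gcongr
        have := mul_le_mul_of_nonneg_left this (by positivity : 0 ≤ 2 / d * G x ^ 2)
        calc _ = 2 / d * G x ^ 2 * -(η x * fderiv ℝ η x x) := by ring
          _ ≤ _ := this
          _ = _ := by ring
      have t2 : -(2 / d * (G x * η x) * (η x * fderiv ℝ G x x)) ≤
          k * (1 / d ^ 2 * (G x * η x) ^ 2) + 1 / k * (‖x‖ ^ 2 * ‖∇ G x‖ ^ 2 * η x ^ 2) := by
        have hsq : (fderiv ℝ G x x) ^ 2 ≤ ‖x‖ ^ 2 * ‖∇ G x‖ ^ 2 := by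
          rw [← mul_pow, mul_comm ‖x‖]; exact sq_le_sq' b1.1 b1.2
        have h3 : 1 / k * (fderiv ℝ G x x ^ 2 * η x ^ 2) ≤
            1 / k * (‖x‖ ^ 2 * ‖∇ G x‖ ^ 2 * η x ^ 2) := by gcongr
        refine le_trans ?_ (add_le_add_right h3 _)
        have h4 : 0 ≤ (1 / k) * (k * (1 / d * (G x * η x)) + η x * fderiv ℝ G x x) ^ 2 := by
          positivity
        have h5 : (1 / k) * (k * (1 / d * (G x * η x)) + η x * fderiv ℝ G x x) ^ 2 =
          k * (1 / d ^ 2 * (G x * η x) ^ 2) + 1 / k * (fderiv ℝ G x x ^ 2 * η x ^ 2) +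
          2 / d * (G x * η x) * (η x * fderiv ℝ G x x) := by
          field_simp; ring
        linarith
      have := mul_le_mul_of_nonneg_left (add_le_add t1 t2) hW0.le
      calc _ = W * (-(2 / d * (G x * η x) * (G x * fderiv ℝ η x x)) +
              -(2 / d * (G x * η x) * (η x * fderiv ℝ G x x))) := by ring
        _ ≤ _ := this
        _ = _ := by ring
  have iBE : Integrable fun x => 1 / k * B x + 2 * E x := (iB.const_mul _).add (iE.const_mul _)
  rw [integral_add (iA.const_mul k) iBE,
    integral_add (iB.const_mul _) (iE.const_mul _)] at key
  simp only [integral_const_mul] at key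
  have k2 : k * ∫ x, A x ≤ 1 / k * (∫ x, B x) + 2 * ∫ x, E x := by linarith
  have k3 := mul_le_mul_of_nonneg_left k2 (by positivity : 0 ≤ 1 / k)
  calc ∫ x, A x = 1 / k * (k * ∫ x, A x) := by field_simp
    _ ≤ _ := k3
    _ = _ := by field_simp

lemma hardy {a k : ℝ} (hk : 2 * k = n - 2 - 2 * a) (hk0 : 0 < k) {g : Euc n → ℝ} (hg : TestFn g) :
    ∫ x : Euc n, ‖x‖ ^ (-(2 * a) - 2) * g x ^ 2 ≤
      (4 / k ^ 2) * ∫ x : Euc n, ‖x‖ ^ (-(2 * a)) * ‖∇ g x‖ ^ 2 := by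
  have h1 := weighted_hardy hk hk0 le_rfl (G := fun _ => 1) contDiffOn_const hg
  have cg : ContinuousOn g {0}ᶜ := hg.continuous.continuousOn
  have cdg : ContinuousOn (fun x => ‖∇ g x‖) {0}ᶜ := (continuousOn_gradient hg.smooth).norm
  have i1 : Integrable fun x : Euc n => ‖x‖ ^ (-(2 * a) - 2) * g x ^ 2 :=
    (hg.supp.mono fun x hx => by simp [hx]).integrable ((continuousOn_norm_rpow _).mul (cg.pow 2))
  have i2 : Integrable fun x : Euc n => ‖x‖ ^ (-(2 * a)) * ‖∇ g x‖ ^ 2 :=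
    (hg.supp.gradient.mono fun x hx => by simp [hx]).integrable
      ((continuousOn_norm_rpow _).mul (cdg.pow 2))
  have h2 : ∫ x : Euc n, 2 / k * (‖x‖ ^ (-(2 * a) - 2) * |g x| * (‖∇ g x‖ * ‖x‖)) ≤
      ∫ x : Euc n, (1 / 2 * (‖x‖ ^ (-(2 * a) - 2) * g x ^ 2) +
        2 / k ^ 2 * (‖x‖ ^ (-(2 * a)) * ‖∇ g x‖ ^ 2)) := by
    refine integral_mono ?_ ((i1.const_mul _).add (i2.const_mul _)) fun x => ?_
    · refine (hg.supp.mono fun x hx => by simp [hx]).integrable ?_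
      exact continuousOn_const.mul (((continuousOn_norm_rpow _).mul cg.abs).mul
        (cdg.mul continuous_norm.continuousOn))
    by_cases hx : x = 0
    · subst hx
      simp only [hg.supp.zero, norm_zero, abs_zero]
      have : (0:ℝ) ≤ 2 / k ^ 2 * ((0:ℝ) ^ (-(2 * a)) * ‖∇ g 0‖ ^ 2) := by positivity
      simpa using this
    have h0 : 0 < ‖x‖ := norm_pos_iff.mpr hx
    have e : ‖x‖ ^ (-(2 * a)) = ‖x‖ ^ (-(2 * a) - 2) * ‖x‖ ^ 2 := by
      rw [← Real.rpow_natCast ‖x‖ 2, ← Real.rpow_add h0]; norm_num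
    rw [e, ← sq_abs (g x)]
    have : 0 ≤ ‖x‖ ^ (-(2 * a) - 2) * (|g x| - 2 / k * (‖∇ g x‖ * ‖x‖)) ^ 2 := by positivity
    have e2 : ‖x‖ ^ (-(2 * a) - 2) * (|g x| - 2 / k * (‖∇ g x‖ * ‖x‖)) ^ 2 =
      2 * (1 / 2 * (‖x‖ ^ (-(2 * a) - 2) * |g x| ^ 2) + 2 / k ^ 2 *
        (‖x‖ ^ (-(2 * a) - 2) * ‖x‖ ^ 2 * ‖∇ g x‖ ^ 2)) -
      2 * (2 / k * (‖x‖ ^ (-(2 * a) - 2) * |g x| * (‖∇ g x‖ * ‖x‖))) := by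
      field_simp; ring
    linarith
  rw [integral_add (i1.const_mul _) (i2.const_mul _)] at h2
  simp only [integral_const_mul] at h2
  have e0 : ∀ x : Euc n, ∇ (fun _ : Euc n => (1:ℝ)) x = 0 := fun x => by simp [gradient_eq_toDual_symm]
  simp only [e0, norm_zero, zero_mul, add_zero, div_one, one_pow, one_mul, mul_one, ne_eq,
    OfNat.ofNat_ne_zero, not_false_eq_true, zero_pow, mul_zero, integral_zero, zero_add] at h1
  have e4 : 4 / k ^ 2 * (∫ x : Euc n, ‖x‖ ^ (-(2 * a)) * ‖∇ g x‖ ^ 2) =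
    2 * (2 / k ^ 2 * ∫ x : Euc n, ‖x‖ ^ (-(2 * a)) * ‖∇ g x‖ ^ 2) := by ring
  rw [e4]
  linarith

end hardy

section integrability

variable {n : ℕ}

lemma continuousOn_wdiv (a : ℝ) {w : Euc n → ℝ} (hw : ContDiffOn ℝ 2 w {0}ᶜ) :
    ContinuousOn (wdiv a w) {0}ᶜ := by
  have hD : ContDiffOn ℝ 1 (fderiv ℝ w) {0}ᶜ :=
    hw.fderiv_of_isOpen isOpen_compl_singleton (by norm_num)
  have hl : ContinuousOn (lapl w) {0}ᶜ := by
    refine continuousOn_finsetSum _ fun i _ => ?_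
    have : ContDiffOn ℝ 1 (fun y => fderiv ℝ w y (EuclideanSpace.single i 1)) {0}ᶜ :=
      hD.clm_apply contDiffOn_const
    exact (this.continuousOn_fderiv_of_isOpen isOpen_compl_singleton le_rfl).clm_apply
      continuousOn_const
  refine (continuousOn_norm_rpow _).mul (hl.sub ((continuousOn_const.mul
    (continuousOn_id.inner (𝕜 := ℝ) (continuousOn_gradient (hw.of_le (by norm_num))))).div
    (continuous_norm.pow 2).continuousOn fun x hx => ?_))
  exact pow_ne_zero 2 (norm_ne_zero_iff.mpr hx)

lemma gradient_mul {f g : Euc n → ℝ} {x : Euc n} (hf : DifferentiableAt ℝ f x)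
    (hg : DifferentiableAt ℝ g x) : ∇ (fun y => f y * g y) x = f x • ∇ g x + g x • ∇ f x := by
  simp only [gradient_eq_toDual_symm]
  rw [(hf.hasFDerivAt.fun_mul hg.hasFDerivAt).fderiv]
  simp

lemma gradient_comp {f : Euc n → ℝ} {h : ℝ → ℝ} {h' : ℝ} {x : Euc n} (hf : DifferentiableAt ℝ f x)
    (hh : HasDerivAt h h' (f x)) : ∇ (fun y => h (f y)) x = h' • ∇ f x := by
  simp only [gradient_eq_toDual_symm]
  have : HasFDerivAt (fun y => h (f y)) (h' • fderiv ℝ f x) x :=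
    hh.comp_hasFDerivAt x hf.hasFDerivAt
  rw [this.fderiv]
  simp

lemma differentiableAt_punctured {m : WithTop ℕ∞} {f : Euc n → ℝ} (hf : ContDiffOn ℝ m f {0}ᶜ)
    (hm : m ≠ 0) {x : Euc n} (hx : x ≠ 0) : DifferentiableAt ℝ f x :=
  (hf.hasFDerivAt_punctured hm hx).differentiableAt

/-- The weight decaying like `‖x‖ ^ (-s)` at infinity. -/
def farWeight (s : ℝ) (x : Euc n) : ℝ := (1 + ‖x‖ ^ 2) ^ (-(s / 2))

lemma farWeight_pos (s : ℝ) (x : Euc n) : 0 < farWeight s x := by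
  unfold farWeight; positivity

lemma contDiff_farWeight (s : ℝ) : ContDiff ℝ 1 (farWeight s : Euc n → ℝ) :=
  (contDiff_const.add (contDiff_norm_sq ℝ)).rpow_const_of_ne fun x => by positivity

lemma norm_gradient_farWeight_le {s : ℝ} (hs : 0 ≤ s) {x : Euc n} (hx : x ≠ 0) :
    ‖∇ (farWeight s) x‖ * ‖x‖ ≤ s * farWeight s x := by
  have h0 : 0 < ‖x‖ := norm_pos_iff.mpr hx
  have hd : HasDerivAt (fun r : ℝ => (1 + r ^ 2) ^ (-(s / 2)))
      (2 * ‖x‖ * (-(s / 2)) * (1 + ‖x‖ ^ 2) ^ (-(s / 2) - 1)) ‖x‖ := by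
    have h1 : HasDerivAt (fun r : ℝ => 1 + r ^ 2) (2 * ‖x‖) ‖x‖ := by
      simpa using (hasDerivAt_pow 2 ‖x‖).const_add 1
    exact h1.rpow_const (Or.inl (by positivity))
  have hr : (farWeight s : Euc n → ℝ) = fun y => (fun r : ℝ => (1 + r ^ 2) ^ (-(s / 2))) ‖y‖ := rfl
  have hg := norm_gradient_radial hx hd
  rw [← hr] at hg
  rw [hg]
  have e : farWeight s x = (1 + ‖x‖ ^ 2) ^ (-(s / 2) - 1) * (1 + ‖x‖ ^ 2) := by
    rw [← Real.rpow_add_one (by positivity)]; simp [farWeight]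
  rw [e, show 2 * ‖x‖ * (-(s / 2)) * (1 + ‖x‖ ^ 2) ^ (-(s / 2) - 1) =
    -(‖x‖ * s * (1 + ‖x‖ ^ 2) ^ (-(s / 2) - 1)) by ring, abs_neg, abs_of_nonneg (by positivity)]
  have : 0 ≤ s * (1 + ‖x‖ ^ 2) ^ (-(s / 2) - 1) := by positivity
  nlinarith

lemma integrable_farWeight {a k s : ℝ} (hn : 0 < n) (hk : 2 * k = n - 2 - 2 * a) (hk0 : 0 < k)
    (hs : k < s) :
    Integrable fun x : Euc n => ‖x‖ ^ (-(2 * a) - 2) * farWeight s x ^ 2 := by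
  have hm : MeasurableSet {x : Euc n | ‖x‖ < 1} :=
    (isOpen_lt continuous_norm continuous_const).measurableSet
  have hme : AEStronglyMeasurable
      (fun x : Euc n => ‖x‖ ^ (-(2 * a) - 2) * farWeight s x ^ 2) volume := by
    refine Measurable.aestronglyMeasurable ?_
    exact (measurable_norm.pow_const _).mul (((contDiff_farWeight s).continuous.measurable).pow_const 2)
  rw [← integrableOn_univ, ← Set.union_compl_self {x : Euc n | ‖x‖ < 1}, integrableOn_union]
  constructor
  · refine (integrableOn_norm_rpow_ball hn (by linarith : 0 < 2 * k)).mono' hme.restrict ?_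
    refine ae_of_all _ fun x => ?_
    have h1 : farWeight s x ≤ 1 :=
      Real.rpow_le_one_of_one_le_of_nonpos (by nlinarith [norm_nonneg x]) (by linarith)
    have h2 : farWeight s x ^ 2 ≤ 1 := pow_le_one₀ (farWeight_pos s x).le h1
    rw [Real.norm_of_nonneg (by have := farWeight_pos s x; positivity)]
    calc _ ≤ ‖x‖ ^ (-(2 * a) - 2) * 1 := by gcongr
      _ = _ := by rw [mul_one, hk]; congr 1; ring
  · have hc : {x : Euc n | ‖x‖ < 1}ᶜ = {x | 1 ≤ ‖x‖} := by ext; simp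
    rw [hc]
    refine (integrableOn_norm_rpow_compl_ball hn (by linarith : 0 < 2 * s - 2 * k)).mono'
      hme.restrict ?_
    filter_upwards [ae_restrict_mem (hc ▸ hm.compl)] with x hx
    have h1 : (1:ℝ) ≤ ‖x‖ := hx
    have h0 : 0 < ‖x‖ := by linarith
    have h2 : farWeight s x ≤ ‖x‖ ^ (-s) := by
      have : ‖x‖ ^ (-s) = (‖x‖ ^ 2) ^ (-(s / 2)) := by
        rw [← Real.rpow_natCast, ← Real.rpow_mul h0.le]; congr 1; push_cast; ring
      rw [this]
      exact Real.rpow_le_rpow_of_nonpos (by positivity) (by linarith) (by linarith)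
    rw [Real.norm_of_nonneg (by have := farWeight_pos s x; positivity)]
    calc _ ≤ ‖x‖ ^ (-(2 * a) - 2) * (‖x‖ ^ (-s)) ^ 2 := by
          have := farWeight_pos s x; gcongr
      _ = _ := by
        rw [← Real.rpow_natCast (‖x‖ ^ (-s)), ← Real.rpow_mul h0.le, ← Real.rpow_add h0]
        congr 1; push_cast; linarith

/-- A positive supersolution of finite energy. -/
structure Supersol (a b p : ℝ) (w : Euc n → ℝ) : Prop where
  smooth : ContDiffOn ℝ 2 w {0}ᶜ
  pos : ∀ x, x ≠ 0 → 0 < w x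
  le_neg_wdiv : ∀ x, x ≠ 0 → ‖x‖ ^ (-(b * p)) * w x ^ (p - 1) ≤ -(wdiv a w x)
  energy : finiteEnergy a w

variable {a b p k : ℝ} {w : Euc n → ℝ}

lemma Supersol.smooth_one (hw : Supersol a b p w) : ContDiffOn ℝ 1 w {0}ᶜ :=
  hw.smooth.of_le (by norm_num)

lemma Supersol.continuousOn_rpow (hw : Supersol a b p w) (s : ℝ) :
    ContinuousOn (fun x => w x ^ s) {0}ᶜ :=
  hw.smooth.continuousOn.rpow_const fun x hx => Or.inl (hw.pos x hx).ne'

lemma Supersol.integrable_source (hn : 0 < n) (hk : 2 * k = n - 2 - 2 * a) (hk0 : 0 < k)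
    (hp : 1 < p) (hw : Supersol a b p w) :
    Integrable fun x : Euc n => ‖x‖ ^ (-(b * p)) * w x ^ (p - 1) * farWeight (k * p) x := by
  set s := k * p with hs
  have hs0 : k < s := by nlinarith
  obtain ⟨K, hK0, hK⟩ := exists_logCutoff n
  have iw := integrable_farWeight (a := a) hn hk hk0 hs0
  have hE : Integrable fun x : Euc n => ‖x‖ ^ (-(2 * a)) * ‖∇ w x‖ ^ 2 := hw.energy
  have cF : ContinuousOn (fun x : Euc n => ‖x‖ ^ (-(b * p)) * w x ^ (p - 1) * farWeight s x)
      {0}ᶜ := ((continuousOn_norm_rpow _).mul (hw.continuousOn_rpow _)).mul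
        (contDiff_farWeight s).continuous.continuousOn
  have hfw := fun x : Euc n => farWeight_pos s x
  refine integrable_of_logCutoff cF (fun x hx => ?_) hn hK (C := 
    ∫ x : Euc n, (1 / 2 * (‖x‖ ^ (-(2 * a)) * ‖∇ w x‖ ^ 2) +
      1 / 2 * (s + 2 * K) ^ 2 * (‖x‖ ^ (-(2 * a) - 2) * farWeight s x ^ 2))) ?_
  · have := hw.pos x hx; have := hfw x; positivity
  intro L hL η hη
  have hζ : TestFn fun x => farWeight s x * η x * η x :=
    TestFn.mul ((contDiff_farWeight s).contDiffOn.mul hη.test.smooth) hη.test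
  have e1 : ∫ x, ‖x‖ ^ (-(b * p)) * w x ^ (p - 1) * farWeight s x * η x ^ 2 ≤
      ∫ x, -(wdiv a w x) * (farWeight s x * η x * η x) := by
    refine integral_mono_ae ?_ ?_ ?_
    · exact (hη.test.supp.mono fun x hx => by simp [hx]).integrable
        (cF.mul (hη.test.continuous.pow 2).continuousOn)
    · exact (hη.test.supp.mono fun x hx => by simp [hx]).integrable
        ((continuousOn_wdiv a hw.smooth).neg.mul hζ.continuous.continuousOn)
    · filter_upwards [ae_ne_zero hn] with x hx
      have h1 := mul_le_mul_of_nonneg_right (hw.le_neg_wdiv x hx)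
        (mul_nonneg (hfw x).le (sq_nonneg (η x)))
      calc _ = ‖x‖ ^ (-(b * p)) * w x ^ (p - 1) * (farWeight s x * η x ^ 2) := by ring
        _ ≤ _ := h1
        _ = _ := by ring
  rw [← integral_inner_gradient_eq a hw.smooth hζ] at e1
  refine e1.trans (integral_mono_ae ?_ ((hE.const_mul _).add (iw.const_mul _)) ?_)
  · exact (hζ.supp.gradient.mono fun x hx => by simp [hx]).integrable
      ((continuousOn_norm_rpow _).mul ((continuousOn_gradient hw.smooth_one).inner
        (continuousOn_gradient hζ.smooth)))
  filter_upwards [ae_ne_zero hn] with x hx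
  have h0 : 0 < ‖x‖ := norm_pos_iff.mpr hx
  have dη := hη.test.differentiable x
  have dm : DifferentiableAt ℝ (farWeight s) x := (contDiff_farWeight s).differentiable (by norm_num) x
  have hg : ‖∇ (fun x => farWeight s x * η x * η x) x‖ * ‖x‖ ≤ (s + 2 * K) * farWeight s x := by
    rw [gradient_mul (dm.fun_mul dη) dη, gradient_mul dm dη]
    have h1 := hη.nonneg x
    have h2 := hη.le_one x
    have h3 : ‖∇ η x‖ * ‖x‖ ≤ K := (hη.grad x hx).trans (div_le_self hK0.le hL)
    have h4 := norm_gradient_farWeight_le (by linarith : 0 ≤ s) hx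
    have hm := hfw x
    calc _ ≤ (farWeight s x * η x * ‖∇ η x‖ + η x * (farWeight s x * ‖∇ η x‖ +
          η x * ‖∇ (farWeight s) x‖)) * ‖x‖ := by
          gcongr
          refine (norm_add_le _ _).trans ?_
          rw [norm_smul, norm_smul, Real.norm_of_nonneg (by positivity), Real.norm_of_nonneg h1]
          gcongr
          refine (norm_add_le _ _).trans ?_
          rw [norm_smul, norm_smul, Real.norm_of_nonneg (by positivity), Real.norm_of_nonneg h1]
      _ = η x * (2 * (farWeight s x * (‖∇ η x‖ * ‖x‖)) +
          η x * (‖∇ (farWeight s) x‖ * ‖x‖)) := by ring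
      _ ≤ 1 * (2 * (farWeight s x * K) + 1 * (s * farWeight s x)) := by gcongr
      _ = _ := by ring
  have e2 : ‖x‖ ^ (-(2 * a)) = ‖x‖ ^ (-(2 * a) - 2) * ‖x‖ ^ 2 := by
    rw [← Real.rpow_natCast ‖x‖ 2, ← Real.rpow_add h0]; norm_num
  have h5 := real_inner_le_norm (∇ w x) (∇ (fun x => farWeight s x * η x * η x) x)
  set N := ‖∇ (fun x => farWeight s x * η x * η x) x‖ with hN
  have hW : 0 < ‖x‖ ^ (-(2 * a) - 2) := by positivity
  have h6 : (N * ‖x‖) ^ 2 ≤ ((s + 2 * K) * farWeight s x) ^ 2 := by gcongr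
  have h7 : ⟪∇ w x, ∇ (fun x => farWeight s x * η x * η x) x⟫ * ‖x‖ ^ 2 ≤
      1 / 2 * (‖x‖ ^ 2 * ‖∇ w x‖ ^ 2) + 1 / 2 * ((s + 2 * K) * farWeight s x) ^ 2 := by
    have := mul_le_mul_of_nonneg_right h5 (sq_nonneg ‖x‖)
    nlinarith [sq_nonneg (‖x‖ * ‖∇ w x‖ - N * ‖x‖)]
  have h8 := mul_le_mul_of_nonneg_left h7 hW.le
  rw [e2]
  calc _ = ‖x‖ ^ (-(2 * a) - 2) *
      (⟪∇ w x, ∇ (fun x => farWeight s x * η x * η x) x⟫ * ‖x‖ ^ 2) := by ring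
    _ ≤ _ := h8
    _ = _ := by ring

lemma Supersol.integrableOn_source (hn : 0 < n) (hk : 2 * k = n - 2 - 2 * a) (hk0 : 0 < k)
    (hp : 1 < p) (hbp : b * p = n - k * p) (hw : Supersol a b p w) :
    IntegrableOn (fun x : Euc n => ‖x‖ ^ (-(n : ℝ)) * w x ^ (p - 1)) {x | 1 ≤ ‖x‖} := by
  have hm : MeasurableSet {x : Euc n | 1 ≤ ‖x‖} :=
    (isClosed_le continuous_const continuous_norm).measurableSet
  have hne : ∀ x ∈ {x : Euc n | 1 ≤ ‖x‖}, x ≠ 0 := fun x hx h => by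
    have : (1:ℝ) ≤ ‖x‖ := hx
    rw [h, norm_zero] at this; linarith
  have h := ((hw.integrable_source hn hk hk0 hp).const_mul (2 ^ (k * p / 2))).integrableOn
    (s := {x : Euc n | 1 ≤ ‖x‖})
  refine h.mono' ?_ ?_
  · exact (((continuousOn_norm_rpow _).mul (hw.continuousOn_rpow _)).mono hne).aestronglyMeasurable hm
  filter_upwards [ae_restrict_mem hm] with x hx
  have hx1 : (1:ℝ) ≤ ‖x‖ := hx
  have h0 : 0 < ‖x‖ := by linarith
  have hw0 := hw.pos x (hne x hx)
  rw [Real.norm_of_nonneg (by positivity)]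
  have h2 : ‖x‖ ^ (-(k * p)) ≤ 2 ^ (k * p / 2) * farWeight (k * p) x := by
    have e : ‖x‖ ^ (-(k * p)) = 2 ^ (k * p / 2) * (2 * ‖x‖ ^ 2) ^ (-(k * p / 2)) := by
      rw [Real.mul_rpow (by norm_num) (by positivity), ← mul_assoc, ← Real.rpow_add two_pos,
        ← Real.rpow_natCast, ← Real.rpow_mul h0.le]
      norm_num
      congr 1; ring
    rw [e]
    gcongr
    exact Real.rpow_le_rpow_of_nonpos (by positivity) (by nlinarith) (by
      have : 0 < k * p := by positivity
      linarith)
  have h3 : ‖x‖ ^ (-(n : ℝ)) = ‖x‖ ^ (-(b * p)) * ‖x‖ ^ (-(k * p)) := by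
    rw [← Real.rpow_add h0, hbp]; congr 1; ring
  calc _ = ‖x‖ ^ (-(b * p)) * w x ^ (p - 1) * ‖x‖ ^ (-(k * p)) := by rw [h3]; ring
    _ ≤ ‖x‖ ^ (-(b * p)) * w x ^ (p - 1) * (2 ^ (k * p / 2) * farWeight (k * p) x) := by gcongr
    _ = _ := by ring

end integrability

section squareIntegrability

variable {n : ℕ}

lemma integrable_of_tendsto_of_integral_le {X : Type*} [MeasurableSpace X] {μ : Measure X}
    {F : ℕ → X → ℝ} {f : X → ℝ} {C : ℝ}
    (hF : ∀ j, Integrable (F j) μ) (h0 : ∀ j, ∀ᵐ x ∂μ, 0 ≤ F j x) (hC : ∀ j, ∫ x, F j x ∂μ ≤ C)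
    (hlim : ∀ᵐ x ∂μ, Tendsto (fun j => F j x) atTop (𝓝 (f x))) : Integrable f μ := by
  refine ⟨aestronglyMeasurable_of_tendsto_ae _ (fun j => (hF j).1) hlim, ?_⟩
  have h1 : ∫⁻ x, ‖f x‖ₑ ∂μ = ∫⁻ x, liminf (fun j => ‖F j x‖ₑ) atTop ∂μ :=
    lintegral_congr_ae (hlim.mono fun x hx => hx.enorm.liminf_eq.symm)
  have h2 : ∀ j, ∫⁻ x, ‖F j x‖ₑ ∂μ ≤ ENNReal.ofReal C := fun j => by
    rw [← ofReal_integral_norm_eq_lintegral_enorm (hF j)]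
    refine ENNReal.ofReal_le_ofReal (le_trans (le_of_eq ?_) (hC j))
    exact integral_congr_ae ((h0 j).mono fun x hx => Real.norm_of_nonneg hx)
  rw [HasFiniteIntegral, h1]
  refine (lintegral_liminf_le' fun j => (hF j).1.enorm).trans_lt ?_
  refine lt_of_le_of_lt (liminf_le_of_le (by isBoundedDefault) fun c hc => ?_)
    (ENNReal.ofReal_lt_top (r := C))
  obtain ⟨j, hj⟩ := hc.exists
  exact hj.trans (h2 j)

/-- A bounded `C¹` truncation of the identity vanishing near zero. -/
structure Truncation (M ε : ℝ) (g g' : ℝ → ℝ) : Prop where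
  contDiff : ContDiff ℝ 1 g
  hasDeriv : ∀ s, HasDerivAt g (g' s) s
  deriv_le : ∀ s, |g' s| ≤ 1
  nonneg : ∀ s, 0 ≤ g s
  le_bound : ∀ s, g s ≤ M
  zero : ∀ s ≤ ε, g s = 0
  le_self : ∀ s, 0 ≤ s → g s ≤ s
  ge : ∀ s, 0 ≤ s → (s - 2 * ε) / (1 + s / M) ≤ g s

lemma exists_truncation {M ε : ℝ} (hM : 0 < M) (hε : 0 < ε) : ∃ g g', Truncation M ε g g' := by
  obtain ⟨S, T, σ, h⟩ := exists_posReg hε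
  have hpos : ∀ s, 0 < 1 + S s / M := fun s => by have := h.S_nonneg s; positivity
  have hd : ∀ s, HasDerivAt (fun s => S (s - ε) / (1 + S (s - ε) / M))
      (σ (s - ε) / (1 + S (s - ε) / M) ^ 2) s := fun s => by
    have h1 : HasDerivAt (fun s => S (s - ε)) (σ (s - ε)) s := (h.hasDerivS _).comp_sub_const s ε
    refine (h1.fun_div ((h1.div_const M).const_add 1) (hpos _).ne').congr_deriv ?_
    congr 1; ring
  have hle : ∀ s, S (s - ε) / (1 + S (s - ε) / M) ≤ S (s - ε) := fun s =>
    div_le_self (h.S_nonneg _) (by have := h.S_nonneg (s - ε); simp; positivity)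
  have cS : ContDiff ℝ 1 fun s => S (s - ε) := h.contDiffS.comp (contDiff_id.sub contDiff_const)
  refine ⟨fun s => S (s - ε) / (1 + S (s - ε) / M),
    fun s => σ (s - ε) / (1 + S (s - ε) / M) ^ 2,
    cS.div (contDiff_const.add (cS.div_const M)) fun s => (hpos _).ne', hd,
    fun s => ?_, fun s => div_nonneg (h.S_nonneg _) (hpos _).le, fun s => ?_, fun s hs => ?_,
    fun s hs => ?_, fun s hs => ?_⟩
  · rw [abs_of_nonneg (div_nonneg (h.σ_nonneg _) (sq_nonneg _)), div_le_one (pow_pos (hpos _) 2)]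
    have h1 : 1 ≤ 1 + S (s - ε) / M := by have := h.S_nonneg (s - ε); simp; positivity
    exact (h.σ_le _).trans (one_le_pow₀ h1)
  · rw [div_le_iff₀ (hpos _), mul_add, mul_div_cancel₀ _ hM.ne']; linarith
  · simp [h.S_zero (s - ε) (by linarith)]
  · refine (hle s).trans ?_
    rcases le_total s ε with h1 | h1
    · rw [h.S_zero _ (by linarith)]; exact hs
    · exact (h.S_le _ (by linarith)).trans (by linarith)
  · rcases le_total (s - 2 * ε) 0 with h1 | h1
    · exact (div_nonpos_of_nonpos_of_nonneg h1 (by positivity)).trans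
        (div_nonneg (h.S_nonneg _) (hpos _).le)
    · have h2 := h.S_le (s - ε) (by linarith)
      have h3 := h.le_S (s - ε)
      have h4 := h.S_nonneg (s - ε)
      gcongr <;> linarith

variable {a b p k : ℝ} {w : Euc n → ℝ}

lemma norm_rpow_two_mul_sq (s : ℝ) {x : Euc n} (hx : x ≠ 0) :
    ‖x‖ ^ (s - 2) * ‖x‖ ^ 2 = ‖x‖ ^ s := by
  rw [← Real.rpow_natCast ‖x‖ 2, ← Real.rpow_add (norm_pos_iff.mpr hx)]; norm_num

lemma Supersol.exists_hardy_approx (hn : 0 < n) (hk : 2 * k = n - 2 - 2 * a) (hk0 : 0 < k)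
    (hp : 1 < p) (hbp : b * p = n - k * p) (hw : Supersol a b p w) (j : ℕ) :
    ∃ (g : ℝ → ℝ) (g' : ℝ → ℝ) (K L : ℝ) (η : Euc n → ℝ), Truncation (j + 1) (1 / (j + 1)) g g' ∧
      LogCutoff K L η ∧ (j : ℝ) ≤ L ∧
      ∫ x : Euc n, ‖x‖ ^ (-(2 * a) - 2) / (1 + 1 / ((j : ℝ) + 1) * ‖x‖ ^ (2 * k)) ^ 2 *
        (g (w x) * η x) ^ 2 ≤
      (1 / k ^ 2) * (∫ x : Euc n, ‖x‖ ^ (-(2 * a)) * ‖∇ w x‖ ^ 2) + 2 / k := by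
  have hM : (0 : ℝ) < j + 1 := by positivity
  set M : ℝ := j + 1 with hMdef
  have hε : 0 < 1 / M := by positivity
  obtain ⟨g, g', hg⟩ := exists_truncation hM hε
  obtain ⟨K, hK0, hK⟩ := exists_logCutoff n
  have hmb : MeasurableSet {x : Euc n | ‖x‖ < 1} :=
    (isOpen_lt continuous_norm continuous_const).measurableSet
  have hmc : MeasurableSet {x : Euc n | 1 ≤ ‖x‖} :=
    (isClosed_le continuous_const continuous_norm).measurableSet
  let Z : Euc n → ℝ := fun x =>
    Set.indicator {x : Euc n | ‖x‖ < 1} (fun x => M ^ 2 * ‖x‖ ^ (2 * k - n)) x +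
    Set.indicator {x : Euc n | 1 ≤ ‖x‖}
      (fun x => M * M ^ 2 * M ^ (p - 1) * (‖x‖ ^ (-(n : ℝ)) * w x ^ (p - 1))) x
  have iZ : Integrable Z := by
    refine Integrable.add ?_ ?_
    · exact (integrable_indicator_iff hmb).mpr
        ((integrableOn_norm_rpow_ball hn (by linarith)).const_mul _)
    · exact (integrable_indicator_iff hmc).mpr
        ((hw.integrableOn_source hn hk hk0 hp hbp).const_mul _)
  have hZ0 : ∀ᵐ x, 0 ≤ Z x := by
    filter_upwards [ae_ne_zero hn] with x hx
    have := hw.pos x hx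
    refine add_nonneg (Set.indicator_apply_nonneg fun _ => ?_) (Set.indicator_apply_nonneg fun _ => ?_)
    · positivity
    · positivity
  have hIZ : 0 ≤ ∫ x, Z x := integral_nonneg_of_ae hZ0
  let L : ℝ := M + K * ∫ x, Z x
  have hL : 0 < L := by positivity
  obtain ⟨η, hη⟩ := hK L hL
  have hE : Integrable fun x : Euc n => ‖x‖ ^ (-(2 * a)) * ‖∇ w x‖ ^ 2 := hw.energy
  refine ⟨g, g', K, L, η, hg, hη, ?_, ?_⟩
  · have : 0 ≤ K * ∫ x, Z x := by positivity
    simp only [L, hMdef]; linarith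
  have cG : ContDiffOn ℝ 1 (fun x => g (w x)) {0}ᶜ :=
    hg.contDiff.comp_contDiffOn hw.smooth_one
  refine (weighted_hardy hk hk0 hε.le cG hη.test).trans ?_
  have hgr : ∀ x : Euc n, x ≠ 0 → ‖∇ (fun x => g (w x)) x‖ ≤ ‖∇ w x‖ := fun x hx => by
    rw [gradient_comp (differentiableAt_punctured hw.smooth two_ne_zero hx) (hg.hasDeriv _),
      norm_smul]
    exact mul_le_of_le_one_left (norm_nonneg _) (hg.deriv_le _)
  have e1 : ∫ x : Euc n, ‖x‖ ^ (-(2 * a)) * ‖∇ (fun x => g (w x)) x‖ ^ 2 * η x ^ 2 ≤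
      ∫ x : Euc n, ‖x‖ ^ (-(2 * a)) * ‖∇ w x‖ ^ 2 := by
    refine integral_mono_of_nonneg (ae_of_all _ fun x => by positivity) hE ?_
    filter_upwards [ae_ne_zero hn] with x hx
    have h1 := hη.le_one x
    have h2 := hη.nonneg x
    calc _ ≤ ‖x‖ ^ (-(2 * a)) * ‖∇ w x‖ ^ 2 * 1 ^ 2 := by
          gcongr; exact hgr x hx
      _ = _ := by ring
  have e2 : ∫ x : Euc n, ‖x‖ ^ (-(2 * a) - 2) / (1 + 1 / M * ‖x‖ ^ (2 * k)) * g (w x) ^ 2 *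
      |η x| * (‖∇ η x‖ * ‖x‖) ≤ ∫ x, K / L * Z x := by
    refine integral_mono_of_nonneg (ae_of_all _ fun x => by positivity) (iZ.const_mul _) ?_
    filter_upwards [ae_ne_zero hn] with x hx
    have h1 := hη.le_one x
    have h2 := hη.nonneg x
    have h3 := hη.grad x hx
    have h0 : 0 < ‖x‖ := norm_pos_iff.mpr hx
    have hw0 := hw.pos x hx
    have hg0 := hg.nonneg (w x)
    rw [abs_of_nonneg h2]
    have key : ‖x‖ ^ (-(2 * a) - 2) / (1 + 1 / M * ‖x‖ ^ (2 * k)) * g (w x) ^ 2 ≤ Z x := by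
      have hW : ‖x‖ ^ (-(2 * a) - 2) = ‖x‖ ^ (2 * k - n) := by rw [hk]; congr 1; ring
      have hgM : g (w x) ^ 2 ≤ M ^ 2 := by have := hg.le_bound (w x); gcongr
      rcases lt_or_ge ‖x‖ 1 with hx1 | hx1
      · have : Z x = M ^ 2 * ‖x‖ ^ (2 * k - n) := by
          simp [Z, Set.indicator, hx1, not_le.mpr hx1]
        rw [this, ← hW, mul_comm (M ^ 2)]
        gcongr
        refine div_le_self (by positivity) ?_
        simp; positivity
      · have : Z x = M * M ^ 2 * M ^ (p - 1) * (‖x‖ ^ (-(n : ℝ)) * w x ^ (p - 1)) := by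
          simp [Z, Set.indicator, hx1, not_lt.mpr hx1]
        rw [this]
        have h5 : ‖x‖ ^ (-(2 * a) - 2) / (1 + 1 / M * ‖x‖ ^ (2 * k)) ≤ M * ‖x‖ ^ (-(n : ℝ)) := by
          rw [div_le_iff₀ (by positivity), hW]
          have : ‖x‖ ^ (2 * k - n) = ‖x‖ ^ (-(n:ℝ)) * ‖x‖ ^ (2 * k) := by
            rw [← Real.rpow_add h0]; congr 1; ring
          rw [this, mul_add, show M * ‖x‖ ^ (-(n : ℝ)) * (1 / M * ‖x‖ ^ (2 * k)) =
            ‖x‖ ^ (-(n : ℝ)) * ‖x‖ ^ (2 * k) by field_simp]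
          have : 0 ≤ M * ‖x‖ ^ (-(n : ℝ)) * 1 := by positivity
          linarith
        have h6 : g (w x) ^ 2 ≤ M ^ 2 * (M ^ (p - 1) * w x ^ (p - 1)) := by
          rcases le_or_gt (w x) (1 / M) with h | h
          · rw [hg.zero _ h, zero_pow two_ne_zero]; positivity
          · refine hgM.trans (le_mul_of_one_le_right (by positivity) ?_)
            rw [← Real.mul_rpow hM.le hw0.le]
            refine Real.one_le_rpow ?_ (by linarith)
            rw [div_lt_iff₀ hM] at h; linarith
        calc _ ≤ M * ‖x‖ ^ (-(n : ℝ)) * (M ^ 2 * (M ^ (p - 1) * w x ^ (p - 1))) := by gcongr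
          _ = _ := by ring
    have hZx : 0 ≤ Z x := by
      refine le_trans ?_ key
      positivity
    calc _ ≤ Z x * 1 * (K / L) := by gcongr
      _ = _ := by ring
  have e3 : ∫ x, K / L * Z x ≤ 1 := by
    rw [integral_const_mul, div_mul_eq_mul_div, div_le_one hL]
    simp only [L]; linarith
  have e4 := e2.trans e3
  have : (0:ℝ) ≤ 2 / k := by positivity
  calc _ ≤ 1 / k ^ 2 * (∫ x : Euc n, ‖x‖ ^ (-(2 * a)) * ‖∇ w x‖ ^ 2) + 2 / k * 1 := by gcongr
    _ = _ := by ring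

lemma Supersol.integrable_sq (hn : 0 < n) (hk : 2 * k = n - 2 - 2 * a) (hk0 : 0 < k)
    (hp : 1 < p) (hbp : b * p = n - k * p) (hw : Supersol a b p w) :
    Integrable fun x : Euc n => ‖x‖ ^ (-(2 * a) - 2) * w x ^ 2 := by
  choose g g' K L η hg hη hL hI using hw.exists_hardy_approx hn hk hk0 hp hbp
  refine integrable_of_tendsto_of_integral_le (fun j => ?_) (fun j => ?_) hI ?_
  · refine ((hη j).test.supp.mono fun x hx => by simp [hx]).integrable ?_
    refine ((continuousOn_norm_rpow _).div ((continuousOn_const.add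
      (continuousOn_const.mul (continuousOn_norm_rpow _))).pow 2) fun x hx =>
        (?_ : (1 + 1 / ((j : ℝ) + 1) * ‖x‖ ^ (2 * k)) ^ 2 ≠ 0)).mul
      (((hg j).contDiff.continuous.comp_continuousOn hw.smooth.continuousOn).mul
        (hη j).test.continuous.continuousOn |>.pow 2)
    positivity
  · exact ae_of_all _ fun x => by positivity
  · filter_upwards [ae_ne_zero hn] with x hx
    have hw0 := (hw.pos x hx).le
    have t0 : Tendsto (fun j : ℕ => 1 / ((j : ℝ) + 1)) atTop (𝓝 0) :=
      tendsto_one_div_add_atTop_nhds_zero_nat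
    have t1 : Tendsto (fun j : ℕ => g j (w x)) atTop (𝓝 (w x)) := by
      have t2 : Tendsto (fun j : ℕ => (w x - 2 * (1 / ((j : ℝ) + 1))) / (1 + w x * (1 / ((j : ℝ) + 1))))
          atTop (𝓝 ((w x - 2 * 0) / (1 + w x * 0))) :=
        ((tendsto_const_nhds).sub (t0.const_mul 2)).div
          ((tendsto_const_nhds).add (t0.const_mul _)) (by simp)
      simp only [mul_zero, sub_zero, add_zero, div_one] at t2
      refine tendsto_of_tendsto_of_tendsto_of_le_of_le t2 tendsto_const_nhds (fun j => ?_)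
        fun j => (hg j).le_self _ hw0
      have := (hg j).ge _ hw0
      rwa [div_eq_mul_one_div (w x)] at this
    have t3 : Tendsto (fun j : ℕ => η j x) atTop (𝓝 1) := by
      refine tendsto_const_nhds.congr' ?_
      filter_upwards [eventually_ge_atTop ⌈|log ‖x‖|⌉₊] with j hj
      exact ((hη j).eq_one x hx ((Nat.ceil_le.mp hj).trans (hL j))).symm
    have := ((tendsto_const_nhds (x := ‖x‖ ^ (-(2 * a) - 2))).div
      (((t0.mul_const (‖x‖ ^ (2 * k))).const_add 1).pow 2) (by simp)).mul ((t1.mul t3).pow 2)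
    simpa using this

end squareIntegrability

section sobolev

variable {n : ℕ}

lemma aestronglyMeasurable_punctured (hn : 0 < n) {F : Euc n → ℝ} (hF : ContinuousOn F {0}ᶜ) :
    AEStronglyMeasurable F volume := by
  have h := hF.aestronglyMeasurable (μ := volume) (measurableSet_singleton (0 : Euc n)).compl
  rwa [Measure.restrict_eq_self_of_ae_mem] at h
  exact ae_ne_zero hn

/-- The critical Sobolev exponent. -/
def critExp (n : ℕ) : ℝ := 2 * n / (n - 2)

lemma two_lt_critExp (hn : 3 ≤ n) : 2 < critExp n := by
  have : (3 : ℝ) ≤ n := by exact_mod_cast hn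
  rw [critExp, lt_div_iff₀ (by linarith)]; linarith

lemma exists_sobolev (hn : 3 ≤ n) : ∃ C : ℝ, 0 ≤ C ∧ ∀ h : Euc n → ℝ, TestFn h →
    (∫ x, |h x| ^ critExp n) ^ (2 / critExp n) ≤ C * ∫ x, ‖∇ h x‖ ^ 2 := by
  have hn' : (3 : ℝ) ≤ n := by exact_mod_cast hn
  have hq := two_lt_critExp hn
  set q := critExp n with hqd
  refine ⟨(eLpNormLESNormFDerivOfEqInnerConst (volume : Measure (Euc n))
    ((2 : NNReal) : ℝ) : ℝ) ^ 2, by positivity, fun h hh => ?_⟩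
  set C := eLpNormLESNormFDerivOfEqInnerConst (volume : Measure (Euc n)) ((2 : NNReal) : ℝ)
  have hfin : Module.finrank ℝ (Euc n) = n := finrank_euclideanSpace_fin
  let q' : NNReal := ⟨q, by linarith⟩
  have key := eLpNorm_le_eLpNorm_fderiv_of_eq_inner (volume : Measure (Euc n)) hh.contDiff
    hh.supp.hasCompactSupport (p := 2) (p' := q') (by norm_num) (by rw [hfin]; omega) (by
      rw [hfin]; change q⁻¹ = _
      rw [hqd, critExp]
      have : (n:ℝ) - 2 ≠ 0 := by linarith
      have : (n:ℝ) ≠ 0 := by linarith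
      push_cast
      field_simp)
  have m1 : MemLp h q' volume :=
    hh.continuous.memLp_of_hasCompactSupport hh.supp.hasCompactSupport
  have m2 : MemLp (fderiv ℝ h) (2 : NNReal) volume :=
    hh.continuous_fderiv.memLp_of_hasCompactSupport
      (hh.supp.hasCompactSupport.fderiv ℝ)
  have hq0 : (q' : ENNReal) ≠ 0 := by
    have : q' ≠ 0 := fun h => by
      have : q = 0 := congrArg NNReal.toReal h
      linarith
    exact_mod_cast this
  rw [m1.eLpNorm_eq_integral_rpow_norm hq0 ENNReal.coe_ne_top,
    m2.eLpNorm_eq_integral_rpow_norm (by norm_num) ENNReal.coe_ne_top,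
    show (eLpNormLESNormFDerivOfEqInnerConst (volume : Measure (Euc n)) ((2 : NNReal) : ℝ) :
      ENNReal) = ENNReal.ofReal C from (ENNReal.ofReal_coe_nnreal).symm,
    ← ENNReal.ofReal_mul C.coe_nonneg] at key
  have k2 := (ENNReal.ofReal_le_ofReal_iff (by positivity)).mp key
  change (∫ x, |h x| ^ q) ^ q⁻¹ ≤ C * (∫ x, ‖fderiv ℝ h x‖ ^ (2 : ℝ)) ^ (2 : ℝ)⁻¹ at k2
  have hA : 0 ≤ ∫ x, |h x| ^ q := integral_nonneg fun x => by positivity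
  have hB : 0 ≤ ∫ x, ‖fderiv ℝ h x‖ ^ (2 : ℝ) := integral_nonneg fun x => by positivity
  calc (∫ x, |h x| ^ q) ^ (2 / q) = ((∫ x, |h x| ^ q) ^ q⁻¹) ^ 2 := by
        rw [← Real.rpow_natCast _ 2, ← Real.rpow_mul hA]; congr 1; push_cast; ring
    _ ≤ (C * (∫ x, ‖fderiv ℝ h x‖ ^ (2 : ℝ)) ^ (2 : ℝ)⁻¹) ^ 2 := by gcongr
    _ = _ := by
        rw [mul_pow, ← Real.rpow_natCast (_ ^ (2:ℝ)⁻¹) 2, ← Real.rpow_mul hB]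
        norm_num [norm_gradient]

lemma exists_weighted_sobolev {a k : ℝ} (hn : 3 ≤ n) (hk : 2 * k = n - 2 - 2 * a) (hk0 : 0 < k) :
    ∃ C : ℝ, 0 ≤ C ∧ ∀ g : Euc n → ℝ, TestFn g →
    (∫ x : Euc n, (‖x‖ ^ (-a) * |g x|) ^ critExp n) ^ (2 / critExp n) ≤
      C * ∫ x : Euc n, ‖x‖ ^ (-(2 * a)) * ‖∇ g x‖ ^ 2 := by
  obtain ⟨C, hC, H⟩ := exists_sobolev hn
  refine ⟨C * (2 + 2 * a ^ 2 * (4 / k ^ 2)), by positivity, fun g hg => ?_⟩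
  have hh : TestFn fun x : Euc n => ‖x‖ ^ (-a) * g x := TestFn.mul (contDiffOn_norm_rpow _) hg
  have h1 := H _ hh
  have e1 : ∀ x : Euc n, |‖x‖ ^ (-a) * g x| = ‖x‖ ^ (-a) * |g x| := fun x => by
    rw [abs_mul, abs_of_nonneg (by positivity)]
  simp only [e1] at h1
  refine h1.trans ?_
  rw [mul_assoc]
  refine mul_le_mul_of_nonneg_left ?_ hC
  have cg : ContinuousOn g {0}ᶜ := hg.continuous.continuousOn
  have cdg : ContinuousOn (fun x => ‖∇ g x‖) {0}ᶜ := (continuousOn_gradient hg.smooth).norm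
  have i1 : Integrable fun x : Euc n => ‖x‖ ^ (-(2 * a) - 2) * g x ^ 2 :=
    (hg.supp.mono fun x hx => by simp [hx]).integrable ((continuousOn_norm_rpow _).mul (cg.pow 2))
  have i2 : Integrable fun x : Euc n => ‖x‖ ^ (-(2 * a)) * ‖∇ g x‖ ^ 2 :=
    (hg.supp.gradient.mono fun x hx => by simp [hx]).integrable
      ((continuousOn_norm_rpow _).mul (cdg.pow 2))
  have h2 : ∫ x : Euc n, ‖∇ (fun x : Euc n => ‖x‖ ^ (-a) * g x) x‖ ^ 2 ≤
      ∫ x : Euc n, (2 * (‖x‖ ^ (-(2 * a)) * ‖∇ g x‖ ^ 2) +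
        2 * a ^ 2 * (‖x‖ ^ (-(2 * a) - 2) * g x ^ 2)) := by
    refine integral_mono_ae ?_ ((i2.const_mul _).add (i1.const_mul _)) ?_
    · exact (hh.supp.gradient.mono fun x hx => by simp [hx]).integrable
        ((continuousOn_gradient hh.smooth).norm.pow 2)
    filter_upwards [ae_ne_zero (by omega : 0 < n)] with x hx
    have h0 : 0 < ‖x‖ := norm_pos_iff.mpr hx
    have hr : ‖∇ (fun x : Euc n => ‖x‖ ^ (-a)) x‖ = |a| * ‖x‖ ^ (-a - 1) := by
      rw [norm_gradient_radial hx (Real.hasDerivAt_rpow_const (Or.inl h0.ne')), abs_mul, abs_neg,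
        abs_of_pos (by positivity : 0 < ‖x‖ ^ (-a - 1))]
    rw [gradient_mul (differentiableAt_punctured (contDiffOn_norm_rpow (m := 1) _) one_ne_zero hx)
      (hg.differentiable x)]
    have e2 : ‖x‖ ^ (-(2 * a)) = (‖x‖ ^ (-a)) ^ 2 := by
      rw [← Real.rpow_natCast, ← Real.rpow_mul h0.le]; congr 1; push_cast; ring
    have e3 : ‖x‖ ^ (-(2 * a) - 2) = (‖x‖ ^ (-a - 1)) ^ 2 := by
      rw [← Real.rpow_natCast, ← Real.rpow_mul h0.le]; congr 1; push_cast; ring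
    have h3 : ‖‖x‖ ^ (-a) • ∇ g x + g x • ∇ (fun x : Euc n => ‖x‖ ^ (-a)) x‖ ≤
        ‖x‖ ^ (-a) * ‖∇ g x‖ + |g x| * (|a| * ‖x‖ ^ (-a - 1)) := by
      refine (norm_add_le _ _).trans ?_
      rw [norm_smul, norm_smul, hr, Real.norm_of_nonneg (by positivity), Real.norm_eq_abs]
    calc _ ≤ (‖x‖ ^ (-a) * ‖∇ g x‖ + |g x| * (|a| * ‖x‖ ^ (-a - 1))) ^ 2 := by gcongr
      _ ≤ 2 * (‖x‖ ^ (-a) * ‖∇ g x‖) ^ 2 + 2 * (|g x| * (|a| * ‖x‖ ^ (-a - 1))) ^ 2 := by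
        nlinarith [sq_nonneg (‖x‖ ^ (-a) * ‖∇ g x‖ - |g x| * (|a| * ‖x‖ ^ (-a - 1)))]
      _ = _ := by rw [e2, e3, mul_pow, mul_pow |g x|, mul_pow |a|, sq_abs, sq_abs]; ring
  rw [integral_add (i2.const_mul _) (i1.const_mul _)] at h2
  simp only [integral_const_mul] at h2
  have h3 := hardy hk hk0 hg
  have : 2 * a ^ 2 * (∫ x : Euc n, ‖x‖ ^ (-(2 * a) - 2) * g x ^ 2) ≤ 2 * a ^ 2 * (4 / k ^ 2 *
    ∫ x : Euc n, ‖x‖ ^ (-(2 * a)) * ‖∇ g x‖ ^ 2) := by gcongr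
  linarith

variable {a b p k : ℝ} {w : Euc n → ℝ}

lemma Supersol.integrable_critExp (hn : 3 ≤ n) (hk : 2 * k = n - 2 - 2 * a) (hk0 : 0 < k)
    (hp : 1 < p) (hbp : b * p = n - k * p) (hw : Supersol a b p w) :
    Integrable fun x : Euc n => (‖x‖ ^ (-a) * w x) ^ critExp n := by
  have hn0 : 0 < n := by omega
  have hq := two_lt_critExp hn
  set q := critExp n
  obtain ⟨C, hC, H⟩ := exists_weighted_sobolev hn hk hk0
  obtain ⟨K, hK0, hK⟩ := exists_logCutoff n
  choose η hη using fun j : ℕ => hK (j + 1) (by positivity)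
  have hT : ∀ j, TestFn fun x => w x * η j x := fun j => TestFn.mul hw.smooth_one (hη j).test
  have hE : Integrable fun x : Euc n => ‖x‖ ^ (-(2 * a)) * ‖∇ w x‖ ^ 2 := hw.energy
  have hS := hw.integrable_sq hn0 hk hk0 hp hbp
  set D := ∫ x : Euc n, (2 * (‖x‖ ^ (-(2 * a)) * ‖∇ w x‖ ^ 2) +
      2 * K ^ 2 * (‖x‖ ^ (-(2 * a) - 2) * w x ^ 2)) with hD
  have hDj : ∀ j, ∫ x : Euc n, ‖x‖ ^ (-(2 * a)) * ‖∇ (fun x => w x * η j x) x‖ ^ 2 ≤ D := fun j => by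
    refine integral_mono_ae ?_ ((hE.const_mul _).add (hS.const_mul _)) ?_
    · exact ((hT j).supp.gradient.mono fun x hx => by simp [hx]).integrable
        ((continuousOn_norm_rpow _).mul ((continuousOn_gradient (hT j).smooth).norm.pow 2))
    filter_upwards [ae_ne_zero hn0] with x hx
    have h0 : 0 < ‖x‖ := norm_pos_iff.mpr hx
    rw [gradient_mul (differentiableAt_punctured hw.smooth two_ne_zero hx)
      ((hη j).test.differentiable x)]
    have h1 := (hη j).nonneg x
    have h2 := (hη j).le_one x
    have hw0 := hw.pos x hx
    have h3 : ‖∇ (η j) x‖ * ‖x‖ ≤ K := ((hη j).grad x hx).trans (div_le_self hK0.le (by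
      have : (0:ℝ) ≤ j := by positivity
      linarith))
    have h4 : ‖w x • ∇ (η j) x + η j x • ∇ w x‖ ≤ w x * ‖∇ (η j) x‖ + 1 * ‖∇ w x‖ := by
      refine (norm_add_le _ _).trans ?_
      rw [norm_smul, norm_smul, Real.norm_of_nonneg hw0.le, Real.norm_of_nonneg h1]
      gcongr
    rw [← norm_rpow_two_mul_sq (-(2 * a)) hx]
    calc _ ≤ ‖x‖ ^ (-(2 * a) - 2) * ‖x‖ ^ 2 * (w x * ‖∇ (η j) x‖ + 1 * ‖∇ w x‖) ^ 2 := by gcongr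
      _ ≤ ‖x‖ ^ (-(2 * a) - 2) * ‖x‖ ^ 2 *
          (2 * (w x * ‖∇ (η j) x‖) ^ 2 + 2 * ‖∇ w x‖ ^ 2) := by
        gcongr
        nlinarith [sq_nonneg (w x * ‖∇ (η j) x‖ - ‖∇ w x‖)]
      _ = 2 * (‖x‖ ^ (-(2 * a) - 2) * ‖x‖ ^ 2 * ‖∇ w x‖ ^ 2) +
          2 * (‖∇ (η j) x‖ * ‖x‖) ^ 2 * (‖x‖ ^ (-(2 * a) - 2) * w x ^ 2) := by ring
      _ ≤ _ := by gcongr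
  have cF : ContinuousOn (fun x : Euc n => ‖x‖ ^ (-a) * w x) {0}ᶜ :=
    (continuousOn_norm_rpow _).mul hw.smooth.continuousOn
  refine integrable_of_tendsto_of_integral_le
    (F := fun j x => (‖x‖ ^ (-a) * |w x * η j x|) ^ q) (C := (C * D) ^ (q / 2))
    (fun j => ?_) (fun j => ae_of_all _ fun x => by positivity) (fun j => ?_) ?_
  · have hq0 : q ≠ 0 := by linarith
    refine ((hT j).supp.mono fun x hx => by simp [hx, hq0]).integrable ?_
    exact (((continuousOn_norm_rpow _).mul (hT j).continuous.continuousOn.abs).rpow_const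
      fun x hx => Or.inr (by linarith))
  · have h1 := (H _ (hT j)).trans (mul_le_mul_of_nonneg_left (hDj j) hC)
    have hI : 0 ≤ ∫ x : Euc n, (‖x‖ ^ (-a) * |w x * η j x|) ^ q :=
      integral_nonneg fun x => by positivity
    have h2 := Real.rpow_le_rpow (by positivity) h1 (by linarith : 0 ≤ q / 2)
    rwa [← Real.rpow_mul hI, show 2 / q * (q / 2) = 1 by
      have : q ≠ 0 := by linarith
      field_simp, Real.rpow_one] at h2
  · filter_upwards [ae_ne_zero hn0] with x hx
    refine tendsto_const_nhds.congr' ?_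
    filter_upwards [eventually_ge_atTop ⌈|log ‖x‖|⌉₊] with j hj
    have : |log ‖x‖| ≤ (j : ℝ) + 1 := (Nat.ceil_le.mp hj).trans (by linarith)
    rw [(hη j).eq_one x hx this, mul_one, abs_of_pos (hw.pos x hx)]

/-- Smallness of the linearised potential on sets carrying little critical mass. -/
lemma exists_small_form (hn : 3 ≤ n) (hk : 2 * k = n - 2 - 2 * a) (hk0 : 0 < k)
    (hp : 2 < p) (hpq : p ≤ critExp n) (hbp : b * p = n - k * p) {Φ : Euc n → ℝ}
    (hΦc : ContinuousOn Φ {0}ᶜ) (hΦ0 : ∀ x, x ≠ 0 → 0 < Φ x)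
    (hΦ : Integrable fun x : Euc n => (‖x‖ ^ (-a) * Φ x) ^ critExp n) {θ : ℝ} (hθ : 0 < θ) :
    ∃ ε : ℝ, 0 < ε ∧ ∀ A : Set (Euc n), MeasurableSet A →
      ∫ x in A, (‖x‖ ^ (-a) * Φ x) ^ critExp n < ε → ∀ g : Euc n → ℝ, TestFn g →
      ∫ x in A, ‖x‖ ^ (-(b * p)) * Φ x ^ (p - 2) * g x ^ 2 ≤
        θ * ∫ x : Euc n, ‖x‖ ^ (-(2 * a)) * ‖∇ g x‖ ^ 2 := by
  have hn0 : 0 < n := by omega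
  have hn' : (3 : ℝ) ≤ n := by exact_mod_cast hn
  have hq := two_lt_critExp hn
  have hkq : k * critExp n = n - a * critExp n := by
    have : (n:ℝ) - 2 ≠ 0 := by linarith
    rw [show k = (n - 2) / 2 - a by linarith, critExp]; field_simp
  set q := critExp n
  obtain ⟨C, hC, H⟩ := exists_weighted_sobolev (a := a) hn hk hk0
  set δ := θ * k ^ 2 / 8 with hδ
  have hδ0 : 0 < δ := by positivity
  set Cδ := δ ^ ((p - q) / (p - 2)) with hCδ
  have hCδ0 : 0 < Cδ := by positivity
  have interp : ∀ t : ℝ, 0 < t → t ^ (p - 2) ≤ δ + Cδ * t ^ (q - 2) := fun t ht => by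
    rcases le_or_gt (t ^ (p - 2)) δ with h | h
    · have : 0 ≤ Cδ * t ^ (q - 2) := by positivity
      linarith
    · have h1 : (t ^ (p - 2)) ^ ((p - q) / (p - 2)) ≤ Cδ :=
        Real.rpow_le_rpow_of_nonpos hδ0 h.le
          (div_nonpos_of_nonpos_of_nonneg (by linarith) (by linarith))
      rw [← Real.rpow_mul ht.le, mul_div_cancel₀ _ (by linarith : p - 2 ≠ 0)] at h1
      have h2 : t ^ (p - 2) = t ^ (p - q) * t ^ (q - 2) := by
        rw [← Real.rpow_add ht]; congr 1; ring
      have h3 : t ^ (p - q) * t ^ (q - 2) ≤ Cδ * t ^ (q - 2) := by gcongr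
      linarith
  set r := (q - 2) / q with hr
  have hr0 : 0 < r := div_pos (by linarith) (by linarith)
  set ε := (θ / 2 / (Cδ * (C + 1))) ^ r⁻¹ with hε
  have hε0 : 0 < ε := by positivity
  refine ⟨ε, hε0, fun A hA hAε g hg => ?_⟩
  have i1 : Integrable fun x : Euc n => ‖x‖ ^ (-(2 * a) - 2) * g x ^ 2 :=
    (hg.supp.mono fun x hx => by simp [hx]).integrable
      ((continuousOn_norm_rpow _).mul (hg.continuous.pow 2).continuousOn)
  have cF : ContinuousOn (fun x : Euc n => ‖x‖ ^ (-a) * Φ x) {0}ᶜ := (continuousOn_norm_rpow _).mul hΦc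
  have pF : ∀ x : Euc n, x ≠ 0 → 0 < ‖x‖ ^ (-a) * Φ x := fun x hx =>
    mul_pos (Real.rpow_pos_of_pos (norm_pos_iff.mpr hx) _) (hΦ0 x hx)
  have cg : ContinuousOn (fun x : Euc n => ‖x‖ ^ (-a) * |g x|) {0}ᶜ :=
    (continuousOn_norm_rpow _).mul hg.continuous.continuousOn.abs
  have cFq : ContinuousOn (fun x : Euc n => (‖x‖ ^ (-a) * Φ x) ^ (q - 2)) {0}ᶜ :=
    cF.rpow_const fun x hx => Or.inl (pF x hx).ne'
  have i2 : Integrable fun x : Euc n => (‖x‖ ^ (-a) * Φ x) ^ (q - 2) * (‖x‖ ^ (-a) * |g x|) ^ 2 :=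
    (hg.supp.mono fun x hx => by simp [hx]).integrable (cFq.mul (cg.pow 2))
  have i3 : Integrable fun x : Euc n => (‖x‖ ^ (-a) * |g x|) ^ q := by
    have hq0 : q ≠ 0 := by linarith
    exact (hg.supp.mono fun x hx => by simp [hx, hq0]).integrable
      (cg.rpow_const fun x hx => Or.inr (by linarith))
  have h1 : ∫ x in A, ‖x‖ ^ (-(b * p)) * Φ x ^ (p - 2) * g x ^ 2 ≤
      ∫ x in A, (δ * (‖x‖ ^ (-(2 * a) - 2) * g x ^ 2) +
        Cδ * ((‖x‖ ^ (-a) * Φ x) ^ (q - 2) * (‖x‖ ^ (-a) * |g x|) ^ 2)) := by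
    refine integral_mono_ae ?_ ((i1.const_mul _).add (i2.const_mul _)).integrableOn ?_
    · refine Integrable.integrableOn ?_
      exact (hg.supp.mono fun x hx => by simp [hx]).integrable
        (((continuousOn_norm_rpow _).mul (hΦc.rpow_const fun x hx => Or.inl (hΦ0 x hx).ne')).mul
          (hg.continuous.pow 2).continuousOn)
    refine ae_restrict_of_ae ?_
    filter_upwards [ae_ne_zero hn0] with x hx
    have h0 : 0 < ‖x‖ := norm_pos_iff.mpr hx
    have hφ := hΦ0 x hx
    have e1 : ‖x‖ ^ (-(b * p)) * Φ x ^ (p - 2) = ‖x‖ ^ (-(2 * a) - 2) * (‖x‖ ^ k * Φ x) ^ (p - 2) := by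
      rw [Real.mul_rpow (by positivity) hφ.le, ← Real.rpow_mul h0.le, ← mul_assoc,
        ← Real.rpow_add h0, hbp]
      congr 2; linarith
    have e2 : ‖x‖ ^ (-(2 * a) - 2) * (‖x‖ ^ k * Φ x) ^ (q - 2) =
        (‖x‖ ^ (-a) * Φ x) ^ (q - 2) * (‖x‖ ^ (-a)) ^ 2 := by
      rw [Real.mul_rpow (by positivity) hφ.le, Real.mul_rpow (by positivity) hφ.le,
        ← Real.rpow_mul h0.le, ← Real.rpow_mul h0.le, ← mul_assoc, ← Real.rpow_add h0,
        mul_right_comm, ← Real.rpow_natCast (‖x‖ ^ (-a)) 2, ← Real.rpow_mul h0.le,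
        ← Real.rpow_add h0]
      congr 2; push_cast; linarith
    calc _ = ‖x‖ ^ (-(2 * a) - 2) * g x ^ 2 * (‖x‖ ^ k * Φ x) ^ (p - 2) := by rw [e1]; ring
      _ ≤ ‖x‖ ^ (-(2 * a) - 2) * g x ^ 2 * (δ + Cδ * (‖x‖ ^ k * Φ x) ^ (q - 2)) := by
        gcongr; exact interp _ (by positivity)
      _ = δ * (‖x‖ ^ (-(2 * a) - 2) * g x ^ 2) +
          Cδ * ((‖x‖ ^ (-(2 * a) - 2) * (‖x‖ ^ k * Φ x) ^ (q - 2)) * g x ^ 2) := by ring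
      _ = _ := by rw [e2, mul_pow, sq_abs]; ring
  rw [integral_add (i1.const_mul _).integrableOn (i2.const_mul _).integrableOn] at h1
  simp only [integral_const_mul] at h1
  set E := ∫ x : Euc n, ‖x‖ ^ (-(2 * a)) * ‖∇ g x‖ ^ 2 with hE
  have hE0 : 0 ≤ E := integral_nonneg fun x => by positivity
  have h2 : ∫ x in A, ‖x‖ ^ (-(2 * a) - 2) * g x ^ 2 ≤ 4 / k ^ 2 * E :=
    (setIntegral_le_integral i1 (ae_of_all _ fun x => by positivity)).trans (hardy hk hk0 hg)
  have h3 : ∫ x in A, (‖x‖ ^ (-a) * Φ x) ^ (q - 2) * (‖x‖ ^ (-a) * |g x|) ^ 2 ≤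
      (∫ x in A, (‖x‖ ^ (-a) * Φ x) ^ q) ^ r * (C * E) := by
    have hc : (q / (q - 2)).HolderConjugate (q / 2) := by
      rw [Real.holderConjugate_iff]
      have : q - 2 ≠ 0 := by linarith
      have : q ≠ 0 := by linarith
      refine ⟨?_, by field_simp; ring⟩
      rw [lt_div_iff₀ (by linarith)]; linarith
    have hp1 : 0 < q / (q - 2) := hc.pos
    have hp2 : 0 < q / 2 := hc.symm.pos
    have pFn : ∀ x : Euc n, x ≠ 0 → ((‖x‖ ^ (-a) * Φ x) ^ (q - 2)) ^ (q / (q - 2)) =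
        (‖x‖ ^ (-a) * Φ x) ^ q := fun x hx => by
      rw [← Real.rpow_mul (pF x hx).le, mul_div_cancel₀ _ (by linarith : q - 2 ≠ 0)]
    have pgn : ∀ x : Euc n, ((‖x‖ ^ (-a) * |g x|) ^ 2) ^ (q / 2) = (‖x‖ ^ (-a) * |g x|) ^ q :=
      fun x => by
        rw [← Real.rpow_natCast _ 2, ← Real.rpow_mul (by positivity)]
        congr 1; push_cast; field_simp
    have ane := ae_ne_zero hn0
    have nnF : ∀ᵐ x : Euc n, 0 ≤ (‖x‖ ^ (-a) * Φ x) ^ (q - 2) :=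
      ane.mono fun x hx => Real.rpow_nonneg (pF x hx).le _
    have m1 : MemLp (fun x : Euc n => (‖x‖ ^ (-a) * Φ x) ^ (q - 2)) (ENNReal.ofReal (q / (q - 2)))
        (volume.restrict A) := by
      refine MemLp.restrict A ?_
      rw [← integrable_norm_rpow_iff (aestronglyMeasurable_punctured hn0 cFq)
        (by simpa using hp1) ENNReal.ofReal_ne_top, ENNReal.toReal_ofReal hp1.le]
      refine hΦ.congr ((ane.and nnF).mono fun x hx => ?_)
      simp only [Real.norm_of_nonneg hx.2]
      exact (pFn x hx.1).symm
    have cg2 : ContinuousOn (fun x : Euc n => (‖x‖ ^ (-a) * |g x|) ^ 2) {0}ᶜ := cg.pow 2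
    have m2 : MemLp (fun x : Euc n => (‖x‖ ^ (-a) * |g x|) ^ 2) (ENNReal.ofReal (q / 2))
        (volume.restrict A) := by
      refine MemLp.restrict A ?_
      rw [← integrable_norm_rpow_iff (aestronglyMeasurable_punctured hn0 cg2)
        (by simpa using hp2) ENNReal.ofReal_ne_top, ENNReal.toReal_ofReal hp2.le]
      refine i3.congr (ae_of_all _ fun x => ?_)
      simp only [Real.norm_of_nonneg (sq_nonneg _)]
      exact (pgn x).symm
    have hh := integral_mul_le_Lp_mul_Lq_of_nonneg hc (ae_restrict_of_ae nnF)
      (ae_of_all _ fun x => sq_nonneg _) m1 m2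
    have eF : ∫ x in A, ((‖x‖ ^ (-a) * Φ x) ^ (q - 2)) ^ (q / (q - 2)) =
        ∫ x in A, (‖x‖ ^ (-a) * Φ x) ^ q :=
      integral_congr_ae (ae_restrict_of_ae (ane.mono pFn))
    simp only [pgn] at hh
    rw [eF] at hh
    refine hh.trans ?_
    rw [show 1 / (q / (q - 2)) = r by rw [hr]; simp]
    have hnn : 0 ≤ ∫ x in A, (‖x‖ ^ (-a) * Φ x) ^ q :=
      integral_nonneg_of_ae (ae_restrict_of_ae (ane.mono fun x hx => Real.rpow_nonneg (pF x hx).le _))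
    gcongr
    rw [show 1 / (q / 2) = 2 / q by simp]
    refine le_trans ?_ (H g hg)
    exact Real.rpow_le_rpow (integral_nonneg fun x => by positivity)
      (setIntegral_le_integral i3 (ae_of_all _ fun x => by positivity)) (by positivity)
  have hnn : 0 ≤ ∫ x in A, (‖x‖ ^ (-a) * Φ x) ^ q :=
      integral_nonneg_of_ae (ae_restrict_of_ae ((ae_ne_zero hn0).mono fun x hx =>
        Real.rpow_nonneg (pF x hx).le _))
  have h4 : (∫ x in A, (‖x‖ ^ (-a) * Φ x) ^ q) ^ r ≤ θ / 2 / (Cδ * (C + 1)) := by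
    calc _ ≤ ε ^ r := by gcongr
      _ = _ := by rw [hε, ← Real.rpow_mul (by positivity), inv_mul_cancel₀ hr0.ne', Real.rpow_one]
  calc _ ≤ δ * (4 / k ^ 2 * E) + Cδ * (θ / 2 / (Cδ * (C + 1)) * (C * E)) := by
        refine h1.trans ?_
        gcongr
        exact h3.trans (by gcongr)
    _ = θ / 2 * E + θ / 2 * (C / (C + 1)) * E := by rw [hδ]; field_simp; ring
    _ ≤ θ / 2 * E + θ / 2 * 1 * E := by
        gcongr
        exact (div_le_one (by positivity)).mpr (by linarith)
    _ = θ * E := by ring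

end sobolev

section comparison

variable {n : ℕ}

lemma continuousAt_indicator_of_frontier {V : Type*} [NormedAddCommGroup V] {Ω : Set (Euc n)}
    {F : Euc n → V} {x : Euc n} (hF : ContinuousAt F x) (h0 : x ∈ frontier Ω → F x = 0) :
    ContinuousAt (Ω.indicator F) x := by
  by_cases hx : x ∈ frontier Ω
  · have hF0 := h0 hx
    have e : Ω.indicator F x = 0 := by
      by_cases h : x ∈ Ω <;> simp [h, hF0]
    rw [ContinuousAt, hF0] at hF
    rw [ContinuousAt, e]
    exact squeeze_zero_norm (fun y => norm_indicator_le_norm_self F y)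
      (by simpa using hF.norm)
  · rw [frontier_eq_closure_inter_closure, Set.mem_inter_iff, not_and_or] at hx
    rcases hx with hx | hx
    · refine (continuousAt_const (y := (0 : V))).congr ?_
      filter_upwards [isClosed_closure.isOpen_compl.mem_nhds hx] with y hy
      rw [Set.indicator_of_notMem (fun h => hy (subset_closure h))]
    · refine hF.congr ?_
      filter_upwards [isClosed_closure.isOpen_compl.mem_nhds hx] with y hy
      rw [Set.indicator_of_mem (not_not.mp fun h => hy (subset_closure h))]

lemma hasFDerivAt_indicator {Ω : Set (Euc n)} {f : Euc n → ℝ} {x : Euc n} {f' : Euc n →L[ℝ] ℝ}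
    (hf : HasFDerivAt f f' x) (h0 : x ∈ frontier Ω → f x = 0 ∧ f' = 0) :
    HasFDerivAt (Ω.indicator f) (Ω.indicator (fun _ => f') x) x := by
  by_cases hx : x ∈ frontier Ω
  · obtain ⟨hF0, rfl⟩ := h0 hx
    have e : Ω.indicator f x = 0 := by
      by_cases h : x ∈ Ω <;> simp [h, hF0]
    rw [hasFDerivAt_iff_isLittleO_nhds_zero] at hf ⊢
    simp only [Set.indicator_zero, hF0, e] at hf ⊢
    refine (Asymptotics.IsBigO.of_bound 1 (Eventually.of_forall fun y => ?_)).trans_isLittleO hf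
    simpa using norm_indicator_le_norm_self (s := Ω) f (x + y)
  · rw [frontier_eq_closure_inter_closure, Set.mem_inter_iff, not_and_or] at hx
    rcases hx with hx | hx
    · rw [Set.indicator_of_notMem (fun h => hx (subset_closure h))]
      refine (hasFDerivAt_const (0 : ℝ) x).congr_of_eventuallyEq ?_
      filter_upwards [isClosed_closure.isOpen_compl.mem_nhds hx] with y hy
      rw [Set.indicator_of_notMem (fun h => hy (subset_closure h))]
    · rw [Set.indicator_of_mem (not_not.mp fun h => hx (subset_closure h))]
      refine hf.congr_of_eventuallyEq ?_
      filter_upwards [isClosed_closure.isOpen_compl.mem_nhds hx] with y hy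
      rw [Set.indicator_of_mem (not_not.mp fun h => hy (subset_closure h))]

section indicator

variable {Ω : Set (Euc n)} {f : Euc n → ℝ}

lemma fderiv_indicator (hf : ContDiffOn ℝ 1 f {0}ᶜ)
    (h0 : ∀ x ∈ frontier Ω, x ≠ 0 → f x = 0 ∧ fderiv ℝ f x = 0)
    {x : Euc n} (hx : x ≠ 0) :
    fderiv ℝ (Ω.indicator f) x = Ω.indicator (fderiv ℝ f) x := by
  rw [(hasFDerivAt_indicator (hf.hasFDerivAt_punctured one_ne_zero hx)
    (fun h => h0 x h hx)).fderiv]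
  by_cases h : x ∈ Ω <;> simp [h]

lemma contDiffOn_indicator (hf : ContDiffOn ℝ 1 f {0}ᶜ)
    (h0 : ∀ x ∈ frontier Ω, x ≠ 0 → f x = 0 ∧ fderiv ℝ f x = 0) :
    ContDiffOn ℝ 1 (Ω.indicator f) {0}ᶜ := by
  have hc : ContinuousOn (fderiv ℝ f) {0}ᶜ :=
    hf.continuousOn_fderiv_of_isOpen isOpen_compl_singleton le_rfl
  rw [show (1 : WithTop ℕ∞) = 0 + 1 from rfl,
    contDiffOn_succ_iff_fderiv_of_isOpen isOpen_compl_singleton]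
  refine ⟨fun x hx => ?_, by simp, ?_⟩
  · exact (hasFDerivAt_indicator (hf.hasFDerivAt_punctured one_ne_zero hx)
      (fun h => h0 x h hx)).differentiableAt.differentiableWithinAt
  · rw [contDiffOn_zero]
    refine ContinuousOn.congr (f := Ω.indicator (fderiv ℝ f)) (fun x hx => ?_)
      fun x hx => fderiv_indicator hf h0 hx
    exact (continuousAt_indicator_of_frontier
      (hc.continuousAt (isOpen_compl_singleton.mem_nhds hx))
      fun h => (h0 x h hx).2).continuousWithinAt

lemma gradient_indicator (hf : ContDiffOn ℝ 1 f {0}ᶜ)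
    (h0 : ∀ x ∈ frontier Ω, x ≠ 0 → f x = 0 ∧ fderiv ℝ f x = 0)
    {x : Euc n} (hx : x ≠ 0) :
    ∇ (Ω.indicator f) x = Ω.indicator (∇ f) x := by
  rw [gradient_eq_toDual_symm, fderiv_indicator hf h0 hx]
  by_cases h : x ∈ Ω <;> simp [h, gradient_eq_toDual_symm]

end indicator

lemma lapl_sub {u v : Euc n → ℝ} (hu : ContDiffOn ℝ 2 u {0}ᶜ) (hv : ContDiffOn ℝ 2 v {0}ᶜ)
    {x : Euc n} (hx : x ≠ 0) : lapl (fun y => u y - v y) x = lapl u x - lapl v x := by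
  unfold lapl
  rw [← Finset.sum_sub_distrib]
  refine Finset.sum_congr rfl fun i _ => ?_
  have hD : ∀ {w : Euc n → ℝ}, ContDiffOn ℝ 2 w {0}ᶜ → DifferentiableAt ℝ
      (fun y => fderiv ℝ w y (EuclideanSpace.single i 1)) x := fun {w} hw => by
    have hD : ContDiffOn ℝ 1 (fderiv ℝ w) {0}ᶜ :=
      hw.fderiv_of_isOpen isOpen_compl_singleton (by norm_num)
    exact differentiableAt_punctured (hD.clm_apply contDiffOn_const) one_ne_zero hx
  have e : (fun y => fderiv ℝ (fun y => u y - v y) y (EuclideanSpace.single i 1)) =ᶠ[𝓝 x]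
      fun y => fderiv ℝ u y (EuclideanSpace.single i 1) -
        fderiv ℝ v y (EuclideanSpace.single i 1) := by
    filter_upwards [isOpen_compl_singleton.mem_nhds hx] with y hy
    rw [((hu.hasFDerivAt_punctured two_ne_zero hy).fun_sub
      (hv.hasFDerivAt_punctured two_ne_zero hy)).fderiv, sub_apply]
  rw [e.fderiv_eq, ((hD hu).hasFDerivAt.fun_sub (hD hv).hasFDerivAt).fderiv, sub_apply]

lemma wdiv_sub (a : ℝ) {u v : Euc n → ℝ} (hu : ContDiffOn ℝ 2 u {0}ᶜ)
    (hv : ContDiffOn ℝ 2 v {0}ᶜ) {x : Euc n} (hx : x ≠ 0) :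
    wdiv a (fun y => u y - v y) x = wdiv a u x - wdiv a v x := by
  simp only [wdiv, lapl_sub hu hv hx, inner_gradient_apply]
  rw [((hu.hasFDerivAt_punctured two_ne_zero hx).fun_sub
      (hv.hasFDerivAt_punctured two_ne_zero hx)).fderiv, sub_apply]
  ring

lemma PosReg.le_of_le {δ : ℝ} {S T σ : ℝ → ℝ} (h : PosReg δ S T σ) {s t : ℝ} (hst : s ≤ t)
    (ht : 0 ≤ t) : S s ≤ t := by
  rcases le_or_gt s 0 with hs | hs
  · rw [h.S_zero s hs]; exact ht
  · exact (h.S_le s hs.le).trans hst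

lemma LogCutoff.sq_grad_le {K L : ℝ} {η : Euc n → ℝ} (hη : LogCutoff K L η) (a : ℝ) {s t : ℝ}
    (hs : 0 ≤ s) (hst : s ≤ t) {x : Euc n} (hx : x ≠ 0) :
    ‖x‖ ^ (-(2 * a)) * (s ^ 2 * ‖∇ η x‖ ^ 2) ≤
      K ^ 2 / L ^ 2 * (‖x‖ ^ (-(2 * a) - 2) * t ^ 2) := by
  have h1 : (‖∇ η x‖ * ‖x‖) ^ 2 ≤ (K / L) ^ 2 := by
    have := hη.grad x hx
    gcongr
  rw [← norm_rpow_two_mul_sq (-(2 * a)) hx]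
  calc _ = ‖x‖ ^ (-(2 * a) - 2) * s ^ 2 * (‖∇ η x‖ * ‖x‖) ^ 2 := by ring
    _ ≤ ‖x‖ ^ (-(2 * a) - 2) * t ^ 2 * (K / L) ^ 2 := by gcongr
    _ = _ := by rw [div_pow]; ring

/-- The Caccioppoli inequality on the part of an open set where `w` is positive. -/
lemma caccioppoli (hn : 0 < n) {a δ K L : ℝ} {w Φ η : Euc n → ℝ} {S T σ : ℝ → ℝ}
    {Ω : Set (Euc n)} (hw : ContDiffOn ℝ 2 w {0}ᶜ)
    (h0 : ∀ x ∈ frontier Ω, x ≠ 0 → w x = 0) (hr : PosReg δ S T σ) (hη : LogCutoff K L η)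
    (hwΦ : ∀ x, x ≠ 0 → w x ≤ Φ x) (hΦ0 : ∀ x, x ≠ 0 → 0 ≤ Φ x)
    (iΦ : Integrable fun x : Euc n => ‖x‖ ^ (-(2 * a) - 2) * Φ x ^ 2) :
    TestFn (fun x => Ω.indicator (fun y => S (w y)) x * η x) ∧
    TestFn (fun x => Ω.indicator (fun y => T (w y)) x * η x ^ 2) ∧
    ∫ x : Euc n, ‖x‖ ^ (-(2 * a)) *
        ‖∇ (fun x => Ω.indicator (fun y => S (w y)) x * η x) x‖ ^ 2 ≤
      4 * (∫ x, -(wdiv a w x) * (Ω.indicator (fun y => T (w y)) x * η x ^ 2)) +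
      10 * (K ^ 2 / L ^ 2 * ∫ x : Euc n, ‖x‖ ^ (-(2 * a) - 2) * Φ x ^ 2) := by
  have hw1 : ContDiffOn ℝ 1 w {0}ᶜ := hw.of_le (by norm_num)
  have aux : ∀ {h h' : ℝ → ℝ}, ContDiff ℝ 1 h → (∀ s, HasDerivAt h (h' s) s) → h 0 = 0 →
      h' 0 = 0 → ContDiffOn ℝ 1 (fun y => h (w y)) {0}ᶜ ∧
      ∀ x ∈ frontier Ω, x ≠ 0 → h (w x) = 0 ∧ fderiv ℝ (fun y => h (w y)) x = 0 :=
    fun {h h'} hh hd e0 e0' => by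
      refine ⟨hh.comp_contDiffOn hw1, fun x hx hx0 => ?_⟩
      have hwx := h0 x hx hx0
      refine ⟨by rw [hwx, e0], ?_⟩
      have : HasFDerivAt (fun y => h (w y)) (h' (w x) • fderiv ℝ w x) x :=
        (hd (w x)).comp_hasFDerivAt x (hw1.hasFDerivAt_punctured one_ne_zero hx0)
      rw [this.fderiv, hwx, e0', zero_smul]
  have σ0 : σ 0 = 0 := hr.σ_zero 0 le_rfl
  obtain ⟨hS, hS0⟩ := aux hr.contDiffS hr.hasDerivS (hr.S_zero 0 le_rfl) σ0
  obtain ⟨hT, hT0⟩ := aux hr.contDiffT hr.hasDerivT (hr.T_zero 0 le_rfl) (by simp [σ0])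
  have hg := TestFn.mul (contDiffOn_indicator hS hS0) hη.test
  have hη2 : TestFn fun x => η x ^ 2 := by
    simpa only [pow_two] using TestFn.mul hη.test.smooth hη.test
  have hζ := TestFn.mul (contDiffOn_indicator hT hT0) hη2
  refine ⟨hg, hζ, ?_⟩
  have i1 : Integrable fun x : Euc n => ‖x‖ ^ (-(2 * a)) *
      ⟪∇ w x, ∇ (fun x => Ω.indicator (fun y => T (w y)) x * η x ^ 2) x⟫ :=
    (hζ.supp.gradient.mono fun x hx => by simp [hx]).integrable ((continuousOn_norm_rpow _).mul
      ((continuousOn_gradient hw1).inner (𝕜 := ℝ) (continuousOn_gradient hζ.smooth)))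
  have i2 := (iΦ.const_mul (K ^ 2 / L ^ 2)).const_mul 10
  have i3 := i1.const_mul 4
  rw [← integral_inner_gradient_eq a hw hζ, ← integral_const_mul (K ^ 2 / L ^ 2),
    ← integral_const_mul, ← integral_const_mul, ← integral_add i3 i2]
  refine integral_mono_ae ?_ (i3.add i2) ?_
  · exact (hg.supp.gradient.mono fun x hx => by simp [hx]).integrable
      ((continuousOn_norm_rpow _).mul ((continuousOn_gradient hg.smooth).norm.pow 2))
  filter_upwards [ae_ne_zero hn] with x hx
  have dη := hη.test.differentiable x
  have dw := differentiableAt_punctured hw1 one_ne_zero hx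
  rw [gradient_mul (differentiableAt_punctured (contDiffOn_indicator hS hS0) one_ne_zero hx) dη,
    gradient_mul (differentiableAt_punctured (contDiffOn_indicator hT hT0) one_ne_zero hx)
      (hη2.differentiable x), gradient_indicator hS hS0 hx, gradient_indicator hT hT0 hx]
  have er : 0 ≤ ‖x‖ ^ (-(2 * a)) := by positivity
  by_cases hxΩ : x ∈ Ω
  swap
  · simp only [Set.indicator_of_notMem hxΩ]
    simp only [zero_smul, smul_zero, add_zero, norm_zero, inner_zero_right, ne_eq,
      OfNat.ofNat_ne_zero, not_false_eq_true, zero_pow, mul_zero, zero_add]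
    positivity
  simp only [Set.indicator_of_mem hxΩ]
  have hη2d : ∇ (fun x => η x ^ 2) x = (2 * η x) • ∇ η x := by
    refine gradient_comp (h := fun s => s ^ 2) dη ?_
    simpa using hasDerivAt_pow 2 (η x)
  rw [gradient_comp dw (hr.hasDerivS (w x)), gradient_comp dw (hr.hasDerivT (w x)), hη2d]
  have hST := hr.T_le (w x)
  have hT0 := hr.T_nonneg (w x)
  have hS0 := hr.S_nonneg (w x)
  have hσ0 := hr.σ_nonneg (w x)
  have hη0 := hη.nonneg x
  have hSΦ := hr.le_of_le (hwΦ x hx) (hΦ0 x hx)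
  refine le_trans (b := ‖x‖ ^ (-(2 * a)) * (4 * ⟪∇ w x, T (w x) • (2 * η x) • ∇ η x +
      η x ^ 2 • σ (w x) ^ 2 • ∇ w x⟫ + 10 * (S (w x) ^ 2 * ‖∇ η x‖ ^ 2))) ?_ ?_
  · refine mul_le_mul_of_nonneg_left ?_ er
    set P := σ (w x) * η x * ‖∇ w x‖ with hP
    set Q := S (w x) * ‖∇ η x‖ with hQ
    have h1 : ‖S (w x) • ∇ η x + η x • σ (w x) • ∇ w x‖ ≤ Q + P := by
      refine (norm_add_le _ _).trans ?_
      rw [norm_smul, norm_smul, norm_smul, Real.norm_of_nonneg hS0, Real.norm_of_nonneg hη0,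
        Real.norm_of_nonneg hσ0]
      exact le_of_eq (by rw [hP, hQ]; ring)
    have h2 : -(‖∇ w x‖ * ‖∇ η x‖) ≤ ⟪∇ w x, ∇ η x⟫ :=
      (abs_le.mp (abs_real_inner_le_norm _ _)).1
    have h3 : P ^ 2 - 2 * (P * Q) ≤ ⟪∇ w x, T (w x) • (2 * η x) • ∇ η x +
        η x ^ 2 • σ (w x) ^ 2 • ∇ w x⟫ := by
      rw [inner_add_right, real_inner_smul_right, real_inner_smul_right, real_inner_smul_right,
        real_inner_smul_right, real_inner_self_eq_norm_sq]
      have h4 : -(S (w x) * σ (w x) * (2 * η x * (‖∇ w x‖ * ‖∇ η x‖))) ≤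
          T (w x) * (2 * η x * ⟪∇ w x, ∇ η x⟫) := by
        calc _ ≤ -(T (w x) * (2 * η x * (‖∇ w x‖ * ‖∇ η x‖))) := by
              gcongr
          _ = T (w x) * (2 * η x * -(‖∇ w x‖ * ‖∇ η x‖)) := by ring
          _ ≤ _ := by gcongr
      calc _ = -(S (w x) * σ (w x) * (2 * η x * (‖∇ w x‖ * ‖∇ η x‖))) +
            η x ^ 2 * (σ (w x) ^ 2 * ‖∇ w x‖ ^ 2) := by rw [hP, hQ]; ring
        _ ≤ _ := by linarith
    calc _ ≤ (Q + P) ^ 2 := by gcongr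
      _ ≤ 4 * (P ^ 2 - 2 * (P * Q)) + 10 * Q ^ 2 := by
        nlinarith [sq_nonneg (P - 3 * Q), sq_nonneg (P - 2 * Q)]
      _ ≤ 4 * ⟪∇ w x, T (w x) • (2 * η x) • ∇ η x +
        η x ^ 2 • σ (w x) ^ 2 • ∇ w x⟫ + 10 * Q ^ 2 := by linarith
      _ = _ := by rw [hQ]; ring
  · have := hη.sq_grad_le a hS0 hSΦ hx
    calc _ = 4 * (‖x‖ ^ (-(2 * a)) * ⟪∇ w x, T (w x) • (2 * η x) • ∇ η x +
        η x ^ 2 • σ (w x) ^ 2 • ∇ w x⟫) +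
          10 * (‖x‖ ^ (-(2 * a)) * (S (w x) ^ 2 * ‖∇ η x‖ ^ 2)) := by ring
      _ ≤ _ := by linarith

end comparison

section system

variable {n : ℕ}

lemma eq_zero_of_logCutoff {F : Euc n → ℝ} (hF : ContinuousOn F {0}ᶜ)
    (h0 : ∀ x, x ≠ 0 → 0 ≤ F x) (hn : 0 < n) {K C : ℝ}
    (hK : ∀ L : ℝ, 0 < L → ∃ η : Euc n → ℝ, LogCutoff K L η)
    (hC : ∀ L : ℝ, 0 < L → ∀ η : Euc n → ℝ, LogCutoff K L η → ∫ x, F x * η x ^ 2 ≤ C / L ^ 2)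
    {x : Euc n} (hx : x ≠ 0) : F x = 0 := by
  by_contra hne
  have hpos : 0 < F x := lt_of_le_of_ne (h0 x hx) (Ne.symm hne)
  have hFx := hF.continuousAt (isOpen_compl_singleton.mem_nhds hx)
  have hlog : ContinuousAt (fun y : Euc n => |log ‖y‖|) x :=
    (continuous_norm.continuousAt.log (norm_ne_zero_iff.mpr hx)).abs
  obtain ⟨ρ, hρ, hball⟩ := Metric.eventually_nhds_iff_ball.mp
    (((hFx.eventually (lt_mem_nhds (half_lt_self hpos))).and
      (hlog.eventually (gt_mem_nhds (lt_add_one _)))).and (isOpen_compl_singleton.mem_nhds hx))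
  set m := volume.real (Metric.ball x ρ) with hm
  have hm0 : 0 < m := ENNReal.toReal_pos (Metric.measure_ball_pos volume x hρ).ne'
    measure_ball_lt_top.ne
  have hlow : ∀ L : ℝ, 0 < L → |log ‖x‖| + 1 ≤ L → F x / 2 * m ≤ C / L ^ 2 := fun L hL hL' => by
    obtain ⟨η, hη⟩ := hK L hL
    refine le_trans ?_ (hC L hL η hη)
    have i1 : Integrable fun y => F y * η y ^ 2 :=
      (hη.test.supp.mono fun y hy => by simp [hy]).integrable
        (hF.mul (hη.test.continuous.continuousOn.pow 2))
    calc F x / 2 * m = ∫ y in Metric.ball x ρ, F x / 2 := by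
          rw [setIntegral_const, smul_eq_mul, mul_comm]
      _ ≤ ∫ y in Metric.ball x ρ, F y * η y ^ 2 := by
          refine setIntegral_mono_on (integrableOn_const measure_ball_lt_top.ne) i1.integrableOn
            Metric.isOpen_ball.measurableSet fun y hy => ?_
          obtain ⟨⟨h1, h2⟩, h3⟩ := hball y hy
          rw [hη.eq_one y h3 (h2.le.trans hL')]
          linarith
      _ ≤ _ := setIntegral_le_integral i1 ((ae_ne_zero hn).mono fun y hy =>
          mul_nonneg (h0 y hy) (sq_nonneg _))
  have hlim : Tendsto (fun L : ℝ => C / L ^ 2) atTop (𝓝 0) :=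
    tendsto_const_nhds.div_atTop (tendsto_pow_atTop two_ne_zero)
  obtain ⟨L, h1, h2, h3⟩ := ((hlim.eventually (gt_mem_nhds (by positivity : 0 < F x / 2 * m))).and
    ((eventually_gt_atTop 0).and (eventually_ge_atTop (|log ‖x‖| + 1)))).exists
  exact absurd (hlow L h2 h3) (not_le.mpr h1)

/-- The nonlinearity of the first equation of the system. -/
def react (p ν α β s t : ℝ) : ℝ := s ^ (p - 1) + ν * α * s ^ (α - 1) * t ^ β

/-- A pair of positive solutions of the system away from the origin. -/
structure Sol {n : ℕ} (a b p ν α β : ℝ) (u v : Euc n → ℝ) : Prop where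
  smooth_fst : ContDiffOn ℝ 2 u {0}ᶜ
  smooth_snd : ContDiffOn ℝ 2 v {0}ᶜ
  pos_fst : ∀ x, x ≠ 0 → 0 < u x
  pos_snd : ∀ x, x ≠ 0 → 0 < v x
  eq_fst : ∀ x, x ≠ 0 → -(wdiv a u x) = ‖x‖ ^ (-(b * p)) * react p ν α β (u x) (v x)
  eq_snd : ∀ x, x ≠ 0 → -(wdiv a v x) = ‖x‖ ^ (-(b * p)) * react p ν β α (v x) (u x)

variable {a b p ν α β : ℝ} {u v : Euc n → ℝ}

lemma Sol.swap (h : Sol a b p ν α β u v) : Sol a b p ν β α v u :=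
  ⟨h.smooth_snd, h.smooth_fst, h.pos_snd, h.pos_fst, h.eq_snd, h.eq_fst⟩

lemma Sol.supersol (h : Sol a b p ν α β u v) (hν : 0 ≤ ν) (hα : 0 ≤ α) (hE : finiteEnergy a u) :
    Supersol a b p u where
  smooth := h.smooth_fst
  pos := h.pos_fst
  le_neg_wdiv x hx := by
    have h1 := h.pos_fst x hx
    have h2 := h.pos_snd x hx
    rw [h.eq_fst x hx, react]
    gcongr
    exact le_add_of_nonneg_right (by positivity)
  energy := hE

lemma react_cross_pos (hα0 : 0 < α) (hα : α < 2) (hβ : 0 < β) (hν : 0 < ν) (hαβ : α + β = p)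
    {s t : ℝ} (hs : 0 < s) (h1 : s < t) (hst : ((1 + ν * β) / (ν * α)) ^ (2 - α)⁻¹ * s < t) :
    0 < t * react p ν α β s t - s * react p ν β α t s := by
  obtain ⟨r, rfl⟩ : ∃ r, t = r * s := ⟨t / s, by field_simp⟩
  have hr : 1 < r := by
    by_contra h
    nlinarith
  have hr2 : ((1 + ν * β) / (ν * α)) ^ (2 - α)⁻¹ < r := lt_of_mul_lt_mul_right hst hs.le
  have hr0 : 0 < r := by linarith
  have e2 : (0 : ℝ) < 2 - α := by linarith
  have h3 : (1 + ν * β) / (ν * α) ≤ r ^ (2 - α) := by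
    calc _ = (((1 + ν * β) / (ν * α)) ^ (2 - α)⁻¹) ^ (2 - α) := by
          rw [← Real.rpow_mul (by positivity), inv_mul_cancel₀ e2.ne', Real.rpow_one]
      _ ≤ _ := by gcongr
  rw [div_le_iff₀ (by positivity)] at h3
  have e : r * s * react p ν α β s (r * s) - s * react p ν β α (r * s) s =
      s ^ p * (r + ν * α * (r ^ (2 - α) * r ^ (p - 1)) - r ^ (p - 1) - ν * β * r ^ (β - 1)) := by
    simp only [react, Real.mul_rpow hr0.le hs.le]
    have a1 : s ^ p = s * s ^ (p - 1) := by rw [Real.rpow_sub_one hs.ne']; field_simp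
    have a2 : s * s ^ (p - 1) = s * s ^ (α - 1) * s ^ β := by
      rw [mul_assoc, ← Real.rpow_add hs]; congr 2; linarith
    have a3 : s * s ^ (p - 1) = s * s ^ (β - 1) * s ^ α := by
      rw [mul_assoc, ← Real.rpow_add hs]; congr 2; linarith
    have a4 : r ^ (2 - α) * r ^ (p - 1) = r * r ^ β := by
      rw [← Real.rpow_add hr0, mul_comm, ← Real.rpow_add_one hr0.ne']; congr 1; linarith
    rw [a4, a1]
    linear_combination (-(r * r ^ β * ν * α)) * a2 + (r ^ (β - 1) * ν * β) * a3
  rw [e]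
  have h4 : r ^ (β - 1) ≤ r ^ (p - 1) := Real.rpow_le_rpow_of_exponent_le hr.le (by linarith)
  have h5 : 0 < r ^ (p - 1) := by positivity
  have h6 := mul_le_mul_of_nonneg_right h3 h5.le
  have h7 := mul_le_mul_of_nonneg_left h4 (mul_pos hν hβ).le
  refine mul_pos (by positivity) ?_
  nlinarith

lemma Sol.ratio_le (hn : 0 < n) (h : Sol a b p ν α β u v) (hα0 : 0 < α) (hα : α < 2) (hβ : 0 < β)
    (hν : 0 < ν) (hαβ : α + β = p)
    (iv : Integrable fun x : Euc n => ‖x‖ ^ (-(2 * a) - 2) * v x ^ 2) {x : Euc n} (hx : x ≠ 0) :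
    v x ≤ max 1 (((1 + ν * β) / (ν * α)) ^ (2 - α)⁻¹) * u x := by
  set C := max 1 (((1 + ν * β) / (ν * α)) ^ (2 - α)⁻¹) with hC
  obtain ⟨K, hK0, hK⟩ := exists_logCutoff n
  obtain ⟨S, T, σ, hr⟩ := exists_posReg one_pos
  have hu1 : ContDiffOn ℝ 1 u {0}ᶜ := h.smooth_fst.of_le (by norm_num)
  have hv1 : ContDiffOn ℝ 1 v {0}ᶜ := h.smooth_snd.of_le (by norm_num)
  have hw : ContDiffOn ℝ 1 (fun y => v y / u y - C) {0}ᶜ :=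
    (hv1.div hu1 fun y hy => (h.pos_fst y hy).ne').sub contDiffOn_const
  set w : Euc n → ℝ := fun y => v y / u y - C with hwd
  have hTw : ContDiffOn ℝ 1 (fun y => T (w y)) {0}ᶜ := hr.contDiffT.comp_contDiffOn hw
  have hF0 : ∀ y, y ≠ 0 → 0 ≤ (-(wdiv a u y) * v y - -(wdiv a v y) * u y) * T (w y) := by
    intro y hy
    rcases le_or_gt (w y) 0 with hwy | hwy
    · rw [hr.T_zero _ hwy, mul_zero]
    · refine mul_nonneg ?_ (hr.T_nonneg _)
      have hu0 := h.pos_fst y hy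
      have hlt : C * u y < v y := by
        rw [hwd] at hwy; simp only [sub_pos, lt_div_iff₀ hu0] at hwy; exact hwy
      have := react_cross_pos hα0 hα hβ hν hαβ hu0
        ((le_mul_of_one_le_left hu0.le (le_max_left _ _)).trans_lt hlt)
        ((mul_le_mul_of_nonneg_right (le_max_right _ _) hu0.le).trans_lt hlt)
      rw [h.eq_fst y hy, h.eq_snd y hy]
      have h0 : 0 < ‖y‖ := norm_pos_iff.mpr hy
      calc 0 ≤ ‖y‖ ^ (-(b * p)) *
            (v y * react p ν α β (u y) (v y) - u y * react p ν β α (v y) (u y)) := by positivity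
        _ = _ := by ring
  have hF : ContinuousOn (fun y => (-(wdiv a u y) * v y - -(wdiv a v y) * u y) * T (w y)) {0}ᶜ :=
    (((continuousOn_wdiv a h.smooth_fst).neg.mul hv1.continuousOn).sub
      ((continuousOn_wdiv a h.smooth_snd).neg.mul hu1.continuousOn)).mul hTw.continuousOn
  have key := eq_zero_of_logCutoff hF hF0 hn hK
    (C := K ^ 2 * ∫ x : Euc n, ‖x‖ ^ (-(2 * a) - 2) * v x ^ 2) ?_ hx
  · by_contra hlt
    rw [not_le] at hlt
    have hu0 := h.pos_fst x hx
    have hwx : 0 < w x := by simp only [hwd, sub_pos, lt_div_iff₀ hu0]; exact hlt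
    have := react_cross_pos hα0 hα hβ hν hαβ hu0
        ((le_mul_of_one_le_left hu0.le (le_max_left _ _)).trans_lt hlt)
        ((mul_le_mul_of_nonneg_right (le_max_right _ _) hu0.le).trans_lt hlt)
    rw [h.eq_fst x hx, h.eq_snd x hx] at key
    have h0 : 0 < ‖x‖ := norm_pos_iff.mpr hx
    have hT := hr.T_pos _ hwx
    have : 0 < ‖x‖ ^ (-(b * p)) *
            (v x * react p ν α β (u x) (v x) - u x * react p ν β α (v x) (u x)) * T (w x) := by
      positivity
    refine this.ne' (Eq.trans ?_ key)
    ring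
  intro L hL η hη
  have hη2 : TestFn fun x => η x ^ 2 := by
    simpa only [pow_two] using TestFn.mul hη.test.smooth hη.test
  have hζ := TestFn.mul hTw hη2
  have huζ := TestFn.mul hu1 hζ
  have hvζ := TestFn.mul hv1 hζ
  have iw : ∀ {f g : Euc n → ℝ}, ContDiffOn ℝ 2 f {0}ᶜ → TestFn g →
      Integrable fun x => -(wdiv a f x) * g x := fun hf hg =>
    (hg.supp.mono fun x hx => by simp [hx]).integrable
      ((continuousOn_wdiv a hf).neg.mul hg.continuous.continuousOn)
  have ig : ∀ {f g : Euc n → ℝ}, ContDiffOn ℝ 1 f {0}ᶜ → TestFn g →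
      Integrable fun x => ‖x‖ ^ (-(2 * a)) * ⟪∇ f x, ∇ g x⟫ := fun hf hg =>
    (hg.supp.gradient.mono fun x hx => by simp [hx]).integrable ((continuousOn_norm_rpow _).mul
      ((continuousOn_gradient hf).inner (𝕜 := ℝ) (continuousOn_gradient hg.smooth)))
  have e1 : ∫ x, (-(wdiv a u x) * v x - -(wdiv a v x) * u x) * T (w x) * η x ^ 2 =
      (∫ x, -(wdiv a u x) * (v x * (T (w x) * η x ^ 2))) -
        ∫ x, -(wdiv a v x) * (u x * (T (w x) * η x ^ 2)) := by
    rw [← integral_sub (iw h.smooth_fst hvζ) (iw h.smooth_snd huζ)]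
    exact integral_congr_ae (ae_of_all _ fun x => by ring)
  rw [e1, ← integral_inner_gradient_eq a h.smooth_fst hvζ,
    ← integral_inner_gradient_eq a h.smooth_snd huζ, ← integral_sub (ig hu1 hvζ) (ig hv1 huζ),
    mul_div_right_comm, ← integral_const_mul]
  refine integral_mono_ae ((ig hu1 hvζ).sub (ig hv1 huζ)) (iv.const_mul _) ?_
  filter_upwards [ae_ne_zero hn] with y hy
  have hu0 := h.pos_fst y hy
  have hv0 := h.pos_snd y hy
  have du := differentiableAt_punctured hu1 one_ne_zero hy
  have dv := differentiableAt_punctured hv1 one_ne_zero hy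
  have dη := hη.test.differentiable y
  have dw := differentiableAt_punctured hw one_ne_zero hy
  have hgv : ∇ v y = u y • ∇ w y + (v y / u y) • ∇ u y := by
    have e : v =ᶠ[𝓝 y] fun z => u z * (w z + C) := by
      filter_upwards [isOpen_compl_singleton.mem_nhds hy] with z hz
      have := (h.pos_fst z hz).ne'
      simp only [hwd]; field_simp; ring
    have e2 : ∇ (fun z => w z + C) y = ∇ w y := by
      rw [gradient_eq_toDual_symm, gradient_eq_toDual_symm, fderiv_add_const]
    rw [gradient_eq_toDual_symm, e.fderiv_eq, ← gradient_eq_toDual_symm,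
      gradient_mul du (dw.add_const C), e2]
    simp [hwd]
  have hη2d : ∇ (fun x => η x ^ 2) y = (2 * η y) • ∇ η y := by
    refine gradient_comp (h := fun s => s ^ 2) dη ?_
    simpa using hasDerivAt_pow 2 (η y)
  have hζd : ∇ (fun x => T (w x) * η x ^ 2) y =
      T (w y) • (2 * η y) • ∇ η y + η y ^ 2 • σ (w y) ^ 2 • ∇ w y := by
    rw [gradient_mul (differentiableAt_punctured hTw one_ne_zero hy) (hη2.differentiable y),
      hη2d, gradient_comp dw (hr.hasDerivT (w y))]
  rw [gradient_mul dv (hζ.differentiable y), gradient_mul du (hζ.differentiable y), hζd, hgv]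
  have hST := hr.T_le (w y)
  have hT0 := hr.T_nonneg (w y)
  have hS0 := hr.S_nonneg (w y)
  have hσ0 := hr.σ_nonneg (w y)
  have hη0 := hη.nonneg y
  have hSv : u y * S (w y) ≤ v y := by
    have h1 : S (w y) ≤ v y / u y := by
      refine hr.le_of_le ?_ (by positivity)
      have : 0 ≤ C := zero_le_one.trans (le_max_left _ _)
      simp only [hwd]; linarith
    calc _ ≤ u y * (v y / u y) := by gcongr
      _ = v y := by field_simp
  refine le_trans ?_ (hη.sq_grad_le a (mul_nonneg hu0.le hS0) hSv hy)
  rw [← mul_sub]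
  refine mul_le_mul_of_nonneg_left ?_ (by positivity)
  have h2 : -(‖∇ w y‖ * ‖∇ η y‖) ≤ ⟪∇ w y, ∇ η y⟫ :=
      (abs_le.mp (abs_real_inner_le_norm _ _)).1
  have h4 : -(S (w y) * σ (w y) * (2 * η y * (‖∇ w y‖ * ‖∇ η y‖))) ≤
      T (w y) * (2 * η y * ⟪∇ w y, ∇ η y⟫) := by
    calc _ ≤ -(T (w y) * (2 * η y * (‖∇ w y‖ * ‖∇ η y‖))) := by
          gcongr
      _ = T (w y) * (2 * η y * -(‖∇ w y‖ * ‖∇ η y‖)) := by ring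
      _ ≤ _ := by gcongr
  simp only [inner_add_right, inner_add_left, real_inner_smul_right, real_inner_smul_left,
    real_inner_self_eq_norm_sq]
  rw [real_inner_comm (∇ w y) (∇ u y)]
  have e3 : v y / u y * u y = v y := by field_simp
  have h6 : 0 ≤ (σ (w y) * η y * ‖∇ w y‖ - S (w y) * ‖∇ η y‖) ^ 2 := sq_nonneg _
  have h7 : -(T (w y) * (2 * η y * ⟪∇ w y, ∇ η y⟫) + η y ^ 2 * (σ (w y) ^ 2 * ‖∇ w y‖ ^ 2)) ≤
      S (w y) ^ 2 * ‖∇ η y‖ ^ 2 := by nlinarith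
  have h8 := mul_le_mul_of_nonneg_left h7 (sq_nonneg (u y))
  set r := v y / u y with hrd
  rw [← e3]
  refine le_of_eq_of_le ?_ (h8.trans_eq (by ring))
  ring

end system

section nonlinearity

lemma rpow_sub_rpow_le {x y s : ℝ} (hy : 0 < y) (hyx : y < x) :
    x ^ s - y ^ s ≤ max 1 s * (x ^ (s - 1) * (x - y)) := by
  have hx : 0 < x := hy.trans hyx
  obtain ⟨t, rfl⟩ : ∃ t, y = t * x := ⟨y / x, by field_simp⟩
  have ht : 0 < t := pos_of_mul_pos_left hy hx.le
  have ht1 : t < 1 := by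
    by_contra h
    nlinarith
  have key : 1 - t ^ s ≤ max 1 s * (1 - t) := by
    rcases le_total s 1 with h | h
    · have : t ≤ t ^ s := by
        simpa using Real.rpow_le_rpow_of_exponent_ge ht ht1.le h
      have := mul_le_mul_of_nonneg_right (le_max_left 1 s) (by linarith : 0 ≤ 1 - t)
      linarith
    · have h1 := one_add_mul_self_le_rpow_one_add (s := t - 1) (by linarith) h
      rw [add_sub_cancel] at h1
      have := mul_le_mul_of_nonneg_right (le_max_right 1 s) (by linarith : 0 ≤ 1 - t)
      linarith
  rw [Real.mul_rpow ht.le hx.le]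
  have e : x ^ s = x ^ (s - 1) * x := by rw [Real.rpow_sub_one hx.ne']; field_simp
  calc x ^ s - t ^ s * x ^ s = x ^ s * (1 - t ^ s) := by ring
    _ ≤ x ^ s * (max 1 s * (1 - t)) := by gcongr
    _ = _ := by rw [e]; ring

lemma react_sub_le {p ν α β M s t s' t' : ℝ} (hp : 2 < p) (hν : 0 < ν) (hα : 1 < α) (hβ : 1 < β)
    (hαβ : α + β = p) (hs' : 0 < s') (hs : s' < s) (ht : 0 < t) (ht' : 0 < t')
    (hM : s ^ (α - 2) * t ^ β ≤ M * (s + t) ^ (p - 2)) :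
    react p ν α β s t - react p ν α β s' t' ≤
      (max 1 (p - 1) + ν * α * (max 1 (α - 1) * M + max 1 β)) * (s + t) ^ (p - 2) *
        (s - s' + max (t - t') 0) := by
  have hs0 : 0 < s := hs'.trans hs
  set Q := (s + t) ^ (p - 2) with hQ
  have hQ0 : 0 < Q := by positivity
  set A := s - s' with hA
  have hA0 : 0 < A := by rw [hA]; linarith
  set B := max (t - t') 0 with hB
  have hB0 : 0 ≤ B := le_max_right _ _
  have h1 : s ^ (p - 1) - s' ^ (p - 1) ≤ max 1 (p - 1) * (Q * A) := by
    refine (rpow_sub_rpow_le hs' hs).trans ?_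
    rw [show p - 1 - 1 = p - 2 by ring]
    have : s ^ (p - 2) ≤ Q := by rw [hQ]; gcongr; linarith
    gcongr
  have h2 : (s ^ (α - 1) - s' ^ (α - 1)) * t ^ β ≤ max 1 (α - 1) * (M * Q * A) := by
    calc _ ≤ max 1 (α - 1) * (s ^ (α - 1 - 1) * A) * t ^ β := by
          gcongr; exact rpow_sub_rpow_le hs' hs
      _ = max 1 (α - 1) * (s ^ (α - 2) * t ^ β * A) := by
          rw [show α - 1 - 1 = α - 2 by ring]; ring
      _ ≤ _ := by gcongr
  have h3 : s' ^ (α - 1) * (t ^ β - t' ^ β) ≤ max 1 β * (Q * B) := by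
    rcases le_or_gt t t' with h | h
    · have : t ^ β ≤ t' ^ β := by gcongr
      have h4 : s' ^ (α - 1) * (t ^ β - t' ^ β) ≤ 0 :=
        mul_nonpos_of_nonneg_of_nonpos (by positivity) (by linarith)
      exact h4.trans (by positivity)
    · have eB : B = t - t' := max_eq_left (by linarith)
      calc _ ≤ (s + t) ^ (α - 1) * (max 1 β * (t ^ (β - 1) * B)) := by
            rw [eB]
            have hh := rpow_sub_rpow_le (s := β) ht' h
            have h5 : t' ^ β ≤ t ^ β := by gcongr
            have h6 : s' ≤ s + t := by linarith
            have h7 : 0 ≤ t ^ β - t' ^ β := by linarith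
            gcongr
        _ ≤ (s + t) ^ (α - 1) * (max 1 β * ((s + t) ^ (β - 1) * B)) := by
            have h6 : t ≤ s + t := by linarith
            gcongr
        _ = max 1 β * ((s + t) ^ (α - 1) * (s + t) ^ (β - 1) * B) := by ring
        _ = _ := by
            rw [← Real.rpow_add (by linarith), hQ, show α - 1 + (β - 1) = p - 2 by linarith]
  have e : react p ν α β s t - react p ν α β s' t' = (s ^ (p - 1) - s' ^ (p - 1)) +
      ν * α * ((s ^ (α - 1) - s' ^ (α - 1)) * t ^ β + s' ^ (α - 1) * (t ^ β - t' ^ β)) := by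
    simp only [react]; ring
  have hM0 : 0 ≤ M := by
    by_contra h
    have h8 : 0 < s ^ (α - 2) * t ^ β := by positivity
    nlinarith
  rw [e]
  calc _ ≤ max 1 (p - 1) * (Q * A) +
        ν * α * (max 1 (α - 1) * (M * Q * A) + max 1 β * (Q * B)) := by gcongr
    _ ≤ max 1 (p - 1) * (Q * (A + B)) +
        ν * α * (max 1 (α - 1) * (M * Q * (A + B)) + max 1 β * (Q * (A + B))) := by
        gcongr <;> linarith
    _ = _ := by ring

end nonlinearity

section comparison

variable {n : ℕ} {a b p ν α β k : ℝ} {u v : Euc n → ℝ}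

/-- The structural assumptions on the parameters; `k` is the exponent of the Kelvin transform. -/
structure Params (n : ℕ) (a b p k ν α β : ℝ) : Prop where
  hn : 3 ≤ n
  hk : 2 * k = n - 2 - 2 * a
  hk0 : 0 < k
  hp : 2 < p
  hpq : p ≤ critExp n
  hbp : b * p = n - k * p
  hν : 0 < ν
  hα : 1 < α
  hβ : 1 < β
  hαβ : α + β = p

lemma Params.swap (P : Params n a b p k ν α β) : Params n a b p k ν β α :=
  ⟨P.hn, P.hk, P.hk0, P.hp, P.hpq, P.hbp, P.hν, P.hβ, P.hα, by linarith [P.hαβ]⟩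

lemma Params.pos (P : Params n a b p k ν α β) : 0 < n := by have := P.hn; omega

lemma Sol.exists_mixed_le (P : Params n a b p k ν α β) (h : Sol a b p ν α β u v)
    (iv : Integrable fun x : Euc n => ‖x‖ ^ (-(2 * a) - 2) * v x ^ 2) :
    ∃ M : ℝ, ∀ x, x ≠ 0 → u x ^ (α - 2) * v x ^ β ≤ M * (u x + v x) ^ (p - 2) := by
  have hα := P.hα
  have hβ := P.hβ
  rcases lt_or_ge α 2 with h2 | h2
  · set C := max 1 (((1 + ν * β) / (ν * α)) ^ (2 - α)⁻¹)
    refine ⟨C ^ (2 - α), fun x hx => ?_⟩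
    have hu := h.pos_fst x hx
    have hv := h.pos_snd x hx
    have hr : v x ≤ C * u x := h.ratio_le P.pos (by linarith) h2 (by linarith) P.hν P.hαβ iv hx
    have hp := P.hp
    have e1 : v x ^ β = v x ^ (2 - α) * v x ^ (p - 2) := by
      rw [← Real.rpow_add hv]; congr 1; linarith [P.hαβ]
    have e2 : u x ^ (α - 2) * u x ^ (2 - α) = 1 := by
      rw [← Real.rpow_add hu, show α - 2 + (2 - α) = 0 by ring, Real.rpow_zero]
    have hC : 0 ≤ C := zero_le_one.trans (le_max_left _ _)
    calc _ = u x ^ (α - 2) * v x ^ (2 - α) * v x ^ (p - 2) := by rw [e1]; ring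
      _ ≤ u x ^ (α - 2) * (C * u x) ^ (2 - α) * (u x + v x) ^ (p - 2) := by
          gcongr
          linarith
      _ = C ^ (2 - α) * (u x ^ (α - 2) * u x ^ (2 - α)) * (u x + v x) ^ (p - 2) := by
          rw [Real.mul_rpow hC hu.le]; ring
      _ = _ := by rw [e2, mul_one]
  · refine ⟨1, fun x hx => ?_⟩
    have hu := h.pos_fst x hx
    have hv := h.pos_snd x hx
    calc _ ≤ (u x + v x) ^ (α - 2) * (u x + v x) ^ β := by
          gcongr <;> linarith
      _ = _ := by
          rw [← Real.rpow_add (by linarith), one_mul]; congr 1; linarith [P.hαβ]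

lemma energy_step (hn : 0 < n) {δ K L κ : ℝ} {w z Φ V η : Euc n → ℝ} {S T σ : ℝ → ℝ}
    {Ω A : Set (Euc n)} (hw : ContDiffOn ℝ 2 w {0}ᶜ) (hz : ContDiffOn ℝ 2 z {0}ᶜ)
    (hw0 : ∀ x ∈ frontier Ω, x ≠ 0 → w x = 0) (hz0 : ∀ x ∈ frontier Ω, x ≠ 0 → z x = 0)
    (hr : PosReg δ S T σ) (hη : LogCutoff K L η) (hκ : 0 ≤ κ)
    (hwΦ : ∀ x, x ≠ 0 → w x ≤ Φ x) (hzΦ : ∀ x, x ≠ 0 → z x ≤ Φ x) (hΦ0 : ∀ x, x ≠ 0 → 0 ≤ Φ x)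
    (iΦ : Integrable fun x : Euc n => ‖x‖ ^ (-(2 * a) - 2) * Φ x ^ 2)
    (hVc : ContinuousOn V {0}ᶜ) (hV0 : ∀ x, x ≠ 0 → 0 ≤ V x)
    (hd : ∀ x ∈ Ω, x ≠ 0 → 0 < w x → -(wdiv a w x) ≤ κ * V x * (w x + max (z x) 0))
    (hAm : MeasurableSet A) (hA : ∀ x ∈ Ω, x ≠ 0 → 0 < w x → x ∈ A) :
    ∫ x : Euc n, ‖x‖ ^ (-(2 * a)) *
        ‖∇ (fun x => Ω.indicator (fun y => S (w y)) x * η x) x‖ ^ 2 ≤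
      4 * (κ * (3 * (∫ x in A, V x * (Ω.indicator (fun y => S (w y)) x * η x) ^ 2) +
        (∫ x in A, V x * (Ω.indicator (fun y => S (z y)) x * η x) ^ 2) +
        δ ^ 2 * ∫ x, V x * η x ^ 2)) +
      10 * (K ^ 2 / L ^ 2 * ∫ x : Euc n, ‖x‖ ^ (-(2 * a) - 2) * Φ x ^ 2) := by
  obtain ⟨hgw, hζ, h⟩ := caccioppoli hn hw hw0 hr hη hwΦ hΦ0 iΦ
  obtain ⟨hgz, -, -⟩ := caccioppoli hn hz hz0 hr hη hzΦ hΦ0 iΦ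
  refine h.trans ?_
  gcongr 4 * ?_ + _
  have iV : ∀ {g : Euc n → ℝ}, TestFn g → Integrable fun x => V x * g x ^ 2 := fun hg =>
    (hg.supp.mono fun x hx => by simp [hx]).integrable
      (hVc.mul (hg.continuous.continuousOn.pow 2))
  have i1 := ((iV hgw).indicator hAm).const_mul 3
  have i2 := (iV hgz).indicator hAm
  have i3 := (iV hη.test).const_mul (δ ^ 2)
  rw [← integral_indicator hAm, ← integral_indicator hAm, ← integral_const_mul,
    ← integral_const_mul, ← integral_add i1 i2,
    ← integral_add (f := fun x =>
      3 * A.indicator (fun x => V x * (Ω.indicator (fun y => S (w y)) x * η x) ^ 2) x +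
        A.indicator (fun x => V x * (Ω.indicator (fun y => S (z y)) x * η x) ^ 2) x) (i1.add i2) i3,
    ← integral_const_mul]
  refine integral_mono_ae ?_ (((i1.add i2).add i3).const_mul κ) ?_
  · exact (hζ.supp.mono fun x hx => by simp [hx]).integrable
      ((continuousOn_wdiv a hw).neg.mul hζ.continuous.continuousOn)
  filter_upwards [ae_ne_zero hn] with x hx
  have hV := hV0 x hx
  by_cases hxw : x ∈ Ω ∧ 0 < w x
  · obtain ⟨hxΩ, hwx⟩ := hxw
    have hxA := hA x hxΩ hx hwx
    simp only [Set.indicator_of_mem hxA, Set.indicator_of_mem hxΩ]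
    have hS0 := hr.S_nonneg (w x)
    have hSz0 := hr.S_nonneg (z x)
    have hT := hr.T_le_S (w x)
    have hT0 := hr.T_nonneg (w x)
    have h1 := hr.le_S (w x)
    have h2 := hr.le_S (z x)
    have hδ0 : 0 ≤ δ := by
      have := hr.le_S 0
      rw [hr.S_zero 0 le_rfl] at this
      linarith
    have h3 : max (z x) 0 ≤ S (z x) + δ := max_le (by linarith) (by linarith)
    have h4 : 0 ≤ max (z x) 0 := le_max_right _ _
    calc _ ≤ κ * V x * (w x + max (z x) 0) * (T (w x) * η x ^ 2) := by
          gcongr; exact hd x hxΩ hx hwx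
      _ = κ * V x * η x ^ 2 * (T (w x) * (w x + max (z x) 0)) := by ring
      _ ≤ κ * V x * η x ^ 2 * (S (w x) * ((S (w x) + δ) + (S (z x) + δ))) := by
          gcongr; linarith
      _ ≤ κ * V x * η x ^ 2 * (3 * S (w x) ^ 2 + S (z x) ^ 2 + δ ^ 2) := by
          gcongr
          nlinarith [sq_nonneg (S (w x) - S (z x)), sq_nonneg (S (w x) - δ)]
      _ = _ := by ring
  · have e : Ω.indicator (fun y => T (w y)) x = 0 := by
      by_cases hxΩ : x ∈ Ω
      · rw [Set.indicator_of_mem hxΩ]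
        exact hr.T_zero _ (not_lt.mp fun hc => hxw ⟨hxΩ, hc⟩)
      · exact Set.indicator_of_notMem hxΩ _
    simp only [e, zero_mul, mul_zero]
    have e1 := Set.indicator_apply_nonneg (s := A) (a := x)
      (f := fun x => V x * (Ω.indicator (fun y => S (w y)) x * η x) ^ 2) fun _ => by positivity
    have e2 := Set.indicator_apply_nonneg (s := A) (a := x)
      (f := fun x => V x * (Ω.indicator (fun y => S (z y)) x * η x) ^ 2) fun _ => by positivity
    positivity

end comparison

section comparison

variable {n : ℕ} {a b p ν α β k : ℝ} {u v : Euc n → ℝ}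

lemma add_rpow_le {s t q : ℝ} (hs : 0 ≤ s) (ht : 0 ≤ t) (hq : 0 ≤ q) :
    (s + t) ^ q ≤ 2 ^ q * (s ^ q + t ^ q) := by
  have key : ∀ {s t : ℝ}, 0 ≤ s → s ≤ t → (s + t) ^ q ≤ 2 ^ q * (s ^ q + t ^ q) :=
    fun {s t} hs hst => by
      have ht : 0 ≤ t := hs.trans hst
      calc (s + t) ^ q ≤ (2 * t) ^ q := by gcongr; linarith
        _ = 2 ^ q * (0 + t ^ q) := by rw [Real.mul_rpow zero_le_two ht, zero_add]
        _ ≤ _ := by gcongr; positivity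
  rcases le_total s t with h | h
  · exact key hs h
  · rw [add_comm s, add_comm (s ^ q)]; exact key ht h

lemma integrable_sum_critExp (hn : 3 ≤ n) (hu : ContinuousOn u {0}ᶜ) (hv : ContinuousOn v {0}ᶜ)
    (hu0 : ∀ x, x ≠ 0 → 0 < u x) (hv0 : ∀ x, x ≠ 0 → 0 < v x)
    (iu : Integrable fun x : Euc n => (‖x‖ ^ (-a) * u x) ^ critExp n)
    (iv : Integrable fun x : Euc n => (‖x‖ ^ (-a) * v x) ^ critExp n) :
    Integrable fun x : Euc n => (‖x‖ ^ (-a) * (u x + v x)) ^ critExp n := by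
  have hn0 : 0 < n := by omega
  have hq := two_lt_critExp hn
  refine ((iu.add iv).const_mul (2 ^ critExp n)).mono' (aestronglyMeasurable_punctured hn0 ?_) ?_
  · refine ((continuousOn_norm_rpow _).mul (hu.add hv)).rpow_const fun x hx => Or.inl ?_
    have h1 := hu0 x hx
    have h2 := hv0 x hx
    have h0 : 0 < ‖x‖ := norm_pos_iff.mpr hx
    exact (mul_pos (by positivity) (add_pos h1 h2)).ne'
  · filter_upwards [ae_ne_zero hn0] with x hx
    have h1 := hu0 x hx
    have h2 := hv0 x hx
    rw [Real.norm_of_nonneg (by positivity), mul_add]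
    exact add_rpow_le (by positivity) (by positivity) (by linarith)

lemma integrable_sum_sq (hn : 0 < n) (hu : ContinuousOn u {0}ᶜ) (hv : ContinuousOn v {0}ᶜ)
    (iu : Integrable fun x : Euc n => ‖x‖ ^ (-(2 * a) - 2) * u x ^ 2)
    (iv : Integrable fun x : Euc n => ‖x‖ ^ (-(2 * a) - 2) * v x ^ 2) :
    Integrable fun x : Euc n => ‖x‖ ^ (-(2 * a) - 2) * (u x + v x) ^ 2 := by
  refine ((iu.add iv).const_mul 2).mono' (aestronglyMeasurable_punctured hn
    ((continuousOn_norm_rpow _).mul ((hu.add hv).pow 2))) (ae_of_all _ fun x => ?_)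
  rw [Real.norm_of_nonneg (by positivity)]
  calc _ ≤ ‖x‖ ^ (-(2 * a) - 2) * (2 * (u x ^ 2 + v x ^ 2)) := by
        gcongr; nlinarith [sq_nonneg (u x - v x)]
    _ = _ := by simp only [Pi.add_apply]; ring

lemma le_of_forall_sq_bound {x c d : ℝ} (hd : 0 ≤ d) (h : ∀ δ : ℝ, 0 < δ → x ≤ c + δ ^ 2 * d) :
    x ≤ c := by
  refine le_of_forall_pos_le_add fun ε hε => (h (√(ε / (d + 1))) (by positivity)).trans ?_
  rw [Real.sq_sqrt (by positivity)]
  gcongr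
  rw [div_mul_eq_mul_div, div_le_iff₀ (by positivity)]
  nlinarith

/-- The subsolution estimate for the difference of two solutions. -/
lemma Sol.exists_diff_le (P : Params n a b p k ν α β) (h : Sol a b p ν α β u v)
    (iv : Integrable fun x : Euc n => ‖x‖ ^ (-(2 * a) - 2) * v x ^ 2) :
    ∃ κ : ℝ, ∀ U V : Euc n → ℝ, Sol a b p ν α β U V → ∀ x, x ≠ 0 → 0 < u x - U x →
      -(wdiv a (fun y => u y - U y) x) ≤ κ * (‖x‖ ^ (-(b * p)) * (u x + v x) ^ (p - 2)) *
        (u x - U x + max (v x - V x) 0) := by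
  obtain ⟨M, hM⟩ := h.exists_mixed_le P iv
  refine ⟨max 1 (p - 1) + ν * α * (max 1 (α - 1) * M + max 1 β), fun U V H x hx hlt => ?_⟩
  rw [wdiv_sub a h.smooth_fst H.smooth_fst hx, neg_sub]
  have key := react_sub_le P.hp P.hν P.hα P.hβ P.hαβ (H.pos_fst x hx) (sub_pos.mp hlt)
    (h.pos_snd x hx) (H.pos_snd x hx) (hM x hx)
  have e1 := h.eq_fst x hx
  have e2 := H.eq_fst x hx
  have h0 : 0 ≤ ‖x‖ ^ (-(b * p)) := by positivity
  refine (le_of_eq ?_).trans ((mul_le_mul_of_nonneg_left key h0).trans_eq ?_)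
  · linear_combination e1 - e2
  · ring

/-- Comparison of solutions on domains where the solution with finite energy is small. -/
lemma Sol.exists_comparison (P : Params n a b p k ν α β) (h : Sol a b p ν α β u v)
    (hEu : finiteEnergy a u) (hEv : finiteEnergy a v) :
    ∃ ε : ℝ, 0 < ε ∧ ∀ U V : Euc n → ℝ, Sol a b p ν α β U V → ∀ Ω : Set (Euc n), IsOpen Ω →
      (∀ x ∈ frontier Ω, x ≠ 0 → u x = U x ∧ v x = V x) →
      ∫ x in {x | x ∈ Ω ∧ x ≠ 0 ∧ (U x < u x ∨ V x < v x)},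
        (‖x‖ ^ (-a) * (u x + v x)) ^ critExp n < ε →
      ∀ x ∈ Ω, x ≠ 0 → u x ≤ U x ∧ v x ≤ V x := by
  have hn := P.pos
  have hk0 := P.hk0
  have hp1 : 1 < p := by linarith [P.hp]
  have su := h.supersol P.hν.le (by linarith [P.hα]) hEu
  have sv := h.swap.supersol P.hν.le (by linarith [P.hβ]) hEv
  have iu := su.integrable_sq hn P.hk hk0 hp1 P.hbp
  have iv := sv.integrable_sq hn P.hk hk0 hp1 P.hbp
  have cu := h.smooth_fst.continuousOn
  have cv := h.smooth_snd.continuousOn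
  have iΦ := integrable_sum_sq hn cu cv iu iv
  set Φ : Euc n → ℝ := fun x => u x + v x with hΦ
  have cΦ : ContinuousOn Φ {0}ᶜ := cu.add cv
  have hΦ0 : ∀ x, x ≠ 0 → 0 < Φ x := fun x hx => add_pos (h.pos_fst x hx) (h.pos_snd x hx)
  have iΦq := integrable_sum_critExp P.hn cu cv h.pos_fst h.pos_snd
    (su.integrable_critExp P.hn P.hk hk0 hp1 P.hbp) (sv.integrable_critExp P.hn P.hk hk0 hp1 P.hbp)
  obtain ⟨κ₁, hκ₁⟩ := h.exists_diff_le P iv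
  obtain ⟨κ₂, hκ₂⟩ := h.swap.exists_diff_le P.swap iu
  set κ := max 0 (max κ₁ κ₂) with hκ
  have κ0 : 0 ≤ κ := le_max_left _ _
  have κ1 : κ₁ ≤ κ := (le_max_left _ _).trans (le_max_right _ _)
  have κ2 : κ₂ ≤ κ := (le_max_right _ _).trans (le_max_right _ _)
  set θ : ℝ := 1 / (32 * (κ + 1)) with hθ
  obtain ⟨ε, hε, Hε⟩ := exists_small_form P.hn P.hk hk0 P.hp P.hpq P.hbp cΦ hΦ0 iΦq
    (θ := θ) (by positivity)
  refine ⟨ε, hε, fun U V H Ω hΩ hfr hA => ?_⟩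
  set A : Set (Euc n) := {x | x ∈ Ω ∧ x ≠ 0 ∧ (U x < u x ∨ V x < v x)} with hAd
  set W : Euc n → ℝ := fun x => ‖x‖ ^ (-(b * p)) * Φ x ^ (p - 2) with hW
  have cW : ContinuousOn W {0}ᶜ :=
    (continuousOn_norm_rpow _).mul (cΦ.rpow_const fun x hx => Or.inl (hΦ0 x hx).ne')
  have W0 : ∀ x, x ≠ 0 → 0 ≤ W x := fun x hx => by have := hΦ0 x hx; positivity
  have sw : ContDiffOn ℝ 2 (fun y => u y - U y) {0}ᶜ := h.smooth_fst.sub H.smooth_fst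
  have sz : ContDiffOn ℝ 2 (fun y => v y - V y) {0}ᶜ := h.smooth_snd.sub H.smooth_snd
  have hAm : MeasurableSet A := by
    have h1 : IsOpen {x ∈ ({0}ᶜ : Set (Euc n)) | u x - U x ∈ Set.Ioi 0} :=
      sw.continuousOn.isOpen_inter_preimage isOpen_compl_singleton isOpen_Ioi
    have h2 : IsOpen {x ∈ ({0}ᶜ : Set (Euc n)) | v x - V x ∈ Set.Ioi 0} :=
      sz.continuousOn.isOpen_inter_preimage isOpen_compl_singleton isOpen_Ioi
    have : A = Ω ∩ ({x ∈ ({0}ᶜ : Set (Euc n)) | u x - U x ∈ Set.Ioi 0} ∪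
        {x ∈ ({0}ᶜ : Set (Euc n)) | v x - V x ∈ Set.Ioi 0}) := by
      ext x
      simp only [hAd, Set.mem_inter_iff, Set.mem_union, Set.mem_ofPred_eq, Set.mem_Ioi, sub_pos,
        Set.mem_compl_iff, Set.mem_singleton_iff]
      tauto
    rw [this]
    exact (hΩ.inter (h1.union h2)).measurableSet
  have fw : ∀ x ∈ frontier Ω, x ≠ 0 → u x - U x = 0 := fun x hx h0 => by
    rw [(hfr x hx h0).1, sub_self]
  have fz : ∀ x ∈ frontier Ω, x ≠ 0 → v x - V x = 0 := fun x hx h0 => by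
    rw [(hfr x hx h0).2, sub_self]
  have wΦ : ∀ x, x ≠ 0 → u x - U x ≤ Φ x := fun x hx => by
    have := H.pos_fst x hx; have := h.pos_snd x hx
    simp only [hΦ]; linarith
  have zΦ : ∀ x, x ≠ 0 → v x - V x ≤ Φ x := fun x hx => by
    have := H.pos_snd x hx; have := h.pos_fst x hx
    simp only [hΦ]; linarith
  have dw : ∀ x ∈ Ω, x ≠ 0 → 0 < u x - U x → -(wdiv a (fun y => u y - U y) x) ≤
      κ * W x * (u x - U x + max (v x - V x) 0) := fun x _ hx hlt => by
    refine (hκ₁ U V H x hx hlt).trans ?_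
    have := W0 x hx
    have : 0 ≤ max (v x - V x) 0 := le_max_right _ _
    exact mul_le_mul_of_nonneg_right (mul_le_mul_of_nonneg_right κ1 (W0 x hx)) (by linarith)
  have dz : ∀ x ∈ Ω, x ≠ 0 → 0 < v x - V x → -(wdiv a (fun y => v y - V y) x) ≤
      κ * W x * (v x - V x + max (u x - U x) 0) := fun x _ hx hlt => by
    refine (hκ₂ V U H.swap x hx hlt).trans ?_
    have : 0 ≤ max (u x - U x) 0 := le_max_right _ _
    rw [add_comm (v x) (u x)]
    exact mul_le_mul_of_nonneg_right (mul_le_mul_of_nonneg_right κ2 (W0 x hx)) (by linarith)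
  obtain ⟨K, hK0, hK⟩ := exists_logCutoff n
  set I := ∫ x : Euc n, ‖x‖ ^ (-(2 * a) - 2) * Φ x ^ 2 with hI
  have joint : ∀ L : ℝ, 0 < L → ∀ η : Euc n → ℝ, LogCutoff K L η →
      ∀ δ : ℝ, ∀ S T σ : ℝ → ℝ, PosReg δ S T σ →
      (∫ x : Euc n, ‖x‖ ^ (-(2 * a)) *
        ‖∇ (fun x => Ω.indicator (fun y => S (u y - U y)) x * η x) x‖ ^ 2) +
      (∫ x : Euc n, ‖x‖ ^ (-(2 * a)) *
        ‖∇ (fun x => Ω.indicator (fun y => S (v y - V y)) x * η x) x‖ ^ 2) ≤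
      16 * κ * (δ ^ 2 * ∫ x, W x * η x ^ 2) + 40 * (K ^ 2 / L ^ 2 * I) := by
    intro L hL η hη δ S T σ hr
    have b1 := energy_step hn sw sz fw fz hr hη κ0 wΦ zΦ (fun x hx => (hΦ0 x hx).le) iΦ cW W0 dw
      hAm (fun x hx h0 hlt => ⟨hx, h0, Or.inl (sub_pos.mp hlt)⟩)
    have b2 := energy_step hn sz sw fz fw hr hη κ0 zΦ wΦ (fun x hx => (hΦ0 x hx).le) iΦ cW W0 dz
      hAm (fun x hx h0 hlt => ⟨hx, h0, Or.inr (sub_pos.mp hlt)⟩)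
    have t1 := (caccioppoli hn sw fw hr hη wΦ (fun x hx => (hΦ0 x hx).le) iΦ).1
    have t2 := (caccioppoli hn sz fz hr hη zΦ (fun x hx => (hΦ0 x hx).le) iΦ).1
    have s1 := Hε A hAm hA _ t1
    have s2 := Hε A hAm hA _ t2
    set X := ∫ x : Euc n, ‖x‖ ^ (-(2 * a)) *
        ‖∇ (fun x => Ω.indicator (fun y => S (u y - U y)) x * η x) x‖ ^ 2
    set Y := ∫ x : Euc n, ‖x‖ ^ (-(2 * a)) *
        ‖∇ (fun x => Ω.indicator (fun y => S (v y - V y)) x * η x) x‖ ^ 2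
    have X0 : 0 ≤ X := integral_nonneg fun x => by positivity
    have Y0 : 0 ≤ Y := integral_nonneg fun x => by positivity
    have hκθ : κ * θ ≤ 1 / 32 := by
      rw [hθ, mul_one_div, div_le_div_iff₀ (by positivity) (by norm_num)]; linarith
    have c1 := mul_le_mul_of_nonneg_left s1 κ0
    have c2 := mul_le_mul_of_nonneg_left s2 κ0
    have c3 := mul_le_mul_of_nonneg_right hκθ X0
    have c4 := mul_le_mul_of_nonneg_right hκθ Y0
    nlinarith
  have hz : ∀ w : Euc n → ℝ, ContinuousOn w {0}ᶜ → (∀ x ∈ frontier Ω, x ≠ 0 → w x = 0) →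
      (∀ L : ℝ, 0 < L → ∀ η : Euc n → ℝ, LogCutoff K L η →
        ∀ δ : ℝ, ∀ S T σ : ℝ → ℝ, PosReg δ S T σ →
        TestFn (fun x => Ω.indicator (fun y => S (w y)) x * η x) ∧
        (∫ x : Euc n, ‖x‖ ^ (-(2 * a)) *
          ‖∇ (fun x => Ω.indicator (fun y => S (w y)) x * η x) x‖ ^ 2) ≤
        16 * κ * (δ ^ 2 * ∫ x, W x * η x ^ 2) + 40 * (K ^ 2 / L ^ 2 * I)) →
      ∀ x ∈ Ω, x ≠ 0 → w x ≤ 0 := by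
    intro w cw hw0 hb
    set F : Euc n → ℝ := fun x => ‖x‖ ^ (-(2 * a) - 2) *
      Ω.indicator (fun y => max (w y) 0 ^ 2) x with hF
    have cF : ContinuousOn F {0}ᶜ := by
      refine (continuousOn_norm_rpow _).mul fun x hx => ?_
      refine (continuousAt_indicator_of_frontier ?_ fun hfr => ?_).continuousWithinAt
      · exact ((cw.sup continuousOn_const).pow 2).continuousAt (isOpen_compl_singleton.mem_nhds hx)
      · simp [hw0 x hfr hx]
    have F0 : ∀ x, x ≠ 0 → 0 ≤ F x := fun x _ =>
      mul_nonneg (by positivity) (Set.indicator_apply_nonneg fun _ => by positivity)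
    have key : ∀ x, x ≠ 0 → F x = 0 := fun x hx => by
      refine eq_zero_of_logCutoff cF F0 hn hK (C := 320 / k ^ 2 * (K ^ 2 * I)) ?_ hx
      intro L hL η hη
      have iW : 0 ≤ ∫ x, W x * η x ^ 2 := integral_nonneg_of_ae
        ((ae_ne_zero hn).mono fun x hx => mul_nonneg (W0 x hx) (sq_nonneg _))
      have iD : 0 ≤ ∫ x : Euc n, ‖x‖ ^ (-(2 * a) - 2) * η x ^ 2 :=
        integral_nonneg fun x => by positivity
      refine le_of_forall_sq_bound (d := 128 / k ^ 2 * κ * (∫ x, W x * η x ^ 2) +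
        2 * ∫ x : Euc n, ‖x‖ ^ (-(2 * a) - 2) * η x ^ 2) (by positivity) fun δ hδ => ?_
      obtain ⟨S, T, σ, hr⟩ := exists_posReg hδ
      obtain ⟨tg, hX⟩ := hb L hL η hη δ S T σ hr
      have hh := hardy P.hk hk0 tg
      have it : ∀ {g : Euc n → ℝ}, TestFn g →
          Integrable fun x : Euc n => ‖x‖ ^ (-(2 * a) - 2) * g x ^ 2 := fun hg =>
        (hg.supp.mono fun x hx => by simp [hx]).integrable
          ((continuousOn_norm_rpow _).mul (hg.continuous.continuousOn.pow 2))
      have j1 := (it tg).const_mul 2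
      have j2 := (it hη.test).const_mul (2 * δ ^ 2)
      have hle : ∫ x, F x * η x ^ 2 ≤
          2 * (∫ x : Euc n, ‖x‖ ^ (-(2 * a) - 2) *
            (Ω.indicator (fun y => S (w y)) x * η x) ^ 2) +
          2 * δ ^ 2 * ∫ x : Euc n, ‖x‖ ^ (-(2 * a) - 2) * η x ^ 2 := by
        rw [← integral_const_mul, ← integral_const_mul, ← integral_add j1 j2]
        refine integral_mono_ae ?_ (j1.add j2) (ae_of_all _ fun x => ?_)
        · exact (hη.test.supp.mono fun x hx => by simp [hx]).integrable
            (cF.mul (hη.test.continuous.continuousOn.pow 2))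
        have hS := hr.le_S (w x)
        have hS0 := hr.S_nonneg (w x)
        by_cases hxΩ : x ∈ Ω
        · simp only [hF, Set.indicator_of_mem hxΩ]
          have h1 : max (w x) 0 ≤ S (w x) + δ := max_le (by linarith) (by linarith)
          have h2 : 0 ≤ max (w x) 0 := le_max_right _ _
          calc _ = ‖x‖ ^ (-(2 * a) - 2) * η x ^ 2 * max (w x) 0 ^ 2 := by ring
            _ ≤ ‖x‖ ^ (-(2 * a) - 2) * η x ^ 2 * (2 * S (w x) ^ 2 + 2 * δ ^ 2) := by
                gcongr
                nlinarith [sq_nonneg (S (w x) - δ)]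
            _ = _ := by ring
        · simp only [hF, Set.indicator_of_notMem hxΩ]
          simp only [mul_zero, zero_mul, ne_eq, OfNat.ofNat_ne_zero, not_false_eq_true, zero_pow,
            zero_add]
          positivity
      have hk4 : 0 ≤ 4 / k ^ 2 := by positivity
      have h5 := mul_le_mul_of_nonneg_left hX hk4
      calc _ ≤ 2 * (4 / k ^ 2 * (16 * κ * (δ ^ 2 * ∫ x, W x * η x ^ 2) +
            40 * (K ^ 2 / L ^ 2 * I))) +
            2 * δ ^ 2 * ∫ x : Euc n, ‖x‖ ^ (-(2 * a) - 2) * η x ^ 2 := by linarith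
        _ = _ := by ring
    intro x hxΩ hx
    have := key x hx
    simp only [hF, Set.indicator_of_mem hxΩ] at this
    have h0 : 0 < ‖x‖ := norm_pos_iff.mpr hx
    have h1 : max (w x) 0 ^ 2 = 0 := by
      rcases mul_eq_zero.mp this with h2 | h2
      · exact absurd h2 (by positivity)
      · exact h2
    exact max_eq_right_iff.mp (pow_eq_zero_iff two_ne_zero |>.mp h1)
  have n1 : ∀ f : Euc n → ℝ, 0 ≤ ∫ x : Euc n, ‖x‖ ^ (-(2 * a)) * ‖∇ f x‖ ^ 2 :=
    fun f => integral_nonneg fun x => by positivity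
  intro x hxΩ hx
  refine ⟨sub_nonpos.mp (hz _ sw.continuousOn fw (fun L hL η hη δ S T σ hr => ⟨?_, ?_⟩) x hxΩ hx),
    sub_nonpos.mp (hz _ sz.continuousOn fz (fun L hL η hη δ S T σ hr => ⟨?_, ?_⟩) x hxΩ hx)⟩
  · exact (caccioppoli hn sw fw hr hη wΦ (fun x hx => (hΦ0 x hx).le) iΦ).1
  · linarith [joint L hL η hη δ S T σ hr,
      n1 (fun x => Ω.indicator (fun y => S (v y - V y)) x * η x)]
  · exact (caccioppoli hn sz fz hr hη zΦ (fun x hx => (hΦ0 x hx).le) iΦ).1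
  · linarith [joint L hL η hη δ S T σ hr,
      n1 (fun x => Ω.indicator (fun y => S (u y - U y)) x * η x)]

end comparison

section kelvin

variable {n : ℕ} {a b p ν α β k l c : ℝ} {u v : Euc n → ℝ}

lemma differentiableAt_fderiv_punctured (hu : ContDiffOn ℝ 2 u {0}ᶜ) {x : Euc n} (hx : x ≠ 0) :
    DifferentiableAt ℝ (fderiv ℝ u) x :=
  ((hu.fderiv_of_isOpen (m := 1) isOpen_compl_singleton (by norm_num)).contDiffAt
    (isOpen_compl_singleton.mem_nhds hx)).differentiableAt one_ne_zero

lemma lapl_eq_sum (hu : ContDiffOn ℝ 2 u {0}ᶜ) {x : Euc n} (hx : x ≠ 0) :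
    lapl u x = ∑ i : Fin n, fderiv ℝ (fderiv ℝ u) x (EuclideanSpace.single i 1)
      (EuclideanSpace.single i 1) := by
  refine Finset.sum_congr rfl fun i _ => ?_
  have := (differentiableAt_fderiv_punctured hu hx).hasFDerivAt.clm_apply
    (hasFDerivAt_const (EuclideanSpace.single i (1 : ℝ)) x)
  rw [this.fderiv]
  simp

lemma hasFDerivAt_fderiv_apply (hu : ContDiffOn ℝ 2 u {0}ᶜ) {x : Euc n} (hx : x ≠ 0)
    (e : Euc n) : HasFDerivAt (fun y => fderiv ℝ u y e)
      ((fderiv ℝ (fderiv ℝ u) x).flip e) x :=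
  ((differentiableAt_fderiv_punctured hu hx).hasFDerivAt.clm_apply
    (hasFDerivAt_const e x)).congr_fderiv (by ext; simp)

lemma eventually_ne_zero {x : Euc n} (hx : x ≠ 0) : ∀ᶠ y in 𝓝 x, y ≠ 0 :=
  isOpen_compl_singleton.mem_nhds hx

lemma lapl_mul (hu : ContDiffOn ℝ 2 u {0}ᶜ) (hv : ContDiffOn ℝ 2 v {0}ᶜ) {x : Euc n}
    (hx : x ≠ 0) : lapl (fun y => u y * v y) x = u x * lapl v x +
      2 * (∑ i : Fin n, fderiv ℝ u x (EuclideanSpace.single i 1) *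
        fderiv ℝ v x (EuclideanSpace.single i 1)) + v x * lapl u x := by
  rw [lapl_eq_sum hu hx, lapl_eq_sum hv hx, lapl, Finset.mul_sum, Finset.mul_sum, Finset.mul_sum,
    ← Finset.sum_add_distrib, ← Finset.sum_add_distrib]
  refine Finset.sum_congr rfl fun i _ => ?_
  set e : Euc n := EuclideanSpace.single i 1
  have heq : (fun y => fderiv ℝ (fun y => u y * v y) y e) =ᶠ[𝓝 x]
      fun y => u y * fderiv ℝ v y e + v y * fderiv ℝ u y e := by
    filter_upwards [eventually_ne_zero hx] with y hy
    rw [((hu.hasFDerivAt_punctured two_ne_zero hy).fun_mul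
      (hv.hasFDerivAt_punctured two_ne_zero hy)).fderiv]
    simp
  rw [heq.fderiv_eq, (((hu.hasFDerivAt_punctured two_ne_zero hx).fun_mul
    (hasFDerivAt_fderiv_apply hv hx e)).fun_add ((hv.hasFDerivAt_punctured two_ne_zero hx).fun_mul
    (hasFDerivAt_fderiv_apply hu hx e))).fderiv]
  simp
  ring

lemma sum_sq_eq (x : Euc n) : ∑ i : Fin n, x i * x i = ‖x‖ ^ 2 := by
  rw [EuclideanSpace.real_norm_sq_eq]
  simp [sq]

lemma lapl_norm_rpow (s : ℝ) {x : Euc n} (hx : x ≠ 0) :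
    lapl (fun y : Euc n => ‖y‖ ^ s) x = s * (s + n - 2) * ‖x‖ ^ (s - 2) := by
  have key : ∀ i : Fin n, fderiv ℝ (fun y : Euc n => fderiv ℝ (fun y : Euc n => ‖y‖ ^ s) y
      (EuclideanSpace.single i 1)) x (EuclideanSpace.single i 1) =
      s * (s - 2) * ‖x‖ ^ (s - 2 - 2) * (x i * x i) + s * ‖x‖ ^ (s - 2) := fun i => by
    have heq : (fun y : Euc n => fderiv ℝ (fun y : Euc n => ‖y‖ ^ s) y
        (EuclideanSpace.single i 1)) =ᶠ[𝓝 x]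
        fun y => (s * ‖y‖ ^ (s - 2)) * innerSL ℝ (EuclideanSpace.single i 1) y := by
      filter_upwards [eventually_ne_zero hx] with y hy
      rw [(hasFDerivAt_norm_rpow_punctured s hy).fderiv]
      simp only [smul_apply, innerSL_apply_apply, smul_eq_mul, real_inner_comm]
    rw [heq.fderiv_eq, (((hasFDerivAt_norm_rpow_punctured (s - 2) hx).const_mul s).fun_mul
      (innerSL ℝ (EuclideanSpace.single i (1 : ℝ))).hasFDerivAt).fderiv]
    simp [EuclideanSpace.inner_single_left, EuclideanSpace.inner_single_right]
    ring
  rw [lapl, Finset.sum_congr rfl fun i _ => key i, Finset.sum_add_distrib, ← Finset.mul_sum,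
    sum_sq_eq, mul_assoc, norm_rpow_two_mul_sq (s - 2) hx]
  simp
  ring

/-- The inversion in the origin-centred sphere of squared radius `c`. -/
def invert (c : ℝ) (x : Euc n) : Euc n := (c / ‖x‖ ^ 2) • x

lemma invert_ne_zero (hc : 0 < c) {x : Euc n} (hx : x ≠ 0) : invert c x ≠ 0 := by
  have := norm_pos_iff.mpr hx
  exact smul_ne_zero (by positivity) hx

lemma norm_invert (hc : 0 < c) {x : Euc n} (hx : x ≠ 0) : ‖invert c x‖ = c / ‖x‖ := by
  have := norm_pos_iff.mpr hx
  rw [invert, norm_smul, Real.norm_of_nonneg (by positivity)]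
  field_simp

lemma invert_invert (hc : 0 < c) {x : Euc n} (hx : x ≠ 0) : invert c (invert c x) = x := by
  have := norm_pos_iff.mpr hx
  rw [invert, norm_invert hc hx, invert, smul_smul]
  convert one_smul ℝ x using 2
  field_simp

lemma contDiffOn_invert (c : ℝ) : ContDiffOn ℝ 2 (invert c : Euc n → Euc n) {0}ᶜ := by
  refine ContDiffOn.smul (contDiffOn_const.div (contDiff_norm_sq ℝ).contDiffOn fun x hx => ?_)
    contDiffOn_id
  have : 0 < ‖x‖ := norm_pos_iff.mpr hx
  positivity

lemma hasFDerivAt_norm_sq_pow_inv (m : ℕ) {x : Euc n} (hx : x ≠ 0) :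
    HasFDerivAt (fun y : Euc n => 1 / (‖y‖ ^ 2) ^ m)
      ((-(2 * m) / (‖x‖ ^ 2) ^ (m + 1)) • innerSL ℝ x) x := by
  have h0 : 0 < ‖x‖ := norm_pos_iff.mpr hx
  have h1 : HasFDerivAt (fun y : Euc n => ‖y‖ ^ 2) (2 • innerSL ℝ x) x :=
    (hasStrictFDerivAt_norm_sq x).hasFDerivAt
  have h2 : HasDerivAt (fun t : ℝ => 1 / t ^ m) (-m / (‖x‖ ^ 2) ^ (m + 1)) (‖x‖ ^ 2) := by
    have h3 := (hasDerivAt_const (‖x‖ ^ 2) (1 : ℝ)).fun_div (hasDerivAt_pow m (‖x‖ ^ 2))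
      (by positivity)
    refine h3.congr_deriv ?_
    rcases m with _ | m
    · simp
    · simp only [Nat.add_sub_cancel]
      field_simp
      ring
  refine (h2.comp_hasFDerivAt x h1).congr_fderiv ?_
  ext y
  simp
  ring

lemma hasFDerivAt_invert (c : ℝ) {x : Euc n} (hx : x ≠ 0) : HasFDerivAt (invert c)
    (c • ((1 / ‖x‖ ^ 2) • ContinuousLinearMap.id ℝ (Euc n) -
      (2 / ‖x‖ ^ 4) • (innerSL ℝ x).smulRight x)) x := by
  have h0 : 0 < ‖x‖ := norm_pos_iff.mpr hx
  have := (((hasFDerivAt_norm_sq_pow_inv 1 hx).fun_smul (hasFDerivAt_id x)).const_smul c)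
  have e : (invert c : Euc n → Euc n) = c • fun y : Euc n => (1 / (‖y‖ ^ 2) ^ 1) • id y := by
    funext y
    simp [invert, smul_smul, div_eq_mul_inv]
  rw [e]
  refine this.congr_fderiv ?_
  ext y
  simp
  ring_nf

lemma fderiv_comp_invert (hc : 0 < c) (hu : ContDiffOn ℝ 2 u {0}ᶜ) {x : Euc n} (hx : x ≠ 0)
    (e : Euc n) : fderiv ℝ (fun y => u (invert c y)) x e =
      c * (1 / (‖x‖ ^ 2) ^ 1 * fderiv ℝ u (invert c x) e -
        2 * (1 / (‖x‖ ^ 2) ^ 2 * (⟪e, x⟫ * fderiv ℝ u (invert c x) x))) := by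
  have := (hu.hasFDerivAt_punctured two_ne_zero (invert_ne_zero hc hx)).comp x
    (hasFDerivAt_invert c hx)
  have e1 : (u ∘ invert c) = fun y => u (invert c y) := rfl
  rw [e1] at this
  rw [this.fderiv]
  simp only [ContinuousLinearMap.comp_apply, smul_apply, sub_apply, ContinuousLinearMap.id_apply,
    ContinuousLinearMap.smulRight_apply, innerSL_apply_apply, map_smul, map_sub, smul_eq_mul,
    real_inner_comm]
  ring

lemma contDiffOn_comp_invert (hc : 0 < c) (hu : ContDiffOn ℝ 2 u {0}ᶜ) :
    ContDiffOn ℝ 2 (fun y => u (invert c y)) {0}ᶜ :=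
  hu.comp (contDiffOn_invert c) fun _ hx => invert_ne_zero hc hx

lemma lapl_comp_invert (hc : 0 < c) (hu : ContDiffOn ℝ 2 u {0}ᶜ) {x : Euc n} (hx : x ≠ 0) :
    lapl (fun y => u (invert c y)) x =
      c * (4 - 2 * n) / ‖x‖ ^ 4 * fderiv ℝ u (invert c x) x +
      c ^ 2 / ‖x‖ ^ 4 * lapl u (invert c x) := by
  have h0 : 0 < ‖x‖ := norm_pos_iff.mpr hx
  have hJ := invert_ne_zero hc hx
  set D := fderiv ℝ u (invert c x) with hD
  set B := fderiv ℝ (fderiv ℝ u) (invert c x) with hB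
  have key : ∀ i : Fin n, fderiv ℝ (fun y : Euc n => fderiv ℝ (fun y => u (invert c y)) y
      (EuclideanSpace.single i 1)) x (EuclideanSpace.single i 1) =
      c * (-4 / ‖x‖ ^ 4) * (x i * D (EuclideanSpace.single i 1)) +
      c * (8 / ‖x‖ ^ 6 * D x) * (x i * x i) + c * (-2 / ‖x‖ ^ 4 * D x) +
      c ^ 2 / ‖x‖ ^ 4 * B (EuclideanSpace.single i 1) (EuclideanSpace.single i 1) -
      2 * c ^ 2 / ‖x‖ ^ 6 * (x i * B x (EuclideanSpace.single i 1)) -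
      2 * c ^ 2 / ‖x‖ ^ 6 * (x i * B (EuclideanSpace.single i 1) x) +
      4 * c ^ 2 / ‖x‖ ^ 8 * B x x * (x i * x i) := fun i => by
    set e : Euc n := EuclideanSpace.single i 1 with he
    have heq : (fun y : Euc n => fderiv ℝ (fun y => u (invert c y)) y e) =ᶠ[𝓝 x]
        fun y => c * (1 / (‖y‖ ^ 2) ^ 1 * fderiv ℝ u (invert c y) e -
        2 * (1 / (‖y‖ ^ 2) ^ 2 * (innerSL ℝ e y * fderiv ℝ u (invert c y) y))) := by
      filter_upwards [eventually_ne_zero hx] with y hy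
      exact fderiv_comp_invert hc hu hy e
    have hDJ : HasFDerivAt (fun y => fderiv ℝ u (invert c y)) _ x :=
      (differentiableAt_fderiv_punctured hu hJ).hasFDerivAt.comp x (hasFDerivAt_invert c hx)
    have d1 := hDJ.clm_apply (hasFDerivAt_const e x)
    have d2 := hDJ.clm_apply (hasFDerivAt_id x)
    have d3 := (((hasFDerivAt_norm_sq_pow_inv 1 hx).fun_mul d1).fun_sub
      (((hasFDerivAt_norm_sq_pow_inv 2 hx).fun_mul
      ((innerSL ℝ e).hasFDerivAt.fun_mul d2)).const_mul 2)).const_mul c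
    have ex : ⟪e, x⟫ = x i := by simp [he, EuclideanSpace.inner_single_left]
    have ex' : ⟪x, e⟫ = x i := by rw [real_inner_comm, ex]
    have ee : ⟪e, e⟫ = (1 : ℝ) := by simp [he]
    rw [heq.fderiv_eq]
    refine (congrFun (congrArg DFunLike.coe d3.fderiv) e).trans ?_
    simp only [← hD, ← hB, smul_apply, sub_apply, add_apply, ContinuousLinearMap.comp_apply,
      ContinuousLinearMap.flip_apply, innerSL_apply_apply, ContinuousLinearMap.smulRight_apply,
      ex, ex', ee, smul_eq_mul, map_sub, map_smul, ContinuousLinearMap.id_apply, id,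
      zero_apply, map_zero]
    push_cast
    field_simp
    ring
  have s1 : ∑ i : Fin n, x i * D (EuclideanSpace.single i 1) = D x :=
    (fderiv_apply_eq_sum u (invert c x) x).symm
  have hx' : x = ∑ i : Fin n, x i • (EuclideanSpace.single i (1 : ℝ) : Euc n) := by
    conv_lhs => rw [← (EuclideanSpace.basisFun (Fin n) ℝ).sum_repr x]
    simp
  have s2 : ∑ i : Fin n, x i * B x (EuclideanSpace.single i 1) = B x x := by
    conv_rhs => rw [show B x x = B x (∑ i : Fin n, x i • (EuclideanSpace.single i (1 : ℝ) : Euc n))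
      by rw [← hx']]
    simp [map_sum]
  have s3 : ∑ i : Fin n, x i * B (EuclideanSpace.single i 1) x = B x x := by
    conv_rhs => rw [show B x x = B (∑ i : Fin n, x i • (EuclideanSpace.single i (1 : ℝ) : Euc n)) x
      by rw [← hx']]
    simp [map_sum]
  rw [lapl_eq_sum hu hJ, lapl, Finset.sum_congr rfl fun i _ => key i]
  simp only [Finset.sum_add_distrib, Finset.sum_sub_distrib, ← Finset.mul_sum, sum_sq_eq, s1, s2,
    s3, Finset.sum_const, Finset.card_univ, Fintype.card_fin, nsmul_eq_mul]
  field_simp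
  ring

/-- The Kelvin transform with respect to the sphere of radius `l`. -/
def kelvin (k l : ℝ) (u : Euc n → ℝ) (x : Euc n) : ℝ :=
  (l / ‖x‖) ^ (2 * k) * u (invert (l ^ 2) x)

lemma kelvin_eq (hl : 0 < l) (k : ℝ) (u : Euc n → ℝ) :
    kelvin k l u = fun x => l ^ (2 * k) * (‖x‖ ^ (-(2 * k)) * u (invert (l ^ 2) x)) := by
  funext x
  rw [kelvin, Real.div_rpow hl.le (norm_nonneg _), Real.rpow_neg (norm_nonneg _)]
  ring

lemma contDiffOn_kelvin (hl : 0 < l) (k : ℝ) (hu : ContDiffOn ℝ 2 u {0}ᶜ) :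
    ContDiffOn ℝ 2 (kelvin k l u) {0}ᶜ := by
  rw [kelvin_eq hl]
  exact contDiffOn_const.mul ((contDiffOn_norm_rpow _).mul
    (contDiffOn_comp_invert (by positivity) hu))

lemma kelvin_pos (hl : 0 < l) (k : ℝ) (hu : ∀ x, x ≠ 0 → 0 < u x) {x : Euc n} (hx : x ≠ 0) :
    0 < kelvin k l u x := by
  have := norm_pos_iff.mpr hx
  have := hu _ (invert_ne_zero (c := l ^ 2) (by positivity) hx)
  rw [kelvin]; positivity

lemma wdiv_kelvin (hk : 2 * k = n - 2 - 2 * a) (hl : 0 < l) (hu : ContDiffOn ℝ 2 u {0}ᶜ)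
    {x : Euc n} (hx : x ≠ 0) : wdiv a (kelvin k l u) x =
      (l / ‖x‖) ^ (2 * k + 4 + 4 * a) * wdiv a u (invert (l ^ 2) x) := by
  have h0 : 0 < ‖x‖ := norm_pos_iff.mpr hx
  have hc : 0 < l ^ 2 := by positivity
  have sW := contDiffOn_comp_invert hc hu
  have sr := contDiffOn_norm_rpow (n := n) (m := 2) (-(2 * k))
  have sg : ContDiffOn ℝ 2 (fun x : Euc n => ‖x‖ ^ (-(2 * k)) * u (invert (l ^ 2) x)) {0}ᶜ :=
    (contDiffOn_norm_rpow _).mul sW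
  have e1 : fderiv ℝ (fun y => u (invert (l ^ 2) y)) x x =
      -(l ^ 2 / ‖x‖ ^ 2 * fderiv ℝ u (invert (l ^ 2) x) x) := by
    rw [fderiv_comp_invert hc hu hx, real_inner_self_eq_norm_sq]
    field_simp
    ring
  have e2 : ∑ i : Fin n, fderiv ℝ (fun y : Euc n => ‖y‖ ^ (-(2 * k))) x
      (EuclideanSpace.single i 1) * fderiv ℝ (fun y => u (invert (l ^ 2) y)) x
      (EuclideanSpace.single i 1) = -(2 * k) * ‖x‖ ^ (-(2 * k) - 2) *
      -(l ^ 2 / ‖x‖ ^ 2 * fderiv ℝ u (invert (l ^ 2) x) x) := by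
    rw [← e1, fderiv_apply_eq_sum _ x x, Finset.mul_sum]
    refine Finset.sum_congr rfl fun i _ => ?_
    rw [(hasFDerivAt_norm_rpow_punctured _ hx).fderiv]
    simp [EuclideanSpace.inner_single_right]
    ring
  have e3 : lapl (kelvin k l u) x = l ^ (2 * k) * lapl (fun x : Euc n => ‖x‖ ^ (-(2 * k)) *
      u (invert (l ^ 2) x)) x := by
    rw [kelvin_eq hl, lapl, lapl, Finset.mul_sum]
    refine Finset.sum_congr rfl fun i _ => ?_
    have heq : (fun y => fderiv ℝ (fun x : Euc n => l ^ (2 * k) * (‖x‖ ^ (-(2 * k)) *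
        u (invert (l ^ 2) x))) y (EuclideanSpace.single i 1)) =ᶠ[𝓝 x] fun y => l ^ (2 * k) *
        fderiv ℝ (fun x : Euc n => ‖x‖ ^ (-(2 * k)) * u (invert (l ^ 2) x)) y
        (EuclideanSpace.single i 1) := by
      filter_upwards [eventually_ne_zero hx] with y hy
      rw [((sg.hasFDerivAt_punctured two_ne_zero hy).const_mul _).fderiv]
      simp
    rw [heq.fderiv_eq, ((hasFDerivAt_fderiv_apply sg hx _).const_mul _).fderiv,
      (hasFDerivAt_fderiv_apply sg hx _).fderiv]
    simp
  have e4 : fderiv ℝ (kelvin k l u) x x = l ^ (2 * k) * (‖x‖ ^ (-(2 * k)) *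
      -(l ^ 2 / ‖x‖ ^ 2 * fderiv ℝ u (invert (l ^ 2) x) x) +
      u (invert (l ^ 2) x) * (-(2 * k) * ‖x‖ ^ (-(2 * k) - 2) * ‖x‖ ^ 2)) := by
    rw [kelvin_eq hl, (((sr.hasFDerivAt_punctured two_ne_zero hx).fun_mul
      (sW.hasFDerivAt_punctured two_ne_zero hx)).const_mul _).fderiv,
      (hasFDerivAt_norm_rpow_punctured _ hx).fderiv]
    simp [e1]
    ring
  have e5 : ‖x‖ ^ (-(2 * k) - 2) = ‖x‖ ^ (-(2 * k)) / ‖x‖ ^ 2 := by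
    rw [Real.rpow_sub h0]; norm_num
  have e6 : fderiv ℝ u (invert (l ^ 2) x) (invert (l ^ 2) x) =
      l ^ 2 / ‖x‖ ^ 2 * fderiv ℝ u (invert (l ^ 2) x) x := by
    conv_lhs => enter [2]; rw [invert]
    simp
  have e7 : (l / ‖x‖) ^ (2 * k + 4 + 4 * a) * (l ^ 2 / ‖x‖) ^ (-(2 * a)) =
      l ^ (2 * k) * ‖x‖ ^ (-(2 * k)) * (l ^ 4 / ‖x‖ ^ 4) * ‖x‖ ^ (-(2 * a)) := by
    rw [show l ^ 2 / ‖x‖ = (l / ‖x‖) ^ (2 : ℝ) * ‖x‖ by norm_cast; field_simp,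
      Real.mul_rpow (by positivity) h0.le, ← Real.rpow_mul (by positivity), ← mul_assoc,
      ← Real.rpow_add (by positivity), show 2 * k + 4 + 4 * a + 2 * -(2 * a) = 2 * k + (4 : ℕ) by
        push_cast; ring, Real.rpow_add_natCast (by positivity), Real.div_rpow hl.le h0.le,
      Real.rpow_neg h0.le (2 * k)]
    field_simp
  rw [wdiv, wdiv, norm_invert hc hx, ← mul_assoc, e7, inner_gradient_apply, inner_gradient_apply,
    e3, e4, e6, lapl_mul sr sW hx, e2, lapl_comp_invert hc hu hx, lapl_norm_rpow _ hx, e5]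
  rw [show (n : ℝ) = 2 * k + 2 + 2 * a by linarith]
  field_simp
  ring

lemma Sol.kelvinTransform (P : Params n a b p k ν α β) (h : Sol a b p ν α β u v) (hl : 0 < l) :
    Sol a b p ν α β (kelvin k l u) (kelvin k l v) := by
  have main : ∀ {α β : ℝ} {u v : Euc n → ℝ}, Params n a b p k ν α β → Sol a b p ν α β u v →
      ∀ x, x ≠ 0 → -(wdiv a (kelvin k l u) x) = ‖x‖ ^ (-(b * p)) *
        react p ν α β (kelvin k l u x) (kelvin k l v x) :=
    fun {α β u v} P h x hx => by
      have h0 : 0 < ‖x‖ := norm_pos_iff.mpr hx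
      have hc : 0 < l ^ 2 := by positivity
      have hJ := invert_ne_zero hc hx
      have hu := h.pos_fst _ hJ
      have hv := h.pos_snd _ hJ
      have hm : 0 < l / ‖x‖ := by positivity
      rw [wdiv_kelvin P.hk hl h.smooth_fst hx, ← mul_neg, h.eq_fst _ hJ, norm_invert hc hx,
        kelvin, kelvin]
      set m := l / ‖x‖ with hmd
      have er : react p ν α β (m ^ (2 * k) * u (invert (l ^ 2) x))
          (m ^ (2 * k) * v (invert (l ^ 2) x)) = m ^ (2 * k * (p - 1)) *
          react p ν α β (u (invert (l ^ 2) x)) (v (invert (l ^ 2) x)) := by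
        simp only [react]
        rw [Real.mul_rpow (by positivity) hu.le, Real.mul_rpow (by positivity) hu.le,
          Real.mul_rpow (by positivity) hv.le, ← Real.rpow_mul hm.le, ← Real.rpow_mul hm.le,
          ← Real.rpow_mul hm.le, show 2 * k * (p - 1) = 2 * k * (α - 1) + 2 * k * β by
            rw [← P.hαβ]; ring, Real.rpow_add hm]
        ring
      rw [er, show l ^ 2 / ‖x‖ = m ^ (2 : ℝ) * ‖x‖ by norm_cast; rw [hmd]; field_simp,
        Real.mul_rpow (by positivity) h0.le, ← Real.rpow_mul hm.le]
      have : m ^ (2 * k + 4 + 4 * a) * m ^ (2 * -(b * p)) = m ^ (2 * k * (p - 1)) := by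
        rw [← Real.rpow_add hm]
        congr 1
        linarith [P.hk, P.hbp]
      rw [← this]
      ring
  exact ⟨contDiffOn_kelvin hl k h.smooth_fst, contDiffOn_kelvin hl k h.smooth_snd,
    fun x hx => kelvin_pos hl k h.pos_fst hx, fun x hx => kelvin_pos hl k h.pos_snd hx,
    main P h, main P.swap h.swap⟩

end kelvin

section maximum

variable {n : ℕ} {a b p ν α β k : ℝ} {u v w : Euc n → ℝ}

lemma fderiv_fderiv_nonneg_of_isLocalMin {f : Euc n → ℝ} (hf : ContDiffOn ℝ 2 f {0}ᶜ) {x : Euc n}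
    (hx : x ≠ 0) (hmin : IsLocalMin f x) (e : Euc n) : 0 ≤ fderiv ℝ (fderiv ℝ f) x e e := by
  have hline : ∀ t : ℝ, HasDerivAt (fun t : ℝ => x + t • e) e t := fun t => by
    simpa using ((hasDerivAt_id t).smul_const e).const_add x
  have hx0 : x + (0 : ℝ) • e = x := by simp
  have htend : Tendsto (fun t : ℝ => x + t • e) (𝓝 0) (𝓝 x) := by
    have := (hline 0).continuousAt.tendsto
    rwa [hx0] at this
  set g : ℝ → ℝ := fun t => f (x + t • e) with hg
  have hd : ∀ᶠ t in 𝓝 (0 : ℝ), HasDerivAt g (fderiv ℝ f (x + t • e) e) t := by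
    filter_upwards [htend.eventually (eventually_ne_zero hx)] with t ht
    exact (hf.hasFDerivAt_punctured two_ne_zero ht).comp_hasDerivAt t (hline t)
  have hd1 : deriv g =ᶠ[𝓝 0] fun t => fderiv ℝ f (x + t • e) e := hd.mono fun t ht => ht.deriv
  have hd2 : deriv (deriv g) 0 = fderiv ℝ (fderiv ℝ f) x e e := by
    rw [hd1.deriv_eq]
    have h1 := hasFDerivAt_fderiv_apply hf hx e
    rw [← hx0] at h1
    have := h1.comp_hasDerivAt (0 : ℝ) (hline 0)
    refine this.deriv.trans ?_
    simp
  have hgmin : IsLocalMin g 0 := by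
    have : ∀ᶠ t in 𝓝 (0 : ℝ), f x ≤ f (x + t • e) := htend.eventually hmin
    filter_upwards [this] with t ht
    simpa [hg] using ht
  by_contra! hneg
  rw [← hd2] at hneg
  have hmax := isLocalMax_of_deriv_deriv_neg hneg hgmin.deriv_eq_zero
    hd.self_of_nhds.continuousAt
  have hconst : g =ᶠ[𝓝 0] fun _ => g 0 := by
    filter_upwards [hgmin, hmax] with t h1 h2 using le_antisymm h2 h1
  have h3 : deriv g =ᶠ[𝓝 0] fun _ => 0 := by
    filter_upwards [hconst.eventuallyEq_nhds] with t ht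
    rw [ht.deriv_eq, deriv_const]
  rw [h3.deriv_eq, deriv_const] at hneg
  exact lt_irrefl _ hneg

lemma wdiv_nonneg_of_isLocalMin (a : ℝ) {f : Euc n → ℝ} (hf : ContDiffOn ℝ 2 f {0}ᶜ) {x : Euc n}
    (hx : x ≠ 0) (hmin : IsLocalMin f x) : 0 ≤ wdiv a f x := by
  rw [wdiv, inner_gradient_apply, hmin.fderiv_eq_zero, lapl_eq_sum hf hx]
  simp only [zero_apply, mul_zero, zero_div, sub_zero]
  exact mul_nonneg (by positivity)
    (Finset.sum_nonneg fun i _ => fderiv_fderiv_nonneg_of_isLocalMin hf hx hmin _)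

/-- A Gaussian centred at `y`. -/
def gauss (γ : ℝ) (y x : Euc n) : ℝ := exp (-γ * ‖x - y‖ ^ 2)

lemma contDiff_gauss (γ : ℝ) (y : Euc n) : ContDiff ℝ 2 (gauss γ y) :=
  ((contDiff_const.mul ((contDiff_id.sub contDiff_const).norm_sq ℝ))).exp

lemma hasFDerivAt_gauss (γ : ℝ) (y x : Euc n) :
    HasFDerivAt (gauss γ y) ((-(2 * γ) * gauss γ y x) • innerSL ℝ (x - y)) x := by
  have h1 : HasFDerivAt (fun z : Euc n => ‖z‖ ^ 2) (2 • innerSL ℝ (x - y)) (x - y) :=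
    (hasStrictFDerivAt_norm_sq (x - y)).hasFDerivAt
  have h2 := ((h1.comp x ((hasFDerivAt_id x).sub_const y)).const_mul (-γ)).exp
  refine h2.congr_fderiv ?_
  ext z
  simp [gauss]
  ring

lemma lapl_gauss (γ : ℝ) (y x : Euc n) :
    lapl (gauss γ y) x = gauss γ y x * (4 * γ ^ 2 * ‖x - y‖ ^ 2 - 2 * γ * n) := by
  have key : ∀ i : Fin n, fderiv ℝ (fun z : Euc n => fderiv ℝ (gauss γ y) z
      (EuclideanSpace.single i 1)) x (EuclideanSpace.single i 1) =
      gauss γ y x * (4 * γ ^ 2) * ((x - y) i * (x - y) i) + gauss γ y x * (-(2 * γ)) := fun i => by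
    set e : Euc n := EuclideanSpace.single i 1 with he
    have heq : (fun z : Euc n => fderiv ℝ (gauss γ y) z e) =
        fun z => -(2 * γ) * (gauss γ y z * innerSL ℝ e (z - y)) := by
      funext z
      rw [(hasFDerivAt_gauss γ y z).fderiv]
      simp only [smul_apply, innerSL_apply_apply, smul_eq_mul, real_inner_comm]
      ring
    have hd := ((hasFDerivAt_gauss γ y x).fun_mul ((innerSL ℝ e).hasFDerivAt.comp x
      ((hasFDerivAt_id x).sub_const y))).const_mul (-(2 * γ))
    have ex : ⟪e, x - y⟫ = (x - y) i := by simp [he, EuclideanSpace.inner_single_left]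
    have ex' : ⟪x - y, e⟫ = (x - y) i := by rw [real_inner_comm, ex]
    have ee : ⟪e, e⟫ = (1 : ℝ) := by simp [he]
    rw [heq]
    refine (congrFun (congrArg DFunLike.coe hd.fderiv) e).trans ?_
    simp only [smul_apply, add_apply, ContinuousLinearMap.comp_apply, Function.comp_apply,
      innerSL_apply_apply, ContinuousLinearMap.id_apply, id, ex, ex', ee, smul_eq_mul]
    ring
  rw [lapl, Finset.sum_congr rfl fun i _ => key i, Finset.sum_add_distrib, ← Finset.mul_sum,
    sum_sq_eq]
  simp
  ring

lemma wdiv_gauss_pos (a : ℝ) {γ D : ℝ} {y x : Euc n} (hγ : 0 < γ) (hx : x ≠ 0)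
    (hD : ‖x - y‖ ≤ D * ‖x‖) (h : n + 2 * |a| * D < 2 * γ * ‖x - y‖ ^ 2) :
    0 < wdiv a (gauss γ y) x := by
  have h0 : 0 < ‖x‖ := norm_pos_iff.mpr hx
  have hg : 0 < gauss γ y x := exp_pos _
  rw [wdiv, inner_gradient_apply, (hasFDerivAt_gauss γ y x).fderiv, lapl_gauss]
  refine mul_pos (by positivity) ?_
  simp only [smul_apply, innerSL_apply_apply, smul_eq_mul]
  have h1 : |⟪x - y, x⟫| ≤ D * ‖x‖ ^ 2 :=
    (abs_real_inner_le_norm _ _).trans (by nlinarith)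
  have h2 : |a * (⟪x - y, x⟫ / ‖x‖ ^ 2)| ≤ |a| * D := by
    rw [abs_mul, abs_div, abs_of_pos (by positivity : (0 : ℝ) < ‖x‖ ^ 2)]
    gcongr
    rwa [div_le_iff₀ (by positivity)]
  have h3 := neg_le_of_abs_le h2
  have h4 : 0 < gauss γ y x * (2 * γ) *
      (2 * γ * ‖x - y‖ ^ 2 - n + 2 * (a * (⟪x - y, x⟫ / ‖x‖ ^ 2))) := by
    refine mul_pos (by positivity) (by linarith)
  refine h4.trans_eq ?_
  ring

/-- The zero set of a nonnegative supersolution is open. -/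
lemma eventually_eq_zero_of_wdiv_nonpos {G : Set (Euc n)} (hG : IsOpen G) (h0 : (0 : Euc n) ∉ G)
    (hw : ContDiffOn ℝ 2 w {0}ᶜ) (hw0 : ∀ x ∈ G, 0 ≤ w x) (hL : ∀ x ∈ G, wdiv a w x ≤ 0)
    {x₀ : Euc n} (hx₀ : x₀ ∈ G) (hz : w x₀ = 0) : ∀ᶠ y in 𝓝 x₀, w y = 0 := by
  have hGne : ∀ x ∈ G, x ≠ 0 := fun x hx h => h0 (h ▸ hx)
  obtain ⟨ρ, hρ, hball⟩ := Metric.isOpen_iff.mp hG x₀ hx₀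
  rw [Metric.eventually_nhds_iff_ball]
  refine ⟨ρ / 4, by positivity, fun y hy => ?_⟩
  by_contra hne
  rw [Metric.mem_ball] at hy
  set Z : Set (Euc n) := Metric.closedBall x₀ (ρ / 2) ∩ w ⁻¹' {0} with hZ
  have hsub : Metric.closedBall x₀ (ρ / 2) ⊆ G :=
    (Metric.closedBall_subset_ball (by linarith)).trans hball
  have hZc : IsCompact Z := by
    refine (isCompact_closedBall x₀ (ρ / 2)).of_isClosed_subset ?_ Set.inter_subset_left
    exact (hw.continuousOn.mono fun x hx => hGne x (hsub hx)).preimage_isClosed_of_isClosed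
      Metric.isClosed_closedBall isClosed_singleton
  obtain ⟨z, hzZ, hzmin⟩ := hZc.exists_isMinOn
    ⟨x₀, Metric.mem_closedBall_self (by positivity), hz⟩
    (continuous_const.dist continuous_id : Continuous fun z => dist y z).continuousOn
  have hzG : z ∈ G := hsub hzZ.1
  have hz0 : w z = 0 := hzZ.2
  set R := dist y z with hR
  have hRle : R ≤ dist y x₀ := hzmin ⟨Metric.mem_closedBall_self (by positivity), hz⟩
  have hyG : y ∈ G := hball (by rw [Metric.mem_ball]; linarith)
  have hRpos : 0 < R := dist_pos.mpr fun h => hne (h ▸ hz0)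
  have hpos : ∀ x, dist y x < R → 0 < w x := fun x hx => by
    have hxb : x ∈ Metric.closedBall x₀ (ρ / 2) := by
      rw [Metric.mem_closedBall]
      have := dist_triangle x y x₀
      rw [dist_comm x y] at this
      linarith
    refine (hw0 x (hsub hxb)).lt_of_ne fun h => ?_
    have : R ≤ dist y x := hzmin ⟨hxb, h.symm⟩
    linarith
  set m : Euc n := (2⁻¹ : ℝ) • (y + z) with hm
  have hmz : ‖z - m‖ = R / 2 := by
    rw [hR, dist_eq_norm, show z - m = (-(2⁻¹) : ℝ) • (y - z) by rw [hm]; module, norm_smul]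
    norm_num
    ring
  have hmy : dist y m = R / 2 := by
    rw [hR, dist_eq_norm, dist_eq_norm, show y - m = (2⁻¹ : ℝ) • (y - z) by rw [hm]; module,
      norm_smul]
    norm_num
    ring
  have hposm : ∀ x, ‖x - m‖ ≤ R / 2 → x ≠ z → 0 < w x := fun x hx hxz => by
    by_contra hcon
    have hxy : R ≤ dist y x := by
      by_contra h; exact hcon (hpos x (not_le.mp h))
    apply hxz
    have e1 : ‖(x - m) - (y - m)‖ = R := by
      refine le_antisymm ((norm_sub_le _ _).trans ?_) ?_
      · rw [← dist_eq_norm y m, hmy]; linarith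
      · rw [sub_sub_sub_cancel_right, ← dist_eq_norm, dist_comm]; exact hxy
    have e2 := parallelogram_law_with_norm ℝ (x - m) (y - m)
    have e3 : ‖y - m‖ = R / 2 := by rw [← dist_eq_norm]; exact hmy
    rw [e1, e3] at e2
    have e4 : ‖(x - m) + (y - m)‖ = 0 := by
      nlinarith [norm_nonneg (x - m), norm_nonneg (x - m + (y - m))]
    have e5 : x - m = -(y - m) := eq_neg_of_add_eq_zero_left (norm_eq_zero.mp e4)
    have e6 : x = m - (y - m) := by rw [sub_eq_iff_eq_add] at e5; rw [e5]; abel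
    rw [e6, hm]
    module
  obtain ⟨d, hd, hdb⟩ := Metric.isOpen_iff.mp hG z hzG
  set s := min (R / 4) (d / 2) with hs
  have hs0 : 0 < s := lt_min (by positivity) (by positivity)
  have hsR : s ≤ R / 4 := min_le_left _ _
  set K := Metric.closedBall z s with hK
  have hKG : K ⊆ G := (Metric.closedBall_subset_ball
    (lt_of_le_of_lt (min_le_right _ _) (by linarith))).trans hdb
  have hKc : IsCompact K := isCompact_closedBall z s
  have hzK : z ∈ K := Metric.mem_closedBall_self hs0.le
  have hKm : ∀ x ∈ K, R / 4 ≤ ‖x - m‖ ∧ ‖x - m‖ ≤ R := fun x hx => by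
    have h1 : ‖x - z‖ ≤ R / 4 := by
      rw [← dist_eq_norm]; exact (Metric.mem_closedBall.mp hx).trans hsR
    have h2 : x - m = (x - z) + (z - m) := by abel
    have h3 : z - m = (x - m) - (x - z) := by abel
    have h4 := norm_sub_le (x - m) (x - z)
    have h5 := norm_add_le (x - z) (z - m)
    rw [← h2] at h5
    rw [← h3] at h4
    constructor <;> linarith
  obtain ⟨x₁, hx₁K, hx₁⟩ := hKc.exists_isMinOn ⟨z, hzK⟩ (continuous_norm (E := Euc n)).continuousOn
  have hc0 : 0 < ‖x₁‖ := norm_pos_iff.mpr (hGne _ (hKG hx₁K))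
  set D := R / ‖x₁‖ with hD
  have hD0 : 0 < D := by positivity
  set γ := (n + 2 * |a| * D + 1) / (2 * (R / 4) ^ 2) with hγ
  have hγ0 : 0 < γ := by positivity
  have hLg : ∀ x ∈ K, 0 < wdiv a (gauss γ m) x := fun x hx => by
    obtain ⟨h1, h2⟩ := hKm x hx
    refine wdiv_gauss_pos a (D := D) hγ0 (hGne x (hKG hx)) ?_ ?_
    · refine h2.trans ?_
      rw [hD, div_mul_eq_mul_div, le_div_iff₀ hc0]
      exact mul_le_mul_of_nonneg_left (hx₁ hx) hRpos.le
    · have h3 : (R / 4) ^ 2 ≤ ‖x - m‖ ^ 2 := by gcongr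
      have h4 : 2 * γ * (R / 4) ^ 2 = n + 2 * |a| * D + 1 := by
        rw [hγ]; field_simp
      have := mul_le_mul_of_nonneg_left h3 (by positivity : 0 ≤ 2 * γ)
      linarith
  set c := gauss γ m z with hc
  have hgc : ∀ x, R / 2 < ‖x - m‖ → gauss γ m x < c := fun x hx => by
    rw [hc, gauss, gauss, exp_lt_exp, hmz]
    have : (R / 2) ^ 2 < ‖x - m‖ ^ 2 := by gcongr
    nlinarith
  -- a positive lower bound on the part of the boundary sphere inside the touching ball
  set Q := Metric.sphere z s ∩ Metric.closedBall m (R / 2) with hQ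
  have hQc : IsCompact Q := (isCompact_sphere z s).inter_right Metric.isClosed_closedBall
  have hSK : Metric.sphere z s ⊆ K := Metric.sphere_subset_closedBall
  have hμ : ∃ μ : ℝ, 0 < μ ∧ ∀ x ∈ Q, μ ≤ w x := by
    rcases Q.eq_empty_or_nonempty with h | h
    · exact ⟨1, one_pos, fun x hx => by rw [h] at hx; exact absurd hx (Set.notMem_empty x)⟩
    · obtain ⟨q, hq, hqm⟩ := hQc.exists_isMinOn h
        (hw.continuousOn.mono fun x hx => hGne x (hKG (hSK hx.1)))
      refine ⟨w q, hposm q ?_ ?_, fun x hx => hqm hx⟩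
      · rw [← dist_eq_norm]; exact hq.2
      · rintro rfl
        have := hq.1
        rw [Metric.mem_sphere, dist_self] at this
        linarith
  obtain ⟨μ, hμ0, hμ⟩ := hμ
  set ε := μ / 2 with hε
  have hg1 : ∀ x, gauss γ m x ≤ 1 := fun x => by
    rw [gauss, exp_le_one_iff]
    have : 0 ≤ γ * ‖x - m‖ ^ 2 := by positivity
    linarith
  have hcpos : 0 < c := exp_pos _
  set f : Euc n → ℝ := fun x => w x - ε * gauss γ m x with hf
  have seg : ContDiffOn ℝ 2 (fun x => ε * gauss γ m x) {0}ᶜ :=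
    (contDiff_const.mul (contDiff_gauss γ m)).contDiffOn
  have sf : ContDiffOn ℝ 2 f {0}ᶜ := hw.sub seg
  obtain ⟨t, htK, htm⟩ := hKc.exists_isMinOn ⟨z, hzK⟩
    (sf.continuousOn.mono fun x hx => hGne x (hKG hx))
  have hfz : f z = -(ε * c) := by simp only [hf, hz0, hc]; ring
  have hft : f t ≤ -(ε * c) := hfz ▸ htm hzK
  have hts : t ∉ Metric.sphere z s := fun ht => by
    by_cases h : ‖t - m‖ ≤ R / 2
    · have h1 := hμ t ⟨ht, by rwa [Metric.mem_closedBall, dist_eq_norm]⟩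
      have h2 := hg1 t
      simp only [hf] at hft
      have : ε * gauss γ m t ≤ ε * 1 := by gcongr
      have : 0 < ε * c := by positivity
      linarith
    · have h1 := hgc t (not_le.mp h)
      have h2 := hw0 t (hKG htK)
      have : ε * gauss γ m t < ε * c := by gcongr
      simp only [hf] at hft
      linarith
  have htb : t ∈ Metric.ball z s := by
    rw [Metric.mem_ball]
    exact (Metric.mem_closedBall.mp htK).lt_of_ne fun h => hts h
  have hlm : IsLocalMin f t := htm.isLocalMin
    (mem_of_superset (Metric.isOpen_ball.mem_nhds htb) Metric.ball_subset_closedBall)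
  have ht0 := hGne t (hKG htK)
  have h1 := wdiv_nonneg_of_isLocalMin a sf ht0 hlm
  have h2 : wdiv a (fun x => ε * gauss γ m x) t = ε * wdiv a (gauss γ m) t := by
    have hg2 : ContDiffOn ℝ 2 (gauss γ m) {0}ᶜ := (contDiff_gauss γ m).contDiffOn
    have hfd : (fderiv ℝ fun x => ε * gauss γ m x) = fun x => ε • fderiv ℝ (gauss γ m) x := by
      funext x
      exact ((contDiff_gauss γ m).differentiable two_ne_zero x).hasFDerivAt.const_mul ε |>.fderiv
    have hfd2 : fderiv ℝ (fun x => ε • fderiv ℝ (gauss γ m) x) t =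
        ε • fderiv ℝ (fderiv ℝ (gauss γ m)) t :=
      ((differentiableAt_fderiv_punctured hg2 ht0).hasFDerivAt.const_smul ε).fderiv
    rw [wdiv, wdiv, lapl_eq_sum seg ht0, lapl_eq_sum hg2 ht0, inner_gradient_apply,
      inner_gradient_apply, hfd, hfd2]
    simp only [smul_apply, smul_eq_mul, ← Finset.mul_sum]
    ring
  have h3 := hLg t htK
  have h4 := hL t (hKG htK)
  have h5 : wdiv a f t = wdiv a w t - wdiv a (fun x => ε * gauss γ m x) t :=
    wdiv_sub a hw seg ht0
  rw [h5, h2] at h1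
  have : 0 < ε * wdiv a (gauss γ m) t := by positivity
  linarith

lemma isPreconnected_punctured_ball (hn : 2 ≤ n) (l : ℝ) :
    IsPreconnected {x : Euc n | x ≠ 0 ∧ ‖x‖ < l} := by
  have hr : 1 < Module.rank ℝ (Euc n) := by
    rw [← Module.finrank_eq_rank, finrank_euclideanSpace_fin]
    exact_mod_cast hn
  have := ((isPreconnected_Ioo (a := (0 : ℝ)) (b := l)).prod
    (isPreconnected_sphere hr (0 : Euc n) 1)).image (fun q => q.1 • q.2)
    (continuous_fst.smul continuous_snd).continuousOn
  convert this using 1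
  ext x
  simp only [Set.mem_ofPred_eq, Set.mem_image, Set.mem_prod, Set.mem_Ioo, Prod.exists,
    mem_sphere_zero_iff_norm]
  constructor
  · rintro ⟨hx, hl⟩
    have h0 : 0 < ‖x‖ := norm_pos_iff.mpr hx
    refine ⟨‖x‖, ‖x‖⁻¹ • x, ⟨⟨h0, hl⟩, ?_⟩, ?_⟩
    · rw [norm_smul, norm_inv, norm_norm, inv_mul_cancel₀ h0.ne']
    · rw [smul_smul, mul_inv_cancel₀ h0.ne', one_smul]
  · rintro ⟨r, y, ⟨⟨h0, hl⟩, hy⟩, rfl⟩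
    have hy0 : y ≠ 0 := by rintro rfl; simp at hy
    refine ⟨smul_ne_zero h0.ne' hy0, ?_⟩
    rwa [norm_smul, hy, mul_one, Real.norm_of_nonneg h0.le]

lemma strong_maximum {G : Set (Euc n)} (hG : IsOpen G) (hGc : IsPreconnected G)
    (h0 : (0 : Euc n) ∉ G) (hw : ContDiffOn ℝ 2 w {0}ᶜ) (hw0 : ∀ x ∈ G, 0 ≤ w x)
    (hL : ∀ x ∈ G, wdiv a w x ≤ 0) : (∀ x ∈ G, w x = 0) ∨ ∀ x ∈ G, 0 < w x := by
  have hGs : G ⊆ {0}ᶜ := fun x hx h => h0 (h ▸ hx)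
  by_cases h : ∃ x ∈ G, w x = 0
  · left
    obtain ⟨x₀, hx₀, hz⟩ := h
    have o1 : IsOpen (G ∩ w ⁻¹' Set.Ioi 0) :=
      (hw.continuousOn.mono hGs).isOpen_inter_preimage hG isOpen_Ioi
    have o2 : IsOpen (G ∩ w ⁻¹' {0}) := isOpen_iff_mem_nhds.mpr fun x hx =>
      inter_mem (hG.mem_nhds hx.1)
        (eventually_eq_zero_of_wdiv_nonpos hG h0 hw hw0 hL hx.1 hx.2)
    have hsub := hGc.subset_left_of_subset_union o2 o1 ?_ ?_ ⟨x₀, hx₀, hx₀, hz⟩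
    · exact fun x hx => (hsub hx).2
    · rw [Set.disjoint_left]
      rintro x ⟨_, hx⟩ ⟨_, hx'⟩
      exact (ne_of_gt hx') hx
    · intro x hx
      rcases (hw0 x hx).eq_or_lt with h | h
      · exact Or.inl ⟨hx, h.symm⟩
      · exact Or.inr ⟨hx, h⟩
  · right
    push Not at h
    exact fun x hx => (hw0 x hx).lt_of_ne (h x hx).symm

lemma react_mono (hp : 2 < p) (hν : 0 < ν) (hα : 1 < α) (hβ : 1 < β) {s t s' t' : ℝ} (hs : 0 < s)
    (ht : 0 < t) (hss : s ≤ s') (htt : t ≤ t') : react p ν α β s t ≤ react p ν α β s' t' := by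
  have : 0 < s' := hs.trans_le hss
  unfold react
  gcongr
  all_goals linarith

lemma react_right_inj (hν : 0 < ν) (hα : 1 < α) (hβ : 1 < β) {s t t' : ℝ} (hs : 0 < s)
    (ht : 0 < t) (ht' : 0 < t') (h : react p ν α β s t = react p ν α β s t') : t = t' := by
  unfold react at h
  have h1 : 0 < ν * α * s ^ (α - 1) := by positivity
  have h2 : t ^ β = t' ^ β := mul_left_cancel₀ h1.ne' (by linarith)
  exact (Real.rpow_left_inj ht.le ht'.le (by linarith)).mp h2

/-- Two ordered solutions on a punctured ball either coincide or are strictly ordered. -/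
lemma Sol.eq_or_lt (P : Params n a b p k ν α β) (h : Sol a b p ν α β u v) {U V : Euc n → ℝ}
    (H : Sol a b p ν α β U V) {l : ℝ} (hle : ∀ x, x ≠ 0 → ‖x‖ < l → u x ≤ U x ∧ v x ≤ V x) :
    (∀ x, x ≠ 0 → ‖x‖ < l → u x = U x ∧ v x = V x) ∨
      ∀ x, x ≠ 0 → ‖x‖ < l → u x < U x ∧ v x < V x := by
  set G : Set (Euc n) := {x | x ≠ 0 ∧ ‖x‖ < l} with hGd
  have hG : IsOpen G := isOpen_compl_singleton.inter (isOpen_lt continuous_norm continuous_const)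
  have hGc : IsPreconnected G := isPreconnected_punctured_ball (by linarith [P.hn]) l
  have h0 : (0 : Euc n) ∉ G := fun h => h.1 rfl
  have alt : ∀ {α β : ℝ} {u v U V : Euc n → ℝ}, Params n a b p k ν α β →
      Sol a b p ν α β u v → Sol a b p ν α β U V →
      (∀ x, x ≠ 0 → ‖x‖ < l → u x ≤ U x ∧ v x ≤ V x) →
      (∀ x ∈ G, u x = U x ∧ v x = V x) ∨ ∀ x ∈ G, u x < U x :=
    fun {α β u v U V} P h H hle => by
      have hL : ∀ x ∈ G, wdiv a (fun y => U y - u y) x = ‖x‖ ^ (-(b * p)) *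
          (react p ν α β (u x) (v x) - react p ν α β (U x) (V x)) := fun x hx => by
        rw [wdiv_sub a H.smooth_fst h.smooth_fst hx.1]
        linear_combination h.eq_fst x hx.1 - H.eq_fst x hx.1
      rcases strong_maximum (a := a) hG hGc h0 (H.smooth_fst.sub h.smooth_fst)
        (fun x hx => sub_nonneg.mpr (hle x hx.1 hx.2).1) (fun x hx => by
          rw [hL x hx]
          exact mul_nonpos_of_nonneg_of_nonpos (by positivity) (sub_nonpos.mpr
            (react_mono P.hp P.hν P.hα P.hβ (h.pos_fst x hx.1) (h.pos_snd x hx.1)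
              (hle x hx.1 hx.2).1 (hle x hx.1 hx.2).2))) with hz | hz
      · left
        intro x hx
        have hux : ∀ y ∈ G, u y = U y := fun y hy => (sub_eq_zero.mp (hz y hy)).symm
        refine ⟨hux x hx, ?_⟩
        have hnear : (fun y => U y - u y) =ᶠ[𝓝 x] fun _ => 0 := by
          filter_upwards [hG.mem_nhds hx] with y hy using hz y hy
        have hmin : IsLocalMin (fun y => U y - u y) x := by
          filter_upwards [hnear] with y hy
          exact (hz x hx).trans_le hy.ge
        have hge := wdiv_nonneg_of_isLocalMin a (H.smooth_fst.sub h.smooth_fst) hx.1 hmin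
        rw [hL x hx] at hge
        have hr : 0 < ‖x‖ ^ (-(b * p)) := by
          have : 0 < ‖x‖ := norm_pos_iff.mpr hx.1
          positivity
        have h1 := nonneg_of_mul_nonneg_right hge hr
        have h2 := react_mono P.hp P.hν P.hα P.hβ (h.pos_fst x hx.1) (h.pos_snd x hx.1)
          (hle x hx.1 hx.2).1 (hle x hx.1 hx.2).2
        have h3 : react p ν α β (u x) (v x) = react p ν α β (u x) (V x) := by
          rw [← hux x hx] at h1 h2; linarith
        exact react_right_inj P.hν P.hα P.hβ (h.pos_fst x hx.1) (h.pos_snd x hx.1)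
          (H.pos_snd x hx.1) h3
      · exact Or.inr fun x hx => sub_pos.mp (hz x hx)
  rcases alt P h H hle with h1 | h1
  · exact Or.inl fun x hx hl => h1 x ⟨hx, hl⟩
  rcases alt P.swap h.swap H.swap (fun x hx hl => (hle x hx hl).symm) with h2 | h2
  · exact Or.inl fun x hx hl => (h2 x ⟨hx, hl⟩).symm
  · exact Or.inr fun x hx hl => ⟨h1 x ⟨hx, hl⟩, h2 x ⟨hx, hl⟩⟩

end maximum

section moving

variable {n : ℕ} {a b p ν α β k l m : ℝ} {u v : Euc n → ℝ}

lemma kelvin_invert (hl : 0 < l) (u : Euc n → ℝ) {x : Euc n} (hx : x ≠ 0) :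
    kelvin k l u (invert (l ^ 2) x) = (‖x‖ / l) ^ (2 * k) * u x := by
  have h0 : 0 < ‖x‖ := norm_pos_iff.mpr hx
  have hc : 0 < l ^ 2 := by positivity
  rw [kelvin, invert_invert hc hx, norm_invert hc hx]
  congr 2
  field_simp

lemma le_kelvin_invert_iff (hl : 0 < l) (u : Euc n → ℝ) {x : Euc n} (hx : x ≠ 0) :
    u (invert (l ^ 2) x) ≤ kelvin k l u (invert (l ^ 2) x) ↔ kelvin k l u x ≤ u x := by
  have h0 : 0 < ‖x‖ := norm_pos_iff.mpr hx
  have h1 : 0 < (l / ‖x‖) ^ (2 * k) := by positivity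
  have h2 : (l / ‖x‖) ^ (2 * k) * (‖x‖ / l) ^ (2 * k) = 1 := by
    rw [← Real.mul_rpow (by positivity) (by positivity), show l / ‖x‖ * (‖x‖ / l) = 1 by
      field_simp, Real.one_rpow]
  rw [kelvin_invert hl u hx, ← mul_le_mul_iff_right₀ h1, ← mul_assoc, h2, one_mul, kelvin]

lemma kelvin_of_norm_eq (hl : 0 < l) (u : Euc n → ℝ) {x : Euc n} (hx : ‖x‖ = l) :
    kelvin k l u x = u x := by
  rw [kelvin, invert, hx, div_self hl.ne', Real.one_rpow, one_mul, div_self (by positivity),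
    one_smul]

lemma eq_kelvin_of_inner_of_outer (hl : 0 < l)
    (hi : ∀ x, x ≠ 0 → ‖x‖ < l → u x ≤ kelvin k l u x)
    (ho : ∀ x, x ≠ 0 → l < ‖x‖ → u x ≤ kelvin k l u x) {x : Euc n} (hx : x ≠ 0) :
    kelvin k l u x = u x := by
  have h0 : 0 < ‖x‖ := norm_pos_iff.mpr hx
  have hc : 0 < l ^ 2 := by positivity
  have hJ := invert_ne_zero hc hx
  rcases lt_trichotomy ‖x‖ l with h | h | h
  · refine le_antisymm ((le_kelvin_invert_iff hl u hx).mp (ho _ hJ ?_)) (hi x hx h)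
    rw [norm_invert hc hx, lt_div_iff₀ h0]
    nlinarith
  · exact kelvin_of_norm_eq hl u h
  · refine le_antisymm ((le_kelvin_invert_iff hl u hx).mp (hi _ hJ ?_)) (ho x hx h)
    rw [norm_invert hc hx, div_lt_iff₀ h0]
    nlinarith

lemma eq_kelvin_of_inner (hl : 0 < l) (hi : ∀ x, x ≠ 0 → ‖x‖ < l → u x = kelvin k l u x)
    {x : Euc n} (hx : x ≠ 0) : kelvin k l u x = u x := by
  refine eq_kelvin_of_inner_of_outer hl (fun y hy h => (hi y hy h).le) (fun y hy h => ?_) hx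
  have h0 : 0 < ‖y‖ := norm_pos_iff.mpr hy
  have hc : 0 < l ^ 2 := by positivity
  have hJ := invert_ne_zero hc hy
  have := (le_kelvin_invert_iff (k := k) hl u hJ).mpr (hi _ hJ (by
    rw [norm_invert hc hy, div_lt_iff₀ h0]
    nlinarith)).ge
  rwa [invert_invert hc hy] at this

lemma continuousAt_kelvin (hu : ContinuousOn u {0}ᶜ) (hl : 0 < l) {x : Euc n} (hx : x ≠ 0) :
    ContinuousAt (fun l => kelvin k l u x) l := by
  have h0 : 0 < ‖x‖ := norm_pos_iff.mpr hx
  have h1 : ContinuousAt (fun l : ℝ => invert (l ^ 2) x) l :=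
    (((continuous_pow 2).div_const _).smul continuous_const).continuousAt
  have h2 : ContinuousAt u (invert (l ^ 2) x) := hu.continuousAt
    (isOpen_compl_singleton.mem_nhds (invert_ne_zero (by positivity) hx))
  have h3 : ContinuousAt (fun l : ℝ => (l / ‖x‖) ^ (2 * k)) l :=
    (continuous_id.div_const _).continuousAt.rpow_const (Or.inl (div_pos hl h0).ne')
  exact h3.mul (ContinuousAt.comp (f := fun l : ℝ => invert (l ^ 2) x) h2 h1)

lemma scaling_of_kelvin (hl : 0 < l) (hm : 0 < m) (h1 : ∀ x, x ≠ 0 → kelvin k l u x = u x)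
    (h2 : ∀ x, x ≠ 0 → kelvin k m u x = u x) {x : Euc n} (hx : x ≠ 0) :
    u x = (m / l) ^ (2 * k) * u ((m / l) ^ 2 • x) := by
  have h0 : 0 < ‖x‖ := norm_pos_iff.mpr hx
  have hc : 0 < l ^ 2 := by positivity
  have e : invert (m ^ 2) (invert (l ^ 2) x) = (m / l) ^ 2 • x := by
    rw [invert, norm_invert hc hx, invert, smul_smul]
    congr 1
    field_simp
  conv_lhs => rw [← h1 x hx, kelvin, ← h2 _ (invert_ne_zero hc hx), kelvin, e, norm_invert hc hx,
    ← mul_assoc, ← Real.mul_rpow (by positivity) (by positivity)]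
  congr 2
  field_simp

/-- A function with integrable weighted square is not invariant under a dilation. -/
lemma not_scaling (hn : 0 < n) (hk : 2 * k = n - 2 - 2 * a)
    (hu0 : ∀ x, x ≠ 0 → 0 < u x)
    (iu : Integrable fun x : Euc n => ‖x‖ ^ (-(2 * a) - 2) * u x ^ 2) {ρ : ℝ} (hρ : 1 < ρ)
    (h : ∀ x, x ≠ 0 → u x = ρ ^ (2 * k) * u (ρ ^ 2 • x)) : False := by
  have hρ0 : 0 < ρ := by linarith
  set g : Euc n → ℝ := fun x => ‖x‖ ^ (-(2 * a) - 2) * u x ^ 2 with hg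
  have hgs : ∀ x, x ≠ 0 → g (ρ ^ 2 • x) = ((ρ ^ 2) ^ n)⁻¹ * g x := fun x hx => by
    have h0 : 0 < ‖x‖ := norm_pos_iff.mpr hx
    simp only [hg]
    rw [h x hx, norm_smul, Real.norm_of_nonneg (by positivity),
      Real.mul_rpow (by positivity) h0.le]
    have e : (ρ ^ 2) ^ (-(2 * a) - 2) = ((ρ ^ 2) ^ n)⁻¹ * (ρ ^ (2 * k)) ^ 2 := by
      rw [← Real.rpow_natCast (ρ ^ 2) n, ← Real.rpow_neg (by positivity), ← Real.rpow_natCast ρ 2,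
        ← Real.rpow_natCast _ 2, ← Real.rpow_mul hρ0.le, ← Real.rpow_mul hρ0.le,
        ← Real.rpow_mul hρ0.le, ← Real.rpow_add hρ0]
      congr 1
      push_cast
      linarith
    rw [e]
    ring
  have g0 : ∀ x, 0 ≤ g x := fun x => by positivity
  have key := Measure.integral_comp_smul_of_nonneg (volume : Measure (Euc n))
    ((Metric.ball (0 : Euc n) 1).indicator g) (ρ ^ 2) (hR := by positivity)
  rw [finrank_euclideanSpace_fin] at key
  have e1 : (fun x => (Metric.ball (0 : Euc n) 1).indicator g (ρ ^ 2 • x)) =ᵐ[volume]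
      fun x => ((ρ ^ 2) ^ n)⁻¹ * (Metric.ball (0 : Euc n) (1 / ρ ^ 2)).indicator g x := by
    filter_upwards [ae_ne_zero hn] with x hx
    have hiff : ρ ^ 2 • x ∈ Metric.ball (0 : Euc n) 1 ↔ x ∈ Metric.ball (0 : Euc n) (1 / ρ ^ 2) := by
      rw [mem_ball_zero_iff, mem_ball_zero_iff, norm_smul, Real.norm_of_nonneg (by positivity),
        lt_div_iff₀ (by positivity), mul_comm]
    by_cases hb : x ∈ Metric.ball (0 : Euc n) (1 / ρ ^ 2)
    · rw [Set.indicator_of_mem (hiff.mpr hb), Set.indicator_of_mem hb, hgs x hx]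
    · rw [Set.indicator_of_notMem (hiff.not.mpr hb), Set.indicator_of_notMem hb, mul_zero]
  rw [integral_congr_ae e1, integral_const_mul, smul_eq_mul,
    integral_indicator measurableSet_ball, integral_indicator measurableSet_ball] at key
  have key2 := mul_left_cancel₀ (by positivity) key
  have hlt : 1 / ρ ^ 2 < 1 := by
    rw [div_lt_one (by positivity)]; nlinarith
  have hsub : Metric.ball (0 : Euc n) (1 / ρ ^ 2) ⊆ Metric.ball 0 1 := Metric.ball_subset_ball hlt.le
  have h3 := setIntegral_sdiff (μ := volume) measurableSet_ball iu.integrableOn hsub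
  rw [show (∫ x in Metric.ball (0 : Euc n) 1, g x) = ∫ x in Metric.ball (0 : Euc n) (1 / ρ ^ 2), g x
    from key2.symm, sub_self] at h3
  have h4 := (setIntegral_eq_zero_iff_of_nonneg_ae (ae_of_all _ g0) iu.integrableOn).mp h3
  set r := (1 / ρ ^ 2 + 1) / 2 with hr
  have hr0 : 0 < r := by positivity
  have hr1 : 1 / ρ ^ 2 < r := by rw [hr]; linarith
  have hr2 : r < 1 := by rw [hr]; linarith
  set O : Set (Euc n) := {x | 1 / ρ ^ 2 < ‖x‖ ∧ ‖x‖ < 1} with hO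
  have hOo : IsOpen O := (isOpen_lt continuous_const continuous_norm).inter
    (isOpen_lt continuous_norm continuous_const)
  have hOn : O.Nonempty := by
    refine ⟨r • EuclideanSpace.single ⟨0, hn⟩ 1, ?_⟩
    have : ‖r • (EuclideanSpace.single ⟨0, hn⟩ 1 : Euc n)‖ = r := by
      rw [norm_smul, Real.norm_of_nonneg hr0.le]; simp
    rw [hO, Set.mem_ofPred_eq, this]
    exact ⟨hr1, hr2⟩
  have hOsub : O ⊆ Metric.ball (0 : Euc n) 1 \ Metric.ball 0 (1 / ρ ^ 2) := fun x hx => by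
    rw [Set.mem_sdiff, mem_ball_zero_iff, mem_ball_zero_iff]
    exact ⟨hx.2, not_lt.mpr hx.1.le⟩
  have h5 := ae_mono (Measure.restrict_mono hOsub le_rfl) h4
  have h6 := (ae_restrict_iff' hOo.measurableSet).mp h5
  have h7 : volume O = 0 := by
    refine measure_mono_null (fun x hx => ?_) (ae_iff.mp h6)
    have hx0 : 0 < ‖x‖ := lt_trans (by positivity) hx.1
    have := hu0 x (norm_pos_iff.mp hx0)
    have hgx : 0 < g x := by simp only [hg]; positivity
    rw [Set.mem_ofPred_eq, Classical.not_imp]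
    exact ⟨hx, hgx.ne'⟩
  exact (hOo.measure_pos volume hOn).ne' h7

lemma tendsto_setIntegral_zero {ι : Type*} {L : Filter ι} [L.IsCountablyGenerated]
    {F : Euc n → ℝ} (hF : Integrable F) {A : ι → Set (Euc n)} (hA : ∀ i, MeasurableSet (A i))
    (h : ∀ᵐ x, ∀ᶠ i in L, x ∉ A i) : Tendsto (fun i => ∫ x in A i, F x) L (𝓝 0) := by
  have e : (fun i => ∫ x in A i, F x) = fun i => ∫ x, (A i).indicator F x := by
    funext i; rw [integral_indicator (hA i)]
  rw [e, ← integral_zero (Euc n) ℝ (μ := volume)]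
  refine tendsto_integral_filter_of_dominated_convergence (fun x => ‖F x‖)
    (Eventually.of_forall fun i => hF.aestronglyMeasurable.indicator (hA i))
    (Eventually.of_forall fun i => ae_of_all _ fun x => norm_indicator_le_norm_self _ _)
    hF.norm ?_
  filter_upwards [h] with x hx
  exact tendsto_const_nhds.congr' (hx.mono fun i hi => (Set.indicator_of_notMem hi F).symm)

lemma Sol.measurableSet_bad (h : Sol a b p ν α β u v) {U V : Euc n → ℝ}
    (H : Sol a b p ν α β U V) {Ω : Set (Euc n)} (hΩ : IsOpen Ω) :
    MeasurableSet {x | x ∈ Ω ∧ x ≠ 0 ∧ (U x < u x ∨ V x < v x)} := by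
  have h1 := (h.smooth_fst.continuousOn.sub H.smooth_fst.continuousOn).isOpen_inter_preimage
    isOpen_compl_singleton (isOpen_Ioi (a := (0 : ℝ)))
  have h2 := (h.smooth_snd.continuousOn.sub H.smooth_snd.continuousOn).isOpen_inter_preimage
    isOpen_compl_singleton (isOpen_Ioi (a := (0 : ℝ)))
  convert (hΩ.inter (h1.union h2)).measurableSet using 1
  ext x
  simp only [Set.mem_inter_iff, Set.mem_union, Set.mem_ofPred_eq, Set.mem_Ioi,
    Set.mem_compl_iff, Set.mem_singleton_iff, Set.mem_preimage, Pi.sub_apply, sub_pos]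
  tauto

/-- The radius of symmetry found by moving the sphere of inversion. -/
lemma Sol.exists_radius (P : Params n a b p k ν α β) (h : Sol a b p ν α β u v)
    (hEu : finiteEnergy a u) (hEv : finiteEnergy a v) : ∃ τ : ℝ, 0 < τ ∧
      (∀ x, x ≠ 0 → kelvin k τ u x = u x ∧ kelvin k τ v x = v x) ∧
      ∀ l, 0 < l → l < τ → ∀ x, x ≠ 0 → ‖x‖ < l →
        u x < kelvin k l u x ∧ v x < kelvin k l v x := by
  have hn := P.pos
  have hp1 : 1 < p := by linarith [P.hp]
  have su := h.supersol P.hν.le (by linarith [P.hα]) hEu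
  have sv := h.swap.supersol P.hν.le (by linarith [P.hβ]) hEv
  have cu := h.smooth_fst.continuousOn
  have cv := h.smooth_snd.continuousOn
  have iF := integrable_sum_critExp P.hn cu cv h.pos_fst h.pos_snd
    (su.integrable_critExp P.hn P.hk P.hk0 hp1 P.hbp)
    (sv.integrable_critExp P.hn P.hk P.hk0 hp1 P.hbp)
  obtain ⟨ε, hε, hcomp⟩ := h.exists_comparison P hEu hEv
  set F : Euc n → ℝ := fun x => (‖x‖ ^ (-a) * (u x + v x)) ^ critExp n with hF
  have F0 : 0 ≤ᵐ[volume] F := by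
    filter_upwards [ae_ne_zero hn] with x hx
    have := h.pos_fst x hx
    have := h.pos_snd x hx
    simp only [hF, Pi.zero_apply]
    positivity
  have hmono : ∀ {A B : Set (Euc n)}, A ⊆ B → ∫ x in A, F x ≤ ∫ x in B, F x := fun hAB =>
    setIntegral_mono_set iF.integrableOn (ae_restrict_of_ae F0) hAB.eventuallyLE
  set inner : ℝ → Prop := fun l => ∀ x, x ≠ 0 → ‖x‖ < l →
    u x ≤ kelvin k l u x ∧ v x ≤ kelvin k l v x with hinner
  set outer : ℝ → Prop := fun l => ∀ x, x ≠ 0 → l < ‖x‖ →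
    u x ≤ kelvin k l u x ∧ v x ≤ kelvin k l v x with houter
  set bad : ℝ → Set (Euc n) := fun l => {x | x ∈ Metric.ball (0 : Euc n) l ∧ x ≠ 0 ∧
    (kelvin k l u x < u x ∨ kelvin k l v x < v x)} with hbad
  have inner_of : ∀ l, 0 < l → ∫ x in bad l, F x < ε → inner l := fun l hl hi x hx hxl => by
    refine hcomp _ _ (h.kelvinTransform P hl) (Metric.ball 0 l) Metric.isOpen_ball (fun y hy _ => ?_)
      hi x (mem_ball_zero_iff.mpr hxl) hx
    rw [frontier_ball _ hl.ne', mem_sphere_zero_iff_norm] at hy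
    exact ⟨(kelvin_of_norm_eq hl u hy).symm, (kelvin_of_norm_eq hl v hy).symm⟩
  have outer_of : ∀ l, 0 < l → ∫ x in {x | l < ‖x‖}, F x < ε → outer l := fun l hl hi x hx hxl => by
    have hΩ : IsOpen {x : Euc n | l < ‖x‖} := isOpen_lt continuous_const continuous_norm
    refine hcomp _ _ (h.kelvinTransform P hl) {x | l < ‖x‖} hΩ (fun y hy _ => ?_)
      ((hmono fun y hy => hy.1).trans_lt hi) x hxl hx
    have hy' : ‖y‖ = l := (frontier_lt_subset_eq continuous_const continuous_norm hy).symm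
    exact ⟨(kelvin_of_norm_eq hl u hy').symm, (kelvin_of_norm_eq hl v hy').symm⟩
  have small : ∀ᶠ l in 𝓝[>] (0 : ℝ), inner l := by
    have ht : Tendsto (fun l => ∫ x in Metric.ball (0 : Euc n) l, F x) (𝓝[>] (0 : ℝ)) (𝓝 0) := by
      refine tendsto_setIntegral_zero iF (fun _ => measurableSet_ball) ?_
      filter_upwards [ae_ne_zero hn] with x hx
      have h0 : 0 < ‖x‖ := norm_pos_iff.mpr hx
      filter_upwards [nhdsWithin_le_nhds (Iio_mem_nhds h0)] with l hl
      rw [mem_ball_zero_iff]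
      exact not_lt.mpr (le_of_lt hl)
    filter_upwards [ht.eventually (gt_mem_nhds hε), self_mem_nhdsWithin] with l hl hl0
    exact inner_of l hl0 ((hmono fun y hy => hy.1).trans_lt hl)
  have large : ∀ᶠ l in atTop, outer l := by
    have ht : Tendsto (fun l : ℝ => ∫ x in {x : Euc n | l < ‖x‖}, F x) atTop (𝓝 0) := by
      refine tendsto_setIntegral_zero iF
        (fun l => (isOpen_lt continuous_const continuous_norm).measurableSet) ?_
      refine ae_of_all _ fun x => ?_
      filter_upwards [eventually_ge_atTop ‖x‖] with l hl
      exact not_lt.mpr hl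
    filter_upwards [ht.eventually (gt_mem_nhds hε), eventually_gt_atTop 0] with l hl hl0
    exact outer_of l hl0 hl
  have iu2 := su.integrable_sq hn P.hk P.hk0 hp1 P.hbp
  have unique : ∀ l m, 0 < l → l < m → (∀ x, x ≠ 0 → kelvin k l u x = u x) →
      ¬ ∀ x, x ≠ 0 → kelvin k m u x = u x := fun l m hl hlm h1 h2 =>
    not_scaling hn P.hk h.pos_fst iu2 ((one_lt_div hl).mpr hlm)
      fun x hx => scaling_of_kelvin hl (hl.trans hlm) h1 h2 hx
  set S : Set ℝ := {l | 0 < l ∧ ∀ m, 0 < m → m ≤ l → inner m} with hS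
  have hSn : S.Nonempty := by
    obtain ⟨δ, hδ, hδs⟩ := mem_nhdsGT_iff_exists_Ioc_subset.mp small
    exact ⟨δ, hδ, fun m hm hml => hδs ⟨hm, hml⟩⟩
  obtain ⟨Λ, hΛ0, hΛ⟩ : ∃ Λ : ℝ, 0 < Λ ∧ ∀ l, Λ ≤ l → outer l := by
    obtain ⟨Λ, hΛ⟩ := eventually_atTop.mp large
    exact ⟨max Λ 1, by positivity, fun l hl => hΛ l ((le_max_left _ _).trans hl)⟩
  have hSb : ∀ l ∈ S, l ≤ Λ := fun l hl => by
    by_contra! hlt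
    refine unique Λ l hΛ0 hlt (fun x hx => ?_) fun x hx => ?_
    · exact eq_kelvin_of_inner_of_outer hΛ0 (fun y hy hyl => (hl.2 Λ hΛ0 hlt.le y hy hyl).1)
        (fun y hy hyl => (hΛ Λ le_rfl y hy hyl).1) hx
    · exact eq_kelvin_of_inner_of_outer hl.1 (fun y hy hyl => (hl.2 l hl.1 le_rfl y hy hyl).1)
        (fun y hy hyl => (hΛ l hlt.le y hy hyl).1) hx
  have hSb' : BddAbove S := ⟨Λ, hSb⟩
  set τ := sSup S with hτ
  have hτ0 : 0 < τ := by
    obtain ⟨l, hl⟩ := hSn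
    exact hl.1.trans_le (le_csSup hSb' hl)
  have hlt : ∀ m, 0 < m → m < τ → inner m := fun m hm hmτ => by
    obtain ⟨l, hl, hml⟩ := exists_lt_of_lt_csSup hSn hmτ
    exact hl.2 m hm hml.le
  have hinτ : inner τ := fun x hx hxτ => by
    have hev : ∀ᶠ m in 𝓝[<] τ, u x ≤ kelvin k m u x ∧ v x ≤ kelvin k m v x := by
      filter_upwards [Ioo_mem_nhdsLT hxτ] with m hm
      exact hlt m ((norm_nonneg x).trans_lt hm.1) hm.2 x hx hm.1
    exact ⟨ge_of_tendsto ((continuousAt_kelvin cu hτ0 hx).mono_left nhdsWithin_le_nhds)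
        (hev.mono fun _ h => h.1),
      ge_of_tendsto ((continuousAt_kelvin cv hτ0 hx).mono_left nhdsWithin_le_nhds)
        (hev.mono fun _ h => h.2)⟩
  have hEq : ∀ x, x ≠ 0 → ‖x‖ < τ → u x = kelvin k τ u x ∧ v x = kelvin k τ v x := by
    rcases h.eq_or_lt P (h.kelvinTransform P hτ0) hinτ with hh | hh
    · exact hh
    exfalso
    have ht : Tendsto (fun l => ∫ x in bad (max l (τ / 2)), F x) (𝓝 τ) (𝓝 0) := by
      refine tendsto_setIntegral_zero iF (fun l => h.measurableSet_bad
        (h.kelvinTransform P (lt_max_of_lt_right (by positivity))) Metric.isOpen_ball) ?_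
      have hsph : ∀ᵐ x : Euc n, ‖x‖ ≠ τ := by
        rw [ae_iff]
        refine measure_mono_null (fun x hx => ?_)
          (Measure.addHaar_sphere_of_ne_zero volume 0 hτ0.ne')
        rw [Set.mem_ofPred_eq, not_not] at hx
        exact mem_sphere_zero_iff_norm.mpr hx
      filter_upwards [ae_ne_zero hn, hsph] with x hx hxτ
      have hhalf : ∀ᶠ l in 𝓝 τ, max l (τ / 2) = l := by
        filter_upwards [lt_mem_nhds (half_lt_self hτ0)] with l hl using max_eq_left (le_of_lt hl)
      rcases lt_or_gt_of_ne hxτ with hlt | hlt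
      · obtain ⟨h1, h2⟩ := hh x hx hlt
        filter_upwards [hhalf, (continuousAt_kelvin (k := k) cu hτ0 hx).eventually (lt_mem_nhds h1),
          (continuousAt_kelvin (k := k) cv hτ0 hx).eventually (lt_mem_nhds h2)] with l hl h3 h4
        rw [hl]
        rintro ⟨-, -, h5 | h5⟩
        · exact lt_asymm h3 h5
        · exact lt_asymm h4 h5
      · filter_upwards [hhalf, gt_mem_nhds hlt] with l hl h3
        rw [hl]
        rintro ⟨h5, -⟩
        rw [mem_ball_zero_iff] at h5
        exact lt_asymm h3 h5
    obtain ⟨δ, hδ, hδs⟩ := Metric.eventually_nhds_iff.mp (ht.eventually (gt_mem_nhds hε))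
    have hmem : τ + δ / 2 ∈ S := by
      refine ⟨by positivity, fun m hm hml => ?_⟩
      rcases lt_or_ge m τ with hmτ | hmτ
      · exact hlt m hm hmτ
      · refine inner_of m hm ?_
        have := hδs (y := m) (by rw [Real.dist_eq, abs_of_nonneg (by linarith)]; linarith)
        rwa [max_eq_left (by linarith)] at this
    have := le_csSup hSb' hmem
    linarith
  have hKτ : ∀ x, x ≠ 0 → kelvin k τ u x = u x ∧ kelvin k τ v x = v x := fun x hx =>
    ⟨eq_kelvin_of_inner hτ0 (fun y hy hyl => (hEq y hy hyl).1) hx,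
      eq_kelvin_of_inner hτ0 (fun y hy hyl => (hEq y hy hyl).2) hx⟩
  refine ⟨τ, hτ0, hKτ, fun l hl hlτ => ?_⟩
  rcases h.eq_or_lt P (h.kelvinTransform P hl) (hlt l hl hlτ) with hh | hh
  · exact absurd (fun x hx => (hKτ x hx).1) (unique l τ hl hlτ fun x hx =>
      eq_kelvin_of_inner hl (fun y hy hyl => (hh y hy hyl).1) hx)
  · exact hh

end moving

section emden

variable {n : ℕ} {a b p k ν α β τ : ℝ} {u v w : Euc n → ℝ}

lemma kelvin_smul (hτ : 0 < τ) {x : Euc n} (hx : x ≠ 0) :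
    kelvin k τ w (τ • x) = ‖x‖ ^ (-(2 * k)) * w (τ • (‖x‖ ^ 2)⁻¹ • x) := by
  have h0 : 0 < ‖x‖ := norm_pos_iff.mpr hx
  rw [kelvin, invert, norm_smul, Real.norm_of_nonneg hτ.le, smul_smul, smul_smul]
  congr 1
  · rw [show τ / (τ * ‖x‖) = ‖x‖⁻¹ by field_simp, Real.inv_rpow h0.le, Real.rpow_neg h0.le]
  · congr 2
    field_simp

lemma rescaled_inversion (hτ : 0 < τ) (h : ∀ x, x ≠ 0 → kelvin k τ w x = w x) {x : Euc n}
    (hx : x ≠ 0) :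
    τ ^ k * w (τ • (‖x‖ ^ 2)⁻¹ • x) = ‖x‖ ^ (2 * k) * (τ ^ k * w (τ • x)) := by
  have h0 : 0 < ‖x‖ := norm_pos_iff.mpr hx
  have e : ‖x‖ ^ (2 * k) * ‖x‖ ^ (-(2 * k)) = 1 := by rw [← Real.rpow_add h0]; simp
  rw [← h (τ • x) (smul_ne_zero hτ.ne' hx), kelvin_smul hτ hx]
  linear_combination (-(τ ^ k * w (τ • (‖x‖ ^ 2)⁻¹ • x))) * e

lemma emdenFowler_even (hτ : 0 < τ) (h : ∀ x, x ≠ 0 → kelvin k τ w x = w x) {e : Euc n}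
    (he : ‖e‖ = 1) (t : ℝ) :
    Real.exp (-k * -t) * (τ ^ k * w (τ • Real.exp (- -t) • e)) =
      Real.exp (-k * t) * (τ ^ k * w (τ • Real.exp (-t) • e)) := by
  have he0 : e ≠ 0 := norm_pos_iff.mp (he ▸ one_pos)
  have hne : ‖Real.exp (-t) • e‖ = Real.exp (-t) := by
    rw [norm_smul, Real.norm_of_nonneg (Real.exp_pos _).le, he, mul_one]
  have key := rescaled_inversion hτ h (smul_ne_zero (Real.exp_pos (-t)).ne' he0)
  rw [hne, smul_smul (Real.exp (-t) ^ 2)⁻¹, ← Real.exp_mul,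
    show (Real.exp (-t) ^ 2)⁻¹ * Real.exp (-t) = Real.exp (- -t) by
      rw [← Real.exp_nat_mul, ← Real.exp_neg, ← Real.exp_add]; congr 1; push_cast; ring] at key
  rw [key, ← mul_assoc, ← Real.exp_add]
  congr 2
  ring

lemma emdenFowler_strictAntiOn (hτ : 0 < τ)
    (h : ∀ l, 0 < l → l < τ → ∀ x, x ≠ 0 → ‖x‖ < l → w x < kelvin k l w x) {e : Euc n}
    (he : ‖e‖ = 1) :
    StrictAntiOn (fun t => Real.exp (-k * t) * (τ ^ k * w (τ • Real.exp (-t) • e)))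
      (Set.Ioi 0) := by
  intro s hs t _ hst
  have hs0 : 0 < s := hs
  have he0 : e ≠ 0 := norm_pos_iff.mp (he ▸ one_pos)
  set l := τ * Real.exp (-((s + t) / 2)) with hl
  have hl0 : 0 < l := by positivity
  have hnx : ‖τ • Real.exp (-t) • e‖ = τ * Real.exp (-t) := by
    rw [norm_smul, norm_smul, Real.norm_of_nonneg (Real.exp_pos _).le,
      Real.norm_of_nonneg hτ.le, he, mul_one]
  have key := h l hl0 (mul_lt_of_lt_one_right hτ (Real.exp_lt_one_iff.mpr (by linarith)))
    (τ • Real.exp (-t) • e) (smul_ne_zero hτ.ne' (smul_ne_zero (Real.exp_pos _).ne' he0)) (by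
      rw [hnx, hl]
      gcongr
      linarith)
  have e1 : l / (τ * Real.exp (-t)) = Real.exp ((t - s) / 2) := by
    rw [hl, mul_div_mul_left _ _ hτ.ne', ← Real.exp_sub]; congr 1; ring
  have e2 : l ^ 2 / (τ * Real.exp (-t)) ^ 2 * (τ * Real.exp (-t)) = τ * Real.exp (-s) := by
    rw [← div_pow, e1, ← Real.exp_nat_mul, mul_left_comm, ← Real.exp_add]
    congr 2; push_cast; ring
  rw [kelvin, invert, hnx, e1, smul_smul, smul_smul, e2, ← Real.exp_mul] at key
  have e3 : Real.exp (-k * t) * Real.exp ((t - s) / 2 * (2 * k)) = Real.exp (-k * s) := by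
    rw [← Real.exp_add]; congr 1; ring
  calc Real.exp (-k * t) * (τ ^ k * w (τ • Real.exp (-t) • e))
      < Real.exp (-k * t) * (τ ^ k *
        (Real.exp ((t - s) / 2 * (2 * k)) * w ((τ * Real.exp (-s)) • e))) := by
        rw [smul_smul]; gcongr
    _ = Real.exp (-k * s) * (τ ^ k * w (τ • Real.exp (-s) • e)) := by
        rw [smul_smul, ← e3]; ring

lemma params_of_exponents (hn : 3 ≤ n) (ha : a < ((n : ℝ) - 2) / 2) (hab : a ≤ b) (hba : b < a + 1)
    (hp : p = 2 * (n : ℝ) / ((n : ℝ) - 2 + 2 * (b - a))) (hν : 0 < ν) (hα : 1 < α) (hβ : 1 < β)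
    (hαβ : α + β = p) : Params n a b p (((n : ℝ) - 2 - 2 * a) / 2) ν α β := by
  have hn' : (3 : ℝ) ≤ n := by exact_mod_cast hn
  have hd : 0 < (n : ℝ) - 2 + 2 * (b - a) := by linarith
  have hpd : p * ((n : ℝ) - 2 + 2 * (b - a)) = 2 * n := by rw [hp]; field_simp
  refine ⟨hn, by ring, by linarith, ?_, ?_, by linear_combination hpd / 2, hν, hα, hβ, hαβ⟩
  · rw [hp, lt_div_iff₀ hd]; linarith
  · rw [hp, critExp]
    exact div_le_div_of_nonneg_left (by linarith) (by linarith) (by linarith)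

end emden

theorem stmt {n : ℕ} (hn : 3 ≤ n) (a b p ν α β : ℝ)
    (ha0 : 0 ≤ a) (ha : a < ((n:ℝ)-2)/2) (hb0 : 0 < b) (hab : a ≤ b) (hba : b < a + 1)
    (hp : p = 2*(n:ℝ)/((n:ℝ)-2+2*(b-a))) (hν : 0 < ν) (hα : 1 < α) (hβ : 1 < β)
    (hαβ : α + β = p)
    (u v : EuclideanSpace ℝ (Fin n) → ℝ)
    (hu : ContDiffOn ℝ 2 u {0}ᶜ) (hv : ContDiffOn ℝ 2 v {0}ᶜ)
    (hupos : ∀ x : EuclideanSpace ℝ (Fin n), x ≠ 0 → 0 < u x)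
    (hvpos : ∀ x : EuclideanSpace ℝ (Fin n), x ≠ 0 → 0 < v x)
    (hueq : ∀ x : EuclideanSpace ℝ (Fin n), x ≠ 0 →
      -(wdiv a u x) = ‖x‖ ^ (-(b*p)) * (u x ^ (p-1) + ν*α * u x ^ (α-1) * v x ^ β))
    (hveq : ∀ x : EuclideanSpace ℝ (Fin n), x ≠ 0 →
      -(wdiv a v x) = ‖x‖ ^ (-(b*p)) * (v x ^ (p-1) + ν*β * u x ^ α * v x ^ (β-1)))
    (hEu : finiteEnergy a u) (hEv : finiteEnergy a v) :
    ∃ τ : ℝ, 0 < τ ∧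
      ∀ ut vt : EuclideanSpace ℝ (Fin n) → ℝ,
        ut = (fun x => τ ^ (((n:ℝ)-2-2*a)/2) * u (τ • x)) →
        vt = (fun x => τ ^ (((n:ℝ)-2-2*a)/2) * v (τ • x)) →
        ((∀ x : EuclideanSpace ℝ (Fin n), x ≠ 0 →
            ut ((‖x‖^2)⁻¹ • x) = ‖x‖ ^ ((n:ℝ)-2-2*a) * ut x ∧
            vt ((‖x‖^2)⁻¹ • x) = ‖x‖ ^ ((n:ℝ)-2-2*a) * vt x) ∧
          (∀ e : EuclideanSpace ℝ (Fin n), ‖e‖ = 1 →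
            ∀ gu gv : ℝ → ℝ,
              gu = (fun t => Real.exp (-(((n:ℝ)-2-2*a)/2) * t) * ut (Real.exp (-t) • e)) →
              gv = (fun t => Real.exp (-(((n:ℝ)-2-2*a)/2) * t) * vt (Real.exp (-t) • e)) →
              (∀ t : ℝ, gu (-t) = gu t) ∧ StrictAntiOn gu (Set.Ioi 0) ∧
              (∀ t : ℝ, gv (-t) = gv t) ∧ StrictAntiOn gv (Set.Ioi 0))) := by
  have P := params_of_exponents hn ha hab hba hp hν hα hβ hαβ
  obtain ⟨τ, hτ, hsym, hlt⟩ := Sol.exists_radius P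
    ⟨hu, hv, hupos, hvpos, hueq, fun x hx => by rw [hveq x hx, react]; ring⟩ hEu hEv
  refine ⟨τ, hτ, ?_⟩
  rintro ut vt rfl rfl
  refine ⟨fun x hx => ?_, ?_⟩
  · have h1 := rescaled_inversion hτ (fun y hy => (hsym y hy).1) hx
    have h2 := rescaled_inversion hτ (fun y hy => (hsym y hy).2) hx
    rw [P.hk] at h1 h2
    exact ⟨h1, h2⟩
  · rintro e he gu gv rfl rfl
    exact ⟨emdenFowler_even hτ (fun y hy => (hsym y hy).1) he,
      emdenFowler_strictAntiOn hτ (fun l h0 h1 x hx hxl => (hlt l h0 h1 x hx hxl).1) he,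
      emdenFowler_even hτ (fun y hy => (hsym y hy).2) he,
      emdenFowler_strictAntiOn hτ (fun l h0 h1 x hx hxl => (hlt l h0 h1 x hx hxl).2) he⟩
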